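/- Let s ≥ 9 be an integer, let μ₁, …, μ_s be real numbers with μ₁ irrational, and let η > 0. Then there exists a real number τ₀ > 0 such that for every real number τ ≥ τ₀ there exist integers x₁, …, x_s with xᵢ > μᵢ for every i ∈ {1, …, s} and |F(x₁, …, x_s) − τ| < η. -/

import Mathlib

open Finset

/-- The additive character `x ↦ exp (2πix)`. -/
noncomputable def addChar (x : ℝ) : ℂ := Complex.exp (Complex.I * ((2 * Real.pi * x : ℝ) : ℂ))

theorem norm_addChar (x : ℝ) : ‖addChar x‖ = 1 := by
  rw [addChar, mul_comm, Complex.norm_exp_ofReal_mul_I]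

theorem addChar_add (x y : ℝ) : addChar (x + y) = addChar x * addChar y := by
  rw [addChar, addChar, addChar, ← Complex.exp_add]
  congr 1
  push_cast
  ring

theorem addChar_zero : addChar 0 = 1 := by simp [addChar]

theorem conj_addChar (x : ℝ) : (starRingEnd ℂ) (addChar x) = addChar (-x) := by
  rw [addChar, addChar, ← Complex.exp_conj]
  congr 1
  rw [map_mul, Complex.conj_I, Complex.conj_ofReal]
  push_cast
  ring

theorem addChar_mul_conj (x y : ℝ) :
    addChar x * (starRingEnd ℂ) (addChar y) = addChar (x - y) := by
  rw [conj_addChar, ← addChar_add, sub_eq_add_neg]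

theorem addChar_intCast (m : ℤ) : addChar m = 1 := by
  rw [addChar, Complex.exp_eq_one_iff]
  exact ⟨m, by push_cast; ring⟩

theorem addChar_re (x : ℝ) : (addChar x).re = Real.cos (2 * Real.pi * x) := by
  rw [addChar, mul_comm, Complex.exp_ofReal_mul_I_re]

theorem continuous_addChar : Continuous addChar := by
  unfold addChar
  fun_prop

theorem norm_addChar_sub_one (x : ℝ) : ‖addChar x - 1‖ = 2 * |Real.sin (Real.pi * x)| := by
  rw [addChar, Complex.norm_exp_I_mul_ofReal_sub_one, Real.norm_eq_abs, abs_mul, abs_two]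
  congr 3
  ring

theorem norm_addChar_sub_le (x y : ℝ) : ‖addChar x - addChar y‖ ≤ 2 * Real.pi * |x - y| := by
  have h : addChar x - addChar y = addChar y * (addChar (x - y) - 1) := by
    rw [mul_sub, ← addChar_add, mul_one]
    congr 2
    ring
  rw [h, norm_mul, norm_addChar, one_mul, norm_addChar_sub_one]
  have h1 := Real.abs_sin_le_abs (x := Real.pi * (x - y))
  rw [abs_mul, abs_of_pos Real.pi_pos] at h1
  linarith

/-- The distance from a real number to the nearest integer. -/
noncomputable def nearestDist (x : ℝ) : ℝ := |x - round x|

theorem nearestDist_nonneg (x : ℝ) : 0 ≤ nearestDist x := abs_nonneg _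

theorem nearestDist_le (x : ℝ) (m : ℤ) : nearestDist x ≤ |x - m| := round_le x m

theorem nearestDist_add_int (x : ℝ) (m : ℤ) : nearestDist (x + m) = nearestDist x := by
  simp [nearestDist]

theorem nearestDist_le_add (x y : ℝ) : nearestDist x ≤ nearestDist y + |x - y| := by
  have h := nearestDist_le x (round y)
  have h2 : |x - round y| ≤ |x - y| + |y - round y| := abs_sub_le _ _ _
  unfold nearestDist at *
  linarith

theorem four_mul_nearestDist_le (x : ℝ) : 4 * nearestDist x ≤ ‖addChar x - 1‖ := by
  have h : addChar x = addChar (x - round x) := by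
    conv_lhs => rw [← sub_add_cancel x (round x : ℝ), addChar_add, addChar_intCast, mul_one]
  rw [h, norm_addChar_sub_one, nearestDist]
  have h2 : |Real.pi * (x - round x)| ≤ Real.pi / 2 := by
    rw [abs_mul, abs_of_pos Real.pi_pos]
    nlinarith [abs_sub_round x, Real.pi_pos]
  have h3 := Real.mul_abs_le_abs_sin h2
  rw [abs_mul, abs_of_pos Real.pi_pos] at h3
  have h4 : 2 / Real.pi * (Real.pi * |x - round x|) = 2 * |x - round x| := by
    field_simp
  linarith

/-- A convenient majorant for a geometric exponential sum of length at most `N`. -/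
noncomputable def geomBound (N : ℕ) (x : ℝ) : ℝ := 2 * N / (1 + N * nearestDist x)

theorem geomBound_nonneg (N : ℕ) (x : ℝ) : 0 ≤ geomBound N x := by
  have := nearestDist_nonneg x
  unfold geomBound
  positivity

theorem norm_sum_addChar_linear_le_nat (M : ℕ) (b c : ℝ) :
    ‖∑ y ∈ range M, addChar (b * y + c)‖ ≤ M := by
  refine (norm_sum_le _ _).trans ?_
  simp [norm_addChar]

theorem nearestDist_mul_norm_sum_le (M : ℕ) (b c : ℝ) :
    2 * nearestDist b * ‖∑ y ∈ range M, addChar (b * y + c)‖ ≤ 1 := by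
  have key : (∑ y ∈ range M, addChar (b * y + c)) * (addChar b - 1)
      = addChar (b * M + c) - addChar c := by
    induction M with
    | zero => simp
    | succ M ih =>
      rw [sum_range_succ, add_mul, ih, mul_sub, ← addChar_add]
      push_cast
      rw [show b * ((M : ℝ) + 1) + c = b * M + c + b by ring]
      ring
  have h1 : ‖∑ y ∈ range M, addChar (b * y + c)‖ * ‖addChar b - 1‖ ≤ 2 := by
    rw [← norm_mul, key]
    refine (norm_sub_le _ _).trans ?_
    rw [norm_addChar, norm_addChar]
    norm_num
  have h2 := four_mul_nearestDist_le b
  nlinarith [norm_nonneg (∑ y ∈ range M, addChar (b * y + c))]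

theorem norm_sum_addChar_linear_le (M N : ℕ) (hMN : M ≤ N) (b c : ℝ) :
    ‖∑ y ∈ range M, addChar (b * y + c)‖ ≤ geomBound N b := by
  have h1 := norm_sum_addChar_linear_le_nat M b c
  have h2 := nearestDist_mul_norm_sum_le M b c
  have h3 := nearestDist_nonneg b
  have h4 : (M : ℝ) ≤ N := by exact_mod_cast hMN
  unfold geomBound
  rw [le_div_iff₀ (by positivity)]
  rcases Nat.eq_zero_or_pos M with rfl | hM
  · simp
  · have h5 : (1 : ℝ) ≤ M := by exact_mod_cast hM
    nlinarith [norm_nonneg (∑ y ∈ range M, addChar (b * y + c))]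

theorem norm_sq_sum_eq (u : ℕ → ℂ) (N : ℕ) :
    ‖∑ y ∈ range N, u y‖ ^ 2 = ∑ y ∈ range N, ‖u y‖ ^ 2
      + 2 * (∑ h ∈ Ico 1 N, ∑ y ∈ range (N - h), u (y + h) * (starRingEnd ℂ) (u y)).re := by
  induction N with
  | zero => simp
  | succ N ih =>
    have h1 : ∀ h ∈ Ico 1 (N + 1), ∑ y ∈ range (N + 1 - h), u (y + h) * (starRingEnd ℂ) (u y)
        = ∑ y ∈ range (N - h), u (y + h) * (starRingEnd ℂ) (u y)
          + u N * (starRingEnd ℂ) (u (N - h)) := by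
      intro h hh
      rw [mem_Ico] at hh
      rw [show N + 1 - h = (N - h) + 1 by omega, sum_range_succ,
        show N - h + h = N by omega]
    rw [sum_congr rfl h1, sum_add_distrib, ← mul_sum]
    have h2 : ∑ h ∈ Ico 1 (N + 1), (starRingEnd ℂ) (u (N - h))
        = (starRingEnd ℂ) (∑ y ∈ range N, u y) := by
      rw [map_sum, ← sum_range_reflect, sum_Ico_eq_sum_range]
      refine sum_congr (by simp) fun i hi => ?_
      congr 2
      omega
    have h3 : ∑ h ∈ Ico 1 (N + 1), ∑ y ∈ range (N - h), u (y + h) * (starRingEnd ℂ) (u y)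
        = ∑ h ∈ Ico 1 N, ∑ y ∈ range (N - h), u (y + h) * (starRingEnd ℂ) (u y) := by
      rcases Nat.eq_zero_or_pos N with rfl | hN
      · simp
      · rw [sum_Ico_succ_top hN]
        simp
    rw [h2, h3, sum_range_succ, sum_range_succ, Complex.add_re, mul_add]
    rw [Complex.sq_norm, Complex.normSq_add, ← Complex.sq_norm, ih, ← Complex.sq_norm]
    have h4 : ((∑ y ∈ range N, u y) * (starRingEnd ℂ) (u N)).re
        = (u N * (starRingEnd ℂ) (∑ y ∈ range N, u y)).re := by
      rw [Complex.mul_re, Complex.mul_re, Complex.conj_re, Complex.conj_im, Complex.conj_re,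
        Complex.conj_im]
      ring
    rw [h4]
    ring

/-- The van der Corput inequality with all shifts. -/
theorem norm_sq_sum_le (u : ℕ → ℂ) (N : ℕ) :
    ‖∑ y ∈ range N, u y‖ ^ 2 ≤ ∑ y ∈ range N, ‖u y‖ ^ 2
      + 2 * ∑ h ∈ Ico 1 N, ‖∑ y ∈ range (N - h), u (y + h) * (starRingEnd ℂ) (u y)‖ := by
  rw [norm_sq_sum_eq]
  have := (Complex.re_le_norm (∑ h ∈ Ico 1 N, ∑ y ∈ range (N - h),
    u (y + h) * (starRingEnd ℂ) (u y))).trans (norm_sum_le _ _)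
  linarith

/-- The exponential sum over `N` consecutive shifted cubes. -/
noncomputable def cubeSum (N : ℕ) (θ α : ℝ) : ℂ :=
  ∑ y ∈ range N, addChar (α * (y + θ) ^ 3)

theorem continuous_cubeSum (N : ℕ) (θ : ℝ) : Continuous (cubeSum N θ) := by
  unfold cubeSum
  exact continuous_finsetSum _ fun y _ => continuous_addChar.comp (by fun_prop)

theorem norm_cubeSum_le (N : ℕ) (θ α : ℝ) : ‖cubeSum N θ α‖ ≤ N := by
  refine (norm_sum_le _ _).trans ?_
  simp [norm_addChar]

/-- The sum of geometric majorants in the Weyl inequality for cubes. -/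
noncomputable def weylSum (N : ℕ) (α : ℝ) : ℝ :=
  ∑ h ∈ Ico 1 N, ∑ k ∈ Ico 1 N, geomBound N (α * (6 * h * k : ℕ))

theorem norm_sq_differenced_le (N h : ℕ) (θ α : ℝ) :
    ‖∑ y ∈ range (N - h), addChar (α * ((y + h : ℕ) + θ) ^ 3)
        * (starRingEnd ℂ) (addChar (α * (y + θ) ^ 3))‖ ^ 2
      ≤ N + 2 * ∑ k ∈ Ico 1 N, geomBound N (α * (6 * h * k : ℕ)) := by
  have h0 := norm_sq_sum_le (fun y : ℕ => addChar (α * ((y + h : ℕ) + θ) ^ 3)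
        * (starRingEnd ℂ) (addChar (α * (y + θ) ^ 3))) (N - h)
  refine h0.trans ?_
  have h1 : ∀ y ∈ range (N - h), ‖addChar (α * ((y + h : ℕ) + θ) ^ 3)
        * (starRingEnd ℂ) (addChar (α * (y + θ) ^ 3))‖ ^ 2 = 1 := by
    intro y _
    rw [addChar_mul_conj, norm_addChar, one_pow]
  have h2 : ∑ y ∈ range (N - h), ‖addChar (α * ((y + h : ℕ) + θ) ^ 3)
        * (starRingEnd ℂ) (addChar (α * (y + θ) ^ 3))‖ ^ 2 ≤ N := by
    rw [sum_congr rfl h1]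
    simp
  have h3 : ∑ k ∈ Ico 1 (N - h), geomBound N (α * (6 * h * k : ℕ))
      ≤ ∑ k ∈ Ico 1 N, geomBound N (α * (6 * h * k : ℕ)) :=
    sum_le_sum_of_subset_of_nonneg (Ico_subset_Ico_right (by omega))
      fun _ _ _ => geomBound_nonneg _ _
  refine add_le_add h2 (mul_le_mul_of_nonneg_left (le_trans (sum_le_sum fun k hk => ?_) h3)
    (by norm_num))
  have h4 : ∀ y ∈ range (N - h - k), addChar (α * ((y + k + h : ℕ) + θ) ^ 3)
        * (starRingEnd ℂ) (addChar (α * ((y + k : ℕ) + θ) ^ 3))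
      * (starRingEnd ℂ) (addChar (α * ((y + h : ℕ) + θ) ^ 3)
        * (starRingEnd ℂ) (addChar (α * (y + θ) ^ 3)))
      = addChar (α * (6 * h * k : ℕ) * y
        + α * (3 * h * k * (2 * θ + h + k))) := by
    intro y _
    rw [addChar_mul_conj, addChar_mul_conj, addChar_mul_conj]
    congr 1
    push_cast
    ring
  rw [sum_congr rfl h4]
  exact norm_sum_addChar_linear_le _ _ (by omega) _ _

/-- The Weyl inequality for shifted cubes, before inserting a rational approximation. -/
theorem norm_cubeSum_pow_four_le (N : ℕ) (θ α : ℝ) :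
    ‖cubeSum N θ α‖ ^ 4 ≤ 10 * N ^ 3 + 16 * N * weylSum N α := by
  set T : ℕ → ℝ := fun h => ‖∑ y ∈ range (N - h), addChar (α * ((y + h : ℕ) + θ) ^ 3)
        * (starRingEnd ℂ) (addChar (α * (y + θ) ^ 3))‖ with hT
  have h0 : ‖cubeSum N θ α‖ ^ 2 ≤ N + 2 * ∑ h ∈ Ico 1 N, T h := by
    have := norm_sq_sum_le (fun y : ℕ => addChar (α * (y + θ) ^ 3)) N
    simpa [norm_addChar, cubeSum, hT] using this
  have hN : (0 : ℝ) ≤ N := by positivity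
  have h1 : (∑ h ∈ Ico 1 N, T h) ^ 2 ≤ N * ∑ h ∈ Ico 1 N, T h ^ 2 := by
    refine sq_sum_le_card_mul_sum_sq.trans ?_
    refine mul_le_mul_of_nonneg_right ?_ (sum_nonneg fun _ _ => sq_nonneg _)
    rw [Nat.card_Ico]
    exact_mod_cast Nat.sub_le _ _
  have h2 : ∑ h ∈ Ico 1 N, T h ^ 2 ≤ N * N + 2 * weylSum N α := by
    calc ∑ h ∈ Ico 1 N, T h ^ 2
        ≤ ∑ h ∈ Ico 1 N, ((N : ℝ) + 2 * ∑ k ∈ Ico 1 N, geomBound N (α * (6 * h * k : ℕ))) :=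
          sum_le_sum fun h _ => norm_sq_differenced_le N h θ α
      _ ≤ _ := by
          rw [sum_add_distrib, ← mul_sum, weylSum]
          gcongr
          rw [sum_const, Nat.card_Ico, nsmul_eq_mul]
          gcongr
          exact_mod_cast Nat.sub_le _ _
  have h3 : 0 ≤ ∑ h ∈ Ico 1 N, T h := sum_nonneg fun _ _ => norm_nonneg _
  have h4 : ‖cubeSum N θ α‖ ^ 4 ≤ (N + 2 * ∑ h ∈ Ico 1 N, T h) ^ 2 := by
    rw [show 4 = 2 * 2 by norm_num, pow_mul]
    gcongr
  have h5 : (N : ℝ) ^ 2 ≤ N ^ 3 := by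
    rcases Nat.eq_zero_or_pos N with h | h
    · simp [h]
    · exact pow_le_pow_right₀ (by exact_mod_cast h) (by norm_num)
  have h6 : (N : ℝ) * ∑ h ∈ Ico 1 N, T h ^ 2 ≤ N * (N * N + 2 * weylSum N α) :=
    mul_le_mul_of_nonneg_left h2 hN
  nlinarith [sq_nonneg ((N : ℝ) - 2 * ∑ h ∈ Ico 1 N, T h)]

theorem exists_card_divisors_le_rpow {ε : ℝ} (hε : 0 < ε) :
    ∃ C : ℝ, 1 ≤ C ∧ ∀ n : ℕ, n ≠ 0 → (#n.divisors : ℝ) ≤ C * (n : ℝ) ^ ε := by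
  obtain ⟨K, hK⟩ := exists_nat_ge ((2 : ℝ) ^ (1 / ε))
  have hlog : 0 < Real.log 2 := Real.log_pos (by norm_num)
  set B : ℝ := 1 + 1 / (ε * Real.log 2) with hB
  have hB1 : 1 ≤ B := by
    rw [hB]
    have : 0 < 1 / (ε * Real.log 2) := by positivity
    linarith
  have hpow : ∀ (p a : ℕ), 2 ≤ p → (a : ℝ) + 1 ≤ B * ((p : ℝ) ^ a) ^ ε := by
    intro p a hp
    have h2 : (2 : ℝ) ≤ p := by exact_mod_cast hp
    have h3 : 1 + a * (ε * Real.log 2) ≤ ((p : ℝ) ^ a) ^ ε := by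
      calc 1 + a * (ε * Real.log 2) ≤ Real.exp (a * (ε * Real.log 2)) := by
            linarith [Real.add_one_le_exp (a * (ε * Real.log 2))]
        _ = ((2 : ℝ) ^ a) ^ ε := by
            rw [← Real.rpow_natCast, ← Real.rpow_mul (by norm_num),
              Real.rpow_def_of_pos (by norm_num)]
            congr 1
            ring
        _ ≤ _ := by gcongr
    have hx : 0 < ε * Real.log 2 := by positivity
    have h4 : (a : ℝ) + 1 ≤ B * (1 + a * (ε * Real.log 2)) := by
      have : B * (1 + a * (ε * Real.log 2))
          = 1 + a * (ε * Real.log 2) + 1 / (ε * Real.log 2) + a := by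
        rw [hB]
        field_simp
        ring
      rw [this]
      have : 0 < 1 / (ε * Real.log 2) := by positivity
      have : 0 ≤ a * (ε * Real.log 2) := by positivity
      linarith
    exact h4.trans (mul_le_mul_of_nonneg_left h3 (by linarith))
  have hbig : ∀ (p a : ℕ), K ≤ p → (a : ℝ) + 1 ≤ ((p : ℝ) ^ a) ^ ε := by
    intro p a hp
    have h2 : (2 : ℝ) ^ (1 / ε) ≤ p := hK.trans (by exact_mod_cast hp)
    have h3 : (2 : ℝ) ≤ (p : ℝ) ^ ε := by
      calc (2 : ℝ) = ((2 : ℝ) ^ (1 / ε)) ^ ε := by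
            rw [← Real.rpow_mul (by norm_num), one_div_mul_cancel hε.ne', Real.rpow_one]
        _ ≤ _ := by gcongr
    have h4 : ((p : ℝ) ^ a) ^ ε = ((p : ℝ) ^ ε) ^ a := by
      rw [← Real.rpow_natCast, ← Real.rpow_natCast, ← Real.rpow_mul (by positivity),
        ← Real.rpow_mul (by positivity), mul_comm]
    rw [h4]
    calc (a : ℝ) + 1 ≤ 2 ^ a := by exact_mod_cast Nat.lt_two_pow_self
      _ ≤ _ := by gcongr
  refine ⟨B ^ K, one_le_pow₀ hB1, fun n hn => ?_⟩
  rw [Nat.card_divisors hn]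
  push_cast
  calc ∏ p ∈ n.primeFactors, ((n.factorization p : ℝ) + 1)
      ≤ ∏ p ∈ n.primeFactors, ((if p < K then B else 1) * ((p : ℝ) ^ n.factorization p) ^ ε) := by
        refine prod_le_prod (fun _ _ => by positivity) fun p hp => ?_
        split_ifs with h
        · exact hpow p _ (Nat.prime_of_mem_primeFactors hp).two_le
        · rw [one_mul]
          exact hbig p _ (not_lt.mp h)
    _ = (∏ p ∈ n.primeFactors, if p < K then B else 1) * (n : ℝ) ^ ε := by
        rw [prod_mul_distrib, Real.finsetProd_rpow _ _ (fun _ _ => by positivity)]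
        congr 2
        conv_rhs => rw [← Nat.prod_factorization_pow_eq_self hn]
        rw [Finsupp.prod]
        push_cast
        rfl
    _ ≤ B ^ K * (n : ℝ) ^ ε := by
        gcongr
        rw [prod_ite, prod_const, prod_const_one, mul_one]
        refine pow_le_pow_right₀ hB1 ?_
        calc #{p ∈ n.primeFactors | p < K} ≤ #(range K) := by
              refine card_le_card fun p hp => ?_
              rw [mem_filter] at hp
              exact mem_range.mpr hp.2
          _ = K := card_range K

theorem sum_Ico_rpow_neg_two_thirds_le (J : ℕ) :
    ∑ j ∈ Ico 1 (J + 1), (j : ℝ) ^ (-(2 / 3) : ℝ) ≤ 3 * (J : ℝ) ^ (1 / 3 : ℝ) := by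
  induction J with
  | zero => simp
  | succ J ih =>
    rw [sum_Ico_succ_top (by omega)]
    have h : ((J + 1 : ℕ) : ℝ) ^ (-(2 / 3) : ℝ)
        ≤ 3 * ((J + 1 : ℕ) : ℝ) ^ (1 / 3 : ℝ) - 3 * (J : ℝ) ^ (1 / 3 : ℝ) := by
      set a : ℝ := ((J + 1 : ℕ) : ℝ) ^ (1 / 3 : ℝ) with ha
      set b : ℝ := (J : ℝ) ^ (1 / 3 : ℝ) with hb
      have ha3 : a ^ 3 = J + 1 := by
        rw [ha, ← Real.rpow_natCast, ← Real.rpow_mul (by positivity)]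
        norm_num
      have hb3 : b ^ 3 = J := by
        rw [hb, ← Real.rpow_natCast, ← Real.rpow_mul (by positivity)]
        norm_num
      have ha2 : ((J + 1 : ℕ) : ℝ) ^ (-(2 / 3) : ℝ) = (a ^ 2)⁻¹ := by
        rw [ha, ← Real.rpow_natCast, ← Real.rpow_mul (by positivity),
            ← Real.rpow_neg (by positivity)]
        norm_num
      have hapos : 0 < a := by positivity
      have hbnn : 0 ≤ b := by positivity
      have hba : b ≤ a := by
        rw [ha, hb]
        gcongr
        simp
      rw [ha2, inv_le_iff_one_le_mul₀ (by positivity)]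
      have h1 : (a - b) * (a ^ 2 + a * b + b ^ 2) = 1 := by
        have : (a - b) * (a ^ 2 + a * b + b ^ 2) = a ^ 3 - b ^ 3 := by ring
        rw [this, ha3, hb3]
        ring
      have h2 : a ^ 2 + a * b + b ^ 2 ≤ 3 * a ^ 2 := by nlinarith
      nlinarith
    linarith

theorem sum_multiples_rpow_le (X e : ℕ) (he : 0 < e) :
    ∑ k ∈ Ico 1 X with e ∣ k, (k : ℝ) ^ (-(2 / 3) : ℝ) ≤ 3 * (X : ℝ) ^ (1 / 3 : ℝ) / e := by
  have h1 : ∑ k ∈ Ico 1 X with e ∣ k, (k : ℝ) ^ (-(2 / 3) : ℝ)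
      ≤ ∑ j ∈ Ico 1 (X / e + 1), ((e * j : ℕ) : ℝ) ^ (-(2 / 3) : ℝ) := by
    rw [← sum_image (f := fun k : ℕ => (k : ℝ) ^ (-(2 / 3) : ℝ)) (g := fun j => e * j)
      (fun a _ b _ hab => Nat.eq_of_mul_eq_mul_left he hab)]
    refine sum_le_sum_of_subset_of_nonneg (fun k hk => ?_) fun _ _ _ => by positivity
    rw [mem_filter, mem_Ico] at hk
    obtain ⟨⟨hk1, hk2⟩, j, rfl⟩ := hk
    rw [mem_image]
    refine ⟨j, ?_, rfl⟩
    rw [mem_Ico]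
    refine ⟨Nat.pos_of_mul_pos_left hk1, ?_⟩
    rw [Nat.lt_succ_iff, Nat.le_div_iff_mul_le he, mul_comm]
    exact hk2.le
  refine h1.trans ?_
  have heR : (0 : ℝ) < e := by exact_mod_cast he
  have h2 : ∀ j ∈ Ico 1 (X / e + 1), ((e * j : ℕ) : ℝ) ^ (-(2 / 3) : ℝ)
      = (e : ℝ) ^ (-(2 / 3) : ℝ) * (j : ℝ) ^ (-(2 / 3) : ℝ) := by
    intro j _
    push_cast
    rw [Real.mul_rpow (by positivity) (by positivity)]
  rw [sum_congr rfl h2, ← mul_sum]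
  have h3 := sum_Ico_rpow_neg_two_thirds_le (X / e)
  have h4 : ((X / e : ℕ) : ℝ) ^ (1 / 3 : ℝ) ≤ (X : ℝ) ^ (1 / 3 : ℝ) * (e : ℝ) ^ (-(1 / 3) : ℝ) := by
    rw [Real.rpow_neg heR.le, ← div_eq_mul_inv, ← Real.div_rpow (by positivity) (by positivity)]
    gcongr
    exact Nat.cast_div_le
  calc (e : ℝ) ^ (-(2 / 3) : ℝ) * ∑ j ∈ Ico 1 (X / e + 1), (j : ℝ) ^ (-(2 / 3) : ℝ)
      ≤ (e : ℝ) ^ (-(2 / 3) : ℝ) * (3 * ((X : ℝ) ^ (1 / 3 : ℝ) * (e : ℝ) ^ (-(1 / 3) : ℝ))) := by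
        gcongr
        linarith
    _ = 3 * (X : ℝ) ^ (1 / 3 : ℝ) * ((e : ℝ) ^ (-(2 / 3) : ℝ) * (e : ℝ) ^ (-(1 / 3) : ℝ)) := by ring
    _ = _ := by
        have h5 : (e : ℝ) ^ (-(2 / 3) : ℝ) * (e : ℝ) ^ (-(1 / 3) : ℝ) = (e : ℝ)⁻¹ := by
          rw [← Real.rpow_add heR, ← Real.rpow_neg_one]
          norm_num
        rw [h5]
        exact (div_eq_mul_inv _ _).symm

theorem sum_resonant_rpow_le (N q : ℕ) (hq : 0 < q) :
    ∑ p ∈ (Ico 1 N ×ˢ Ico 1 N) with q ∣ 6 * p.1 * p.2,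
        ((6 * p.1 : ℕ) : ℝ) ^ (-(2 / 3) : ℝ) * (p.2 : ℝ) ^ (-(2 / 3) : ℝ)
      ≤ 18 * (N : ℝ) ^ (2 / 3 : ℝ) * #q.divisors / q := by
  set f : ℕ × ℕ → ℝ := fun p =>
    ((6 * p.1 : ℕ) : ℝ) ^ (-(2 / 3) : ℝ) * (p.2 : ℝ) ^ (-(2 / 3) : ℝ) with hf
  have hf0 : ∀ p, 0 ≤ f p := fun p => by positivity
  have h1 : ∑ p ∈ (Ico 1 N ×ˢ Ico 1 N) with q ∣ 6 * p.1 * p.2, f p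
      ≤ ∑ d ∈ q.divisors, ∑ p ∈ {h ∈ Ico 1 N | d ∣ 6 * h} ×ˢ {k ∈ Ico 1 N | q / d ∣ k}, f p := by
    have h2 : ∀ d ∈ q.divisors, ∑ p ∈ {h ∈ Ico 1 N | d ∣ 6 * h} ×ˢ {k ∈ Ico 1 N | q / d ∣ k}, f p
        = ∑ p ∈ Ico 1 N ×ˢ Ico 1 N, if d ∣ 6 * p.1 ∧ q / d ∣ p.2 then f p else 0 := by
      intro d _
      rw [← sum_filter, ← filter_product]
    rw [sum_congr rfl h2, sum_comm, sum_filter]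
    refine sum_le_sum fun p _ => ?_
    have h3 : ∀ d ∈ q.divisors, 0 ≤ if d ∣ 6 * p.1 ∧ q / d ∣ p.2 then f p else 0 := by
      intro d _
      split_ifs
      · exact hf0 p
      · exact le_rfl
    split_ifs with hp
    · have hg : Nat.gcd q (6 * p.1) ∈ q.divisors :=
        Nat.mem_divisors.mpr ⟨Nat.gcd_dvd_left _ _, hq.ne'⟩
      refine le_trans (le_of_eq ?_) (single_le_sum h3 hg)
      rw [if_pos]
      refine ⟨Nat.gcd_dvd_right _ _, ?_⟩
      have hpos : 0 < Nat.gcd q (6 * p.1) := Nat.gcd_pos_of_pos_left _ hq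
      have hc := Nat.coprime_div_gcd_div_gcd hpos
      refine hc.dvd_of_dvd_mul_left ?_
      have := Nat.div_dvd_div (Nat.gcd_dvd_left q (6 * p.1)) hp
      rwa [mul_comm (6 * p.1), Nat.mul_div_assoc _ (Nat.gcd_dvd_right q (6 * p.1)),
          mul_comm p.2] at this
    · exact sum_nonneg h3
  refine h1.trans ?_
  have h4 : ∀ d ∈ q.divisors,
      ∑ p ∈ {h ∈ Ico 1 N | d ∣ 6 * h} ×ˢ {k ∈ Ico 1 N | q / d ∣ k}, f p
        ≤ 18 * (N : ℝ) ^ (2 / 3 : ℝ) / q := by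
    intro d hd
    have hdq := Nat.dvd_of_mem_divisors hd
    have hd0 : 0 < d := Nat.pos_of_mem_divisors hd
    have he0 : 0 < q / d := Nat.div_pos (Nat.le_of_dvd hq hdq) hd0
    have hde : (d : ℝ) * (q / d : ℕ) = q := by
      exact_mod_cast Nat.mul_div_cancel' hdq
    have hs : ∑ p ∈ {h ∈ Ico 1 N | d ∣ 6 * h} ×ˢ {k ∈ Ico 1 N | q / d ∣ k}, f p
        = (∑ h ∈ Ico 1 N with d ∣ 6 * h, ((6 * h : ℕ) : ℝ) ^ (-(2 / 3) : ℝ))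
          * ∑ k ∈ Ico 1 N with q / d ∣ k, (k : ℝ) ^ (-(2 / 3) : ℝ) := by
      rw [sum_mul_sum, sum_product]
    have ha : ∑ h ∈ Ico 1 N with d ∣ 6 * h, ((6 * h : ℕ) : ℝ) ^ (-(2 / 3) : ℝ)
        ≤ 3 * ((6 * N : ℕ) : ℝ) ^ (1 / 3 : ℝ) / d := by
      refine le_trans ?_ (sum_multiples_rpow_le (6 * N) d hd0)
      rw [← sum_image (f := fun k : ℕ => (k : ℝ) ^ (-(2 / 3) : ℝ)) (g := fun j => 6 * j)
        (fun a _ b _ hab => by simpa using hab)]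
      refine sum_le_sum_of_subset_of_nonneg (fun k hk => ?_) fun _ _ _ => by positivity
      rw [mem_image] at hk
      obtain ⟨j, hj, rfl⟩ := hk
      rw [mem_filter, mem_Ico] at hj ⊢
      refine ⟨⟨by omega, by omega⟩, hj.2⟩
    have hb := sum_multiples_rpow_le N (q / d) he0
    have h6 : ((6 * N : ℕ) : ℝ) ^ (1 / 3 : ℝ) ≤ 2 * (N : ℝ) ^ (1 / 3 : ℝ) := by
      push_cast
      rw [Real.mul_rpow (by norm_num) (by positivity)]
      gcongr
      calc (6 : ℝ) ^ (1 / 3 : ℝ) ≤ 8 ^ (1 / 3 : ℝ) := by gcongr; norm_num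
        _ = 2 := by
          rw [show (8 : ℝ) = 2 ^ (3 : ℝ) by norm_num, ← Real.rpow_mul (by norm_num)]
          norm_num
    have h7 : (N : ℝ) ^ (1 / 3 : ℝ) * (N : ℝ) ^ (1 / 3 : ℝ) = (N : ℝ) ^ (2 / 3 : ℝ) := by
      rw [← Real.rpow_add_of_nonneg (by positivity) (by norm_num) (by norm_num)]
      norm_num
    have hd0R : (0 : ℝ) < d := by exact_mod_cast hd0
    have he0R : (0 : ℝ) < (q / d : ℕ) := by exact_mod_cast he0
    rw [hs, ← hde, ← h7]
    calc _ ≤ (3 * (2 * (N : ℝ) ^ (1 / 3 : ℝ)) / d) * (3 * (N : ℝ) ^ (1 / 3 : ℝ) / (q / d : ℕ)) := by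
          refine mul_le_mul (ha.trans (by gcongr)) hb (sum_nonneg fun _ _ => by positivity)
            (by positivity)
      _ = _ := by
          field_simp
          ring
  refine (sum_le_card_nsmul _ _ _ h4).trans (le_of_eq ?_)
  rw [nsmul_eq_mul]
  ring

theorem sum_range_mul_of_periodic (f : ℕ → ℝ) (q : ℕ) (hf : ∀ m, f (m + q) = f m) (T : ℕ) :
    ∑ m ∈ range (q * T), f m = T * ∑ m ∈ range q, f m := by
  have hf' : ∀ t m, f (q * t + m) = f m := by
    intro t m
    induction t with
    | zero => simp
    | succ t ih =>
      rw [← ih, ← hf (q * t + m)]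
      congr 1
      ring
  induction T with
  | zero => simp
  | succ T ih =>
    rw [mul_add, mul_one, sum_range_add, ih, sum_congr rfl fun m _ => hf' T m]
    push_cast
    ring

theorem inv_nearestDist_div_le (j q : ℕ) (hjq : j < q) :
    (nearestDist ((j : ℝ) / q))⁻¹ ≤ q * ((j : ℝ)⁻¹ + ((q - j : ℕ) : ℝ)⁻¹) := by
  rw [nearestDist, abs_sub_round_div_natCast_eq, Nat.mod_eq_of_lt hjq, inv_div, div_eq_mul_inv]
  have : 0 < q - j := by omega
  gcongr
  rcases min_cases j (q - j) with h | h <;> rw [h.1]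
  · simp
  · simp

theorem sum_inv_nearestDist_div_le (q : ℕ) (hq : 0 < q) :
    ∑ j ∈ range q, (nearestDist ((j : ℝ) / q))⁻¹ ≤ 2 * q * (1 + Real.log q) := by
  obtain ⟨p, rfl⟩ : ∃ p, q = p + 1 := ⟨q - 1, by omega⟩
  rw [sum_range_succ']
  have h0 : (nearestDist (((0 : ℕ) : ℝ) / (p + 1 : ℕ)))⁻¹ = 0 := by
    simp [nearestDist]
  rw [h0, add_zero]
  have hH : ∑ i ∈ range p, (((i + 1 : ℕ) : ℝ))⁻¹ ≤ 1 + Real.log (p + 1 : ℕ) := by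
    have h1 := harmonic_le_one_add_log p
    rw [harmonic] at h1
    push_cast at h1 ⊢
    refine h1.trans ?_
    rcases Nat.eq_zero_or_pos p with rfl | hp
    · simp
    · have : (0 : ℝ) < p := by exact_mod_cast hp
      gcongr
      linarith
  have hH' : ∑ i ∈ range p, (((p + 1 - (i + 1) : ℕ) : ℝ))⁻¹
      = ∑ i ∈ range p, (((i + 1 : ℕ) : ℝ))⁻¹ := by
    rw [← sum_range_reflect]
    refine sum_congr rfl fun i hi => ?_
    rw [mem_range] at hi
    congr 2
    omega
  calc ∑ i ∈ range p, (nearestDist (((i + 1 : ℕ) : ℝ) / (p + 1 : ℕ)))⁻¹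
      ≤ ∑ i ∈ range p, ((p + 1 : ℕ) : ℝ)
        * ((((i + 1 : ℕ) : ℝ))⁻¹ + ((p + 1 - (i + 1) : ℕ) : ℝ)⁻¹) := by
        refine sum_le_sum fun i hi => ?_
        rw [mem_range] at hi
        exact inv_nearestDist_div_le _ _ (by omega)
    _ = ((p + 1 : ℕ) : ℝ) * (2 * ∑ i ∈ range p, (((i + 1 : ℕ) : ℝ))⁻¹) := by
        rw [← mul_sum, sum_add_distrib, hH']
        ring
    _ ≤ ((p + 1 : ℕ) : ℝ) * (2 * (1 + Real.log (p + 1 : ℕ))) := by gcongr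
    _ = _ := by ring

theorem nearestDist_rat_mul (r : ℚ) (m : ℕ) :
    nearestDist ((r : ℝ) * m) = nearestDist ((((r.num * m) % r.den).toNat : ℝ) / r.den) := by
  have hq : (r.den : ℤ) ≠ 0 := by exact_mod_cast r.den_nz
  have hqR : (r.den : ℝ) ≠ 0 := by exact_mod_cast r.den_nz
  have h1 : ((((r.num * m) % r.den).toNat : ℕ) : ℤ) = (r.num * m) % r.den :=
    Int.toNat_of_nonneg (Int.emod_nonneg _ hq)
  have h2 : ((((r.num * m) % r.den).toNat : ℕ) : ℝ) = ((r.num * m : ℤ) : ℝ)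
      - r.den * ((r.num * m / r.den : ℤ) : ℝ) := by
    have h3 : ((((r.num * m) % r.den).toNat : ℕ) : ℝ) = (((r.num * m) % r.den : ℤ) : ℝ) := by
      have := congrArg (Int.cast : ℤ → ℝ) h1
      rwa [Int.cast_natCast] at this
    rw [h3, Int.emod_def]
    push_cast
    ring
  rw [h2]
  conv_rhs => rw [← nearestDist_add_int _ (r.num * m / r.den)]
  congr 1
  rw [Rat.cast_def]
  push_cast
  field_simp
  ring

theorem sum_inv_nearestDist_rat_le (r : ℚ) :
    ∑ m ∈ range r.den, (nearestDist ((r : ℝ) * m))⁻¹ ≤ 2 * r.den * (1 + Real.log r.den) := by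
  refine le_trans (le_of_eq ?_) (sum_inv_nearestDist_div_le r.den r.den_pos)
  have hq : (0 : ℤ) < r.den := by exact_mod_cast r.den_pos
  have hmaps : ∀ m ∈ range r.den, ((r.num * m) % r.den).toNat ∈ range r.den := by
    intro m _
    rw [mem_range]
    have := Int.emod_lt_of_pos (r.num * m) hq
    omega
  have hinj : ∀ a ∈ range r.den, ∀ b ∈ range r.den,
      ((r.num * a) % r.den).toNat = ((r.num * b) % r.den).toNat → a = b := by
    intro a ha b hb hab
    rw [mem_range] at ha hb
    have h1 := Int.emod_nonneg (r.num * a) hq.ne'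
    have h2 := Int.emod_nonneg (r.num * b) hq.ne'
    have h3 : (r.num * a) % r.den = (r.num * b) % r.den := by omega
    have h4 : (r.den : ℤ) ∣ r.num * (b - a) := by
      rw [mul_sub]
      exact (Int.ModEq.dvd h3)
    have hc : IsCoprime (r.den : ℤ) r.num := by
      rw [Int.isCoprime_iff_gcd_eq_one, Int.gcd_comm]
      exact r.reduced
    have h5 := hc.dvd_of_dvd_mul_left h4
    have h6 : (b : ℤ) - a = 0 := Int.eq_zero_of_abs_lt_dvd h5 (by rw [abs_lt]; omega)
    omega
  refine sum_bij (fun m _ => ((r.num * m) % r.den).toNat) hmaps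
    (fun a ha b hb => hinj a ha b hb) ?_ fun m _ => by rw [nearestDist_rat_mul]
  intro b hb
  obtain ⟨a, ha, hab⟩ := surj_on_of_inj_on_of_card_le (s := range r.den) (t := range r.den)
    (fun m _ => ((r.num * m) % r.den).toNat) hmaps (fun a b ha hb => hinj a ha b hb) le_rfl b hb
  exact ⟨a, ha, hab.symm⟩

theorem sum_inv_nearestDist_rat_range_le (r : ℚ) (X : ℕ) :
    ∑ m ∈ range X, (nearestDist ((r : ℝ) * m))⁻¹ ≤ 2 * (X + r.den) * (1 + Real.log r.den) := by
  have hq : 0 < r.den := r.den_pos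
  have hqR : (0 : ℝ) < r.den := by exact_mod_cast hq
  have hqR0 : (r.den : ℝ) ≠ 0 := hqR.ne'
  have h1 : ∑ m ∈ range X, (nearestDist ((r : ℝ) * m))⁻¹
      ≤ ∑ m ∈ range (r.den * (X / r.den + 1)), (nearestDist ((r : ℝ) * m))⁻¹ := by
    refine sum_le_sum_of_subset_of_nonneg ?_ fun _ _ _ => inv_nonneg.mpr (nearestDist_nonneg _)
    rw [range_subset_range]
    exact (Nat.lt_mul_div_succ X hq).le
  rw [sum_range_mul_of_periodic _ r.den] at h1
  · refine h1.trans ?_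
    have h2 := sum_inv_nearestDist_rat_le r
    have h3 : 0 ≤ ∑ m ∈ range r.den, (nearestDist ((r : ℝ) * m))⁻¹ :=
      sum_nonneg fun _ _ => inv_nonneg.mpr (nearestDist_nonneg _)
    have h4 : ((X / r.den + 1 : ℕ) : ℝ) ≤ X / r.den + 1 := by
      push_cast
      gcongr
      exact Nat.cast_div_le
    calc _ ≤ ((X : ℝ) / r.den + 1) * (2 * r.den * (1 + Real.log r.den)) := by gcongr
      _ = _ := by field_simp
  · intro m
    rw [← nearestDist_add_int ((r : ℝ) * m) r.num]
    congr 2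
    have h5 : (r : ℝ) * r.den = r.num := by
      rw [Rat.cast_def]
      field_simp
    rw [Nat.cast_add, mul_add, h5]

theorem abs_le_nearestDist {x : ℝ} (hx : |x| ≤ 1 / 2) : |x| ≤ nearestDist x := by
  rw [nearestDist]
  by_cases h : round x = 0
  · simp [h]
  · have h1 : (1 : ℝ) ≤ |(round x : ℝ)| := by exact_mod_cast Int.one_le_abs h
    have h2 := abs_sub_abs_le_abs_sub (round x : ℝ) x
    rw [abs_sub_comm] at h2
    linarith

theorem geomBound_le_of_resonant {N h k : ℕ} {α : ℝ} {r : ℚ} (hN : 0 < N) (hh : 0 < h) (hk : 0 < k)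
    (hdvd : r.den ∣ 6 * h * k) (hsmall : |α - r| * (6 * h * k : ℕ) ≤ 1 / 2)
    (hlt : 6 * h * k ≤ 6 * N ^ 2) :
    geomBound N (α * (6 * h * k : ℕ)) ≤ 14 * (N : ℝ) ^ (7 / 3 : ℝ)
      * (max 1 ((N : ℝ) ^ 3 * |α - r|)) ^ (-(2 / 3) : ℝ)
      * (((6 * h : ℕ) : ℝ) ^ (-(2 / 3) : ℝ) * (k : ℝ) ^ (-(2 / 3) : ℝ)) := by
  have hNR : (0 : ℝ) < N := by exact_mod_cast hN
  set m : ℕ := 6 * h * k with hm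
  have hm0 : 0 < m := by positivity
  have hmR : (0 : ℝ) < m := by exact_mod_cast hm0
  have hmN : (m : ℝ) ≤ 6 * N ^ 2 := by exact_mod_cast hlt
  have h1 : |α - r| * m ≤ nearestDist (α * m) := by
    obtain ⟨t, ht⟩ := hdvd
    have h2 : nearestDist (α * m) = nearestDist ((α - r) * m) := by
      rw [← nearestDist_add_int ((α - r) * m) (r.num * t)]
      congr 1
      have h5 : (r : ℝ) * r.den = r.num := by
        have : (r.den : ℝ) ≠ 0 := by exact_mod_cast r.den_nz
        rw [Rat.cast_def]
        field_simp
      rw [ht]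
      push_cast
      rw [← h5]
      ring
    rw [h2]
    have h3 : |(α - r) * m| = |α - r| * m := by rw [abs_mul, abs_of_pos hmR]
    rw [← h3]
    refine abs_le_nearestDist ?_
    rwa [h3]
  set B : ℝ := max 1 ((N : ℝ) ^ 3 * |α - r|) with hB
  have hB1 : 1 ≤ B := le_max_left _ _
  have hB0 : 0 < B := by linarith
  have h4 : B ≤ 1 + (N : ℝ) ^ 3 * |α - r| := by
    rw [hB]
    have : 0 ≤ (N : ℝ) ^ 3 * |α - r| := by positivity
    exact max_le (by linarith) (by linarith)
  have h5 : (m : ℝ) / N ^ 2 * B ≤ 6 + N * nearestDist (α * m) := by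
    calc (m : ℝ) / N ^ 2 * B ≤ m / N ^ 2 * (1 + (N : ℝ) ^ 3 * |α - r|) := by gcongr
      _ = m / N ^ 2 + N * (|α - r| * m) := by
        field_simp
      _ ≤ _ := by
        have : (m : ℝ) / N ^ 2 ≤ 6 := by
          rw [div_le_iff₀ (by positivity)]
          exact hmN
        have := mul_le_mul_of_nonneg_left h1 hNR.le
        linarith
  set z : ℝ := (m : ℝ) / N ^ 2 * B with hz
  have hz0 : 0 < z := by positivity
  have hnd : 0 ≤ N * nearestDist (α * m) := mul_nonneg hNR.le (nearestDist_nonneg _)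
  have h6 : z ^ (2 / 3 : ℝ) ≤ 1 + z := by
    calc z ^ (2 / 3 : ℝ) ≤ (1 + z) ^ (2 / 3 : ℝ) := by gcongr; linarith
      _ ≤ (1 + z) ^ (1 : ℝ) := Real.rpow_le_rpow_of_exponent_le (by linarith) (by norm_num)
      _ = _ := Real.rpow_one _
  have hz23 : 0 < z ^ (2 / 3 : ℝ) := by positivity
  have h7 : geomBound N (α * m) ≤ 14 * N * z ^ (-(2 / 3) : ℝ) := by
    rw [geomBound, Real.rpow_neg hz0.le, ← div_eq_mul_inv, div_le_div_iff₀ (by linarith) hz23]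
    nlinarith
  refine h7.trans (le_of_eq ?_)
  rw [hz, Real.mul_rpow (by positivity) (by positivity),
      Real.div_rpow (by positivity) (by positivity),
    hm]
  have h8 : ((6 * h * k : ℕ) : ℝ) ^ (-(2 / 3) : ℝ)
      = ((6 * h : ℕ) : ℝ) ^ (-(2 / 3) : ℝ) * (k : ℝ) ^ (-(2 / 3) : ℝ) := by
    rw [← Real.mul_rpow (by positivity) (by positivity)]
    push_cast
    rfl
  have h9 : (N : ℝ) * (((N : ℝ) ^ 2) ^ (-(2 / 3) : ℝ))⁻¹ = (N : ℝ) ^ (7 / 3 : ℝ) := by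
    rw [← Real.rpow_natCast, ← Real.rpow_mul hNR.le, ← Real.rpow_neg hNR.le]
    nth_rewrite 1 [← Real.rpow_one (N : ℝ)]
    rw [← Real.rpow_add hNR]
    norm_num
  rw [h8, ← h9]
  ring

theorem geomBound_le_of_not_dvd {N m : ℕ} {α : ℝ} {r : ℚ} (hdvd : ¬ r.den ∣ m)
    (hsmall : |α - r| * m ≤ 1 / (2 * r.den)) :
    geomBound N (α * m) ≤ 4 * (nearestDist (r * m))⁻¹ := by
  have hq : (0 : ℝ) < r.den := by exact_mod_cast r.den_pos
  have h5 : (r : ℝ) * r.den = r.num := by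
    rw [Rat.cast_def]
    field_simp
  have h1 : 1 / (r.den : ℝ) ≤ nearestDist (r * m) := by
    rw [nearestDist, div_le_iff₀ hq]
    have h2 : |(r : ℝ) * m - round ((r : ℝ) * m)| * r.den
        = ((|r.num * m - round ((r : ℝ) * m) * r.den| : ℤ) : ℝ) := by
      conv_lhs => rhs; rw [← abs_of_pos hq]
      rw [← abs_mul]
      push_cast
      rw [← h5]
      congr 1
      ring
    rw [h2]
    have h3 : r.num * m - round ((r : ℝ) * m) * r.den ≠ 0 := by
      intro h0
      apply hdvd
      have h4 : (r.den : ℤ) ∣ r.num * m := ⟨round ((r : ℝ) * m), by linarith⟩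
      have hc : IsCoprime (r.den : ℤ) r.num := by
        rw [Int.isCoprime_iff_gcd_eq_one, Int.gcd_comm]
        exact r.reduced
      exact_mod_cast hc.dvd_of_dvd_mul_left h4
    exact_mod_cast Int.one_le_abs h3
  have h6 := nearestDist_le_add ((r : ℝ) * m) (α * m)
  have h7 : |(r : ℝ) * m - α * m| = |α - r| * m := by
    rw [← sub_mul, abs_mul, Nat.abs_cast, abs_sub_comm]
  rw [h7] at h6
  have h8 : 1 / (2 * (r.den : ℝ)) = 1 / (r.den : ℝ) / 2 := by
    field_simp
  have h10 : 0 < 1 / (r.den : ℝ) := by positivity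
  have h9 : nearestDist (r * m) ≤ 2 * nearestDist (α * m) := by linarith
  have hpos : 0 < nearestDist (r * m) := by linarith
  rw [geomBound, ← div_eq_mul_inv, div_le_div_iff₀ (by nlinarith [Nat.cast_nonneg (α := ℝ) N]) hpos]
  nlinarith [Nat.cast_nonneg (α := ℝ) N, mul_le_mul_of_nonneg_left h9 (Nat.cast_nonneg (α := ℝ) N)]

theorem weylSum_le {N : ℕ} (hN : 0 < N) {α : ℝ} {r : ℚ}
    (hr : |α - r| * (12 * N ^ 2 * r.den) ≤ 1) {T : ℝ}
    (hT : ∀ m : ℕ, m ≠ 0 → m < 6 * N ^ 2 → (#m.divisors : ℝ) ≤ T) :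
    weylSum N α ≤ 252 * N ^ 3 * (max 1 ((N : ℝ) ^ 3 * |α - r|)) ^ (-(2 / 3) : ℝ)
        * (#r.den.divisors / r.den)
      + 8 * T * (6 * N ^ 2 + r.den) * (1 + Real.log r.den) := by
  have hNR : (0 : ℝ) < N := by exact_mod_cast hN
  have hq : (0 : ℝ) < r.den := by exact_mod_cast r.den_pos
  have hq1 : (1 : ℝ) ≤ r.den := by exact_mod_cast r.den_pos
  have hlt : ∀ p ∈ Ico 1 N ×ˢ Ico 1 N, 0 < p.1 ∧ 0 < p.2 ∧ 6 * p.1 * p.2 < 6 * N ^ 2 := by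
    intro p hp
    rw [mem_product, mem_Ico, mem_Ico] at hp
    refine ⟨hp.1.1, hp.2.1, ?_⟩
    have : p.1 * p.2 < N * N := Nat.mul_lt_mul'' hp.1.2 hp.2.2
    nlinarith
  have hsm : ∀ p ∈ Ico 1 N ×ˢ Ico 1 N, |α - r| * (6 * p.1 * p.2 : ℕ) ≤ 1 / (2 * r.den) := by
    intro p hp
    have h1 : ((6 * p.1 * p.2 : ℕ) : ℝ) ≤ 6 * N ^ 2 := by exact_mod_cast (hlt p hp).2.2.le
    rw [le_div_iff₀ (by positivity)]
    calc |α - r| * (6 * p.1 * p.2 : ℕ) * (2 * r.den)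
        ≤ |α - r| * (6 * N ^ 2) * (2 * r.den) := by gcongr
      _ = |α - r| * (12 * N ^ 2 * r.den) := by ring
      _ ≤ 1 := hr
  rw [weylSum, ← sum_product (f := fun p : ℕ × ℕ => geomBound N (α * (6 * p.1 * p.2 : ℕ))),
    ← sum_filter_add_sum_filter_not _ (fun p : ℕ × ℕ => r.den ∣ 6 * p.1 * p.2)]
  refine add_le_add ?_ ?_
  · have h1 : ∀ p ∈ {p ∈ Ico 1 N ×ˢ Ico 1 N | r.den ∣ 6 * p.1 * p.2},
        geomBound N (α * (6 * p.1 * p.2 : ℕ)) ≤ 14 * (N : ℝ) ^ (7 / 3 : ℝ)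
          * (max 1 ((N : ℝ) ^ 3 * |α - r|)) ^ (-(2 / 3) : ℝ)
          * (((6 * p.1 : ℕ) : ℝ) ^ (-(2 / 3) : ℝ) * (p.2 : ℝ) ^ (-(2 / 3) : ℝ)) := by
      intro p hp
      rw [mem_filter] at hp
      obtain ⟨ha, hb, hc⟩ := hlt p hp.1
      refine geomBound_le_of_resonant hN ha hb hp.2 ((hsm p hp.1).trans ?_) hc.le
      gcongr
      linarith
    refine (sum_le_sum h1).trans ?_
    rw [← mul_sum]
    have h2 := sum_resonant_rpow_le N r.den r.den_pos
    have h3 : (N : ℝ) ^ (7 / 3 : ℝ) * (N : ℝ) ^ (2 / 3 : ℝ) = N ^ 3 := by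
      rw [← Real.rpow_add hNR, ← Real.rpow_natCast]
      norm_num
    calc _ ≤ 14 * (N : ℝ) ^ (7 / 3 : ℝ)
          * (max 1 ((N : ℝ) ^ 3 * |α - r|)) ^ (-(2 / 3) : ℝ)
          * (18 * (N : ℝ) ^ (2 / 3 : ℝ) * #r.den.divisors / r.den) := by gcongr
      _ = 252 * ((N : ℝ) ^ (7 / 3 : ℝ) * (N : ℝ) ^ (2 / 3 : ℝ))
          * (max 1 ((N : ℝ) ^ 3 * |α - r|)) ^ (-(2 / 3) : ℝ) * (#r.den.divisors / r.den) := by ring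
      _ = _ := by rw [h3]
  · set s := {p ∈ Ico 1 N ×ˢ Ico 1 N | ¬ r.den ∣ 6 * p.1 * p.2} with hs
    have h1 : ∀ p ∈ s, geomBound N (α * (6 * p.1 * p.2 : ℕ))
        ≤ 4 * (nearestDist (r * (6 * p.1 * p.2 : ℕ)))⁻¹ := by
      intro p hp
      rw [hs, mem_filter] at hp
      exact geomBound_le_of_not_dvd hp.2 (hsm p hp.1)
    refine (sum_le_sum h1).trans ?_
    rw [← mul_sum]
    have hmaps : ∀ p ∈ s, 6 * p.1 * p.2 ∈ Ico 1 (6 * N ^ 2) := by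
      intro p hp
      rw [hs, mem_filter] at hp
      obtain ⟨ha, hb, hc⟩ := hlt p hp.1
      rw [mem_Ico]
      exact ⟨Nat.mul_pos (Nat.mul_pos (by norm_num) ha) hb, hc⟩
    rw [← sum_fiberwise_of_maps_to hmaps]
    have h2 : ∀ m ∈ Ico (1 : ℕ) (6 * N ^ 2),
        ∑ p ∈ s with 6 * p.1 * p.2 = m, (nearestDist (r * (6 * p.1 * p.2 : ℕ)))⁻¹
          ≤ T * (nearestDist (r * m))⁻¹ := by
      intro m hm
      rw [mem_Ico] at hm
      have h3 : ∀ p ∈ {p ∈ s | 6 * p.1 * p.2 = m},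
          (nearestDist (r * (6 * p.1 * p.2 : ℕ)))⁻¹ = (nearestDist (r * m))⁻¹ := by
        intro p hp
        rw [mem_filter] at hp
        rw [hp.2]
      rw [sum_congr rfl h3, sum_const, nsmul_eq_mul]
      refine mul_le_mul_of_nonneg_right ?_ (inv_nonneg.mpr (nearestDist_nonneg _))
      refine le_trans ?_ (hT m (by omega) hm.2)
      norm_cast
      refine card_le_card_of_injOn (fun p => p.2) (fun p hp => ?_) fun p hp p' hp' hpp => ?_
      · rw [mem_coe, mem_filter] at hp
        rw [mem_coe, Nat.mem_divisors]
        exact ⟨⟨6 * p.1, by rw [← hp.2]; ring⟩, by omega⟩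
      · rw [mem_coe, mem_filter] at hp hp'
        have hpos : 0 < p.2 := by
          have := hp.1
          rw [hs, mem_filter] at this
          exact (hlt p this.1).2.1
        have hpp' : p.2 = p'.2 := hpp
        refine Prod.ext ?_ hpp'
        have h4 := hp.2.trans hp'.2.symm
        rw [← hpp'] at h4
        have := Nat.eq_of_mul_eq_mul_right hpos h4
        omega
    have h5 := sum_inv_nearestDist_rat_range_le r (6 * N ^ 2)
    have hT0 : 0 ≤ T := by
      refine le_trans ?_ (hT 1 one_ne_zero (by nlinarith [Nat.pow_pos (n := 2) hN]))
      positivity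
    calc _ ≤ 4 * ∑ m ∈ Ico (1 : ℕ) (6 * N ^ 2), T * (nearestDist (r * m))⁻¹ := by
          gcongr with m hm
          exact h2 m hm
      _ ≤ 4 * ∑ m ∈ range (6 * N ^ 2), T * (nearestDist (r * m))⁻¹ := by
          refine mul_le_mul_of_nonneg_left (sum_le_sum_of_subset_of_nonneg (fun m hm => ?_)
            fun _ _ _ => mul_nonneg hT0 (inv_nonneg.mpr (nearestDist_nonneg _))) (by norm_num)
          rw [mem_Ico] at hm
          exact mem_range.mpr hm.2
      _ ≤ 4 * (T * (2 * ((6 * N ^ 2 : ℕ) + r.den) * (1 + Real.log r.den))) := by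
          rw [← mul_sum]
          gcongr
      _ = _ := by
          push_cast
          ring

theorem exists_norm_cubeSum_pow_four_le : ∃ C : ℝ, 1 ≤ C ∧ ∀ (N : ℕ) (θ α : ℝ) (r : ℚ), 0 < N →
    |α - r| * (12 * N ^ 2 * r.den) ≤ 1 → r.den ≤ 12 * N ^ 2 →
    ‖cubeSum N θ α‖ ^ 4 ≤ C * ((N : ℝ) ^ 4 * ((1 + (N : ℝ) ^ 3 * |α - r|) ^ (-(2 / 3) : ℝ)
      * (r.den : ℝ) ^ (-(199 / 200) : ℝ)) + (N : ℝ) ^ (151 / 50 : ℝ)) := by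
  obtain ⟨D, hD1, hD⟩ := exists_card_divisors_le_rpow (ε := 1 / 200) (by norm_num)
  refine ⟨16 * 504 * D + 10 + 16 * 8 * D * 6 * 18 * 201 * 12, by nlinarith, ?_⟩
  intro N θ α r hN hr hq12
  have hNR : (0 : ℝ) < N := by exact_mod_cast hN
  have hN1 : (1 : ℝ) ≤ N := by exact_mod_cast hN
  have hq : (0 : ℝ) < r.den := by exact_mod_cast r.den_pos
  have hq1 : (1 : ℝ) ≤ r.den := by exact_mod_cast r.den_pos
  have hqN : (r.den : ℝ) ≤ 12 * N ^ 2 := by exact_mod_cast hq12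
  have hD0 : 0 < D := by linarith
  set B : ℝ := (N : ℝ) ^ 3 * |α - r| with hB
  have hB0 : 0 ≤ B := by positivity
  have hW := weylSum_le hN hr (T := D * (6 * (N : ℝ) ^ (1 / 100 : ℝ))) (by
    intro m hm hm6
    refine (hD m hm).trans ?_
    have h1 : (m : ℝ) ≤ 6 * N ^ 2 := by exact_mod_cast hm6.le
    have h2 : (m : ℝ) ^ (1 / 200 : ℝ) ≤ 6 * (N : ℝ) ^ (1 / 100 : ℝ) := by
      calc (m : ℝ) ^ (1 / 200 : ℝ) ≤ (6 * (N : ℝ) ^ 2) ^ (1 / 200 : ℝ) := by gcongr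
        _ = 6 ^ (1 / 200 : ℝ) * (N : ℝ) ^ (1 / 100 : ℝ) := by
          rw [Real.mul_rpow (by norm_num) (by positivity), ← Real.rpow_natCast,
              ← Real.rpow_mul hNR.le]
          norm_num
        _ ≤ 6 ^ (1 : ℝ) * (N : ℝ) ^ (1 / 100 : ℝ) := by
          gcongr <;> norm_num
        _ = _ := by rw [Real.rpow_one]
    gcongr)
  have h1 : (max 1 B) ^ (-(2 / 3) : ℝ) ≤ 2 * (1 + B) ^ (-(2 / 3) : ℝ) := by
    have hm : (1 + B) ≤ 2 * max 1 B := by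
      have := le_max_left 1 B
      have := le_max_right 1 B
      linarith
    have hm0 : 0 < max 1 B := lt_max_of_lt_left one_pos
    calc (max 1 B) ^ (-(2 / 3) : ℝ) = 2 ^ (2 / 3 : ℝ) * (2 * max 1 B) ^ (-(2 / 3) : ℝ) := by
          rw [Real.mul_rpow (by norm_num) hm0.le, ← mul_assoc, ← Real.rpow_add (by norm_num)]
          norm_num
      _ ≤ 2 ^ (1 : ℝ) * (1 + B) ^ (-(2 / 3) : ℝ) := by
          refine mul_le_mul ?_ ?_ (by positivity) (by positivity)
          · gcongr <;> norm_num
          · exact Real.rpow_le_rpow_of_nonpos (by linarith) hm (by norm_num)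
      _ = _ := by rw [Real.rpow_one]
  have h2 : (#r.den.divisors : ℝ) / r.den ≤ D * (r.den : ℝ) ^ (-(199 / 200) : ℝ) := by
    rw [div_le_iff₀ hq]
    refine (hD r.den r.den_nz).trans (le_of_eq ?_)
    rw [mul_assoc, ← Real.rpow_add_one hq.ne']
    norm_num
  have h3 : 1 + Real.log r.den ≤ 201 * (12 * (N : ℝ) ^ (1 / 100 : ℝ)) := by
    have h4 := Real.log_le_rpow_div hq.le (ε := 1 / 200) (by norm_num)
    have h5 : (1 : ℝ) ≤ (r.den : ℝ) ^ (1 / 200 : ℝ) := Real.one_le_rpow hq1 (by norm_num)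
    have h6 : (r.den : ℝ) ^ (1 / 200 : ℝ) ≤ 12 * (N : ℝ) ^ (1 / 100 : ℝ) := by
      calc (r.den : ℝ) ^ (1 / 200 : ℝ) ≤ (12 * (N : ℝ) ^ 2) ^ (1 / 200 : ℝ) := by gcongr
        _ = 12 ^ (1 / 200 : ℝ) * (N : ℝ) ^ (1 / 100 : ℝ) := by
          rw [Real.mul_rpow (by norm_num) (by positivity), ← Real.rpow_natCast,
              ← Real.rpow_mul hNR.le]
          norm_num
        _ ≤ 12 ^ (1 : ℝ) * (N : ℝ) ^ (1 / 100 : ℝ) := by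
          gcongr <;> norm_num
        _ = _ := by rw [Real.rpow_one]
    have h7 : (r.den : ℝ) ^ (1 / 200 : ℝ) / (1 / 200) = 200 * (r.den : ℝ) ^ (1 / 200 : ℝ) := by ring
    rw [h7] at h4
    linarith
  have hlog : 0 ≤ Real.log r.den := Real.log_nonneg hq1
  have hpw : (N : ℝ) ^ (151 / 50 : ℝ)
      = (N : ℝ) ^ (1 / 100 : ℝ) * (N : ℝ) ^ (1 / 100 : ℝ) * N ^ 3 := by
    rw [← Real.rpow_add hNR, ← Real.rpow_natCast, ← Real.rpow_add hNR]
    norm_num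
  have hN3 : (N : ℝ) ^ 3 ≤ (N : ℝ) ^ (151 / 50 : ℝ) := by
    rw [← Real.rpow_natCast]
    exact Real.rpow_le_rpow_of_exponent_le hN1 (by norm_num)
  set β := (1 + B) ^ (-(2 / 3) : ℝ) with hβ
  set κ := (r.den : ℝ) ^ (-(199 / 200) : ℝ) with hκ
  have hβ0 : 0 < β := by positivity
  have hκ0 : 0 < κ := by positivity
  have h8 := norm_cubeSum_pow_four_le N θ α
  have h9 : 252 * N ^ 3 * (max 1 B) ^ (-(2 / 3) : ℝ) * (#r.den.divisors / r.den)
      ≤ 252 * N ^ 3 * (2 * β) * (D * κ) := by gcongr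
  have h10 : 8 * (D * (6 * (N : ℝ) ^ (1 / 100 : ℝ))) * (6 * N ^ 2 + r.den) * (1 + Real.log r.den)
      ≤ 8 * (D * (6 * (N : ℝ) ^ (1 / 100 : ℝ))) * (6 * N ^ 2 + 12 * N ^ 2)
        * (201 * (12 * (N : ℝ) ^ (1 / 100 : ℝ))) := by gcongr
  calc ‖cubeSum N θ α‖ ^ 4 ≤ 10 * N ^ 3 + 16 * N * weylSum N α := h8
    _ ≤ 10 * N ^ 3 + 16 * N * (252 * N ^ 3 * (2 * β) * (D * κ)
        + 8 * (D * (6 * (N : ℝ) ^ (1 / 100 : ℝ))) * (6 * N ^ 2 + 12 * N ^ 2)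
        * (201 * (12 * (N : ℝ) ^ (1 / 100 : ℝ)))) := by
          gcongr
          exact hW.trans (add_le_add h9 h10)
    _ = 16 * 504 * D * ((N : ℝ) ^ 4 * (β * κ)) + 10 * N ^ 3
        + 16 * 8 * D * 6 * 18 * 201 * 12 * (N : ℝ) ^ (151 / 50 : ℝ) := by
          rw [hpw]
          ring
    _ ≤ 16 * 504 * D * ((N : ℝ) ^ 4 * (β * κ)) + 10 * (N : ℝ) ^ (151 / 50 : ℝ)
        + 16 * 8 * D * 6 * 18 * 201 * 12 * (N : ℝ) ^ (151 / 50 : ℝ) := by gcongr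
    _ ≤ _ := by
          have ha : 0 ≤ (N : ℝ) ^ 4 * (β * κ) := by positivity
          have hb : 0 ≤ (N : ℝ) ^ (151 / 50 : ℝ) := by positivity
          nlinarith [mul_nonneg hD0.le ha, mul_nonneg hD0.le hb]

/-- A fourth-power bound `S ^ 4 ≤ C * (N ^ 4 * x)` gives `S ≤ C * N * x ^ (1 / 4)`. -/
theorem le_of_pow_four_le {S C N x : ℝ} (hC : 1 ≤ C) (hN : 0 ≤ N) (hx : 0 ≤ x)
    (h : S ^ 4 ≤ C * (N ^ 4 * x)) : S ≤ C * N * x ^ (1 / 4 : ℝ) := by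
  have h0 : 0 ≤ C * N * x ^ (1 / 4 : ℝ) := by positivity
  refine le_of_pow_le_pow_left₀ (n := 4) (by norm_num) h0 (h.trans ?_)
  have h1 : (x ^ (1 / 4 : ℝ)) ^ 4 = x := by
    rw [← Real.rpow_natCast, ← Real.rpow_mul hx]
    norm_num
  have h2 : (C * N * x ^ (1 / 4 : ℝ)) ^ 4 = C ^ 4 * (N ^ 4 * (x ^ (1 / 4 : ℝ)) ^ 4) := by ring
  rw [h2, h1]
  gcongr
  exact le_self_pow₀ hC (by norm_num)

/-- Dirichlet approximation combined with the Weyl inequality: either the long exponential sum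
saves almost a fourth root, or `α` has a rational approximation controlling both sums. -/
theorem exists_weyl_dichotomy : ∃ C : ℝ, 1 ≤ C ∧ ∀ (n : ℕ) (α : ℝ), 0 < n →
    (∀ θ, ‖cubeSum (n ^ 5) θ α‖ ≤ C * (n : ℝ) ^ (151 / 40 : ℝ)) ∨
    ∃ r : ℚ, r.den ≤ n ^ 5 ∧ |α - r| * (12 * (n : ℝ) ^ 10 * r.den) ≤ 1 ∧
      (∀ θ, ‖cubeSum (n ^ 5) θ α‖ ≤ C * (n : ℝ) ^ 5 * ((r.den : ℝ) ^ (-(199 / 800) : ℝ)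
        * (1 + (n : ℝ) ^ 15 * |α - r|) ^ (-(1 / 6) : ℝ))) ∧
      ∀ θ, ‖cubeSum (n ^ 4) θ α‖ ≤ C * (n : ℝ) ^ 4 * (r.den : ℝ) ^ (-(39 / 200) : ℝ) := by
  obtain ⟨C, hC1, hC⟩ := exists_norm_cubeSum_pow_four_le
  refine ⟨2 * C, by linarith, fun n α hn => ?_⟩
  have hn0 : (0 : ℝ) < n := by exact_mod_cast hn
  have hn1 : (1 : ℝ) ≤ n := by exact_mod_cast hn
  obtain ⟨r, hr1, hr2⟩ := Real.exists_rat_abs_sub_le_and_den_le α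
    (n := 12 * (n ^ 5) ^ 2) (by positivity)
  have hq : (0 : ℝ) < r.den := by exact_mod_cast r.den_pos
  have hq1 : (1 : ℝ) ≤ r.den := by exact_mod_cast r.den_pos
  have happ : |α - r| * (12 * ((n ^ 5 : ℕ) : ℝ) ^ 2 * r.den) ≤ 1 := by
    rw [le_div_iff₀ (by positivity)] at hr1
    refine le_trans ?_ hr1
    gcongr
    push_cast
    linarith
  have hP := fun θ => hC (n ^ 5) θ α r (by positivity) happ hr2
  set B : ℝ := ((n ^ 5 : ℕ) : ℝ) ^ 3 * |α - r| with hB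
  have hB' : B = (n : ℝ) ^ 15 * |α - r| := by
    rw [hB]
    push_cast
    ring
  have hB0 : 0 ≤ B := by positivity
  set x : ℝ := (1 + B) ^ (-(2 / 3) : ℝ) * (r.den : ℝ) ^ (-(199 / 200) : ℝ) with hx
  have hx0 : 0 ≤ x := by positivity
  have hpow : (((n ^ 5 : ℕ) : ℝ)) ^ (151 / 50 : ℝ) = (n : ℝ) ^ (151 / 10 : ℝ) := by
    push_cast
    rw [← Real.rpow_natCast, ← Real.rpow_mul hn0.le]
    norm_num
  by_cases hcase : (((n ^ 5 : ℕ) : ℝ)) ^ 4 * x ≤ (n : ℝ) ^ (151 / 10 : ℝ)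
  · left
    intro θ
    have h1 : ‖cubeSum (n ^ 5) θ α‖ ^ 4 ≤ 2 * C * (1 ^ 4 * (n : ℝ) ^ (151 / 10 : ℝ)) := by
      refine (hP θ).trans ?_
      rw [hpow]
      nlinarith
    have h2 := le_of_pow_four_le (by linarith) zero_le_one (by positivity) h1
    rw [← Real.rpow_mul hn0.le, mul_one] at h2
    norm_num at h2 ⊢
    exact h2
  · right
    rw [not_le] at hcase
    have hqP : r.den ≤ n ^ 5 := by
      by_contra hlt
      rw [not_le] at hlt
      have hltR : (n : ℝ) ^ 5 ≤ r.den := by exact_mod_cast hlt.le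
      apply absurd hcase
      rw [not_lt]
      have h3 : x ≤ 1 * ((n : ℝ) ^ 5) ^ (-(199 / 200) : ℝ) := by
        rw [hx]
        refine mul_le_mul ?_ ?_ (by positivity) zero_le_one
        · exact Real.rpow_le_one_of_one_le_of_nonpos (by linarith) (by norm_num)
        · exact Real.rpow_le_rpow_of_nonpos (by positivity) hltR (by norm_num)
      calc _ ≤ (((n ^ 5 : ℕ) : ℝ)) ^ 4 * (1 * ((n : ℝ) ^ 5) ^ (-(199 / 200) : ℝ)) := by gcongr
        _ = (n : ℝ) ^ (20 - 199 / 40 : ℝ) := by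
          push_cast
          rw [one_mul, ← Real.rpow_natCast _ 5, ← Real.rpow_mul hn0.le, Real.rpow_natCast,
              ← pow_mul, ← Real.rpow_natCast,
            ← Real.rpow_add hn0]
          norm_num
        _ ≤ _ := Real.rpow_le_rpow_of_exponent_le hn1 (by norm_num)
    have hqPR : (r.den : ℝ) ≤ (n : ℝ) ^ 5 := by exact_mod_cast hqP
    refine ⟨r, hqP, ?_, fun θ => ?_, fun θ => ?_⟩
    · convert happ using 3
      push_cast
      ring
    · have h1 : ‖cubeSum (n ^ 5) θ α‖ ^ 4 ≤ 2 * C * (((n ^ 5 : ℕ) : ℝ) ^ 4 * x) := by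
        refine (hP θ).trans ?_
        rw [hpow]
        nlinarith
      have h2 := le_of_pow_four_le (by linarith) (by positivity) hx0 h1
      refine h2.trans (le_of_eq ?_)
      rw [hx, Real.mul_rpow (by positivity) (by positivity), ← Real.rpow_mul (by positivity),
        ← Real.rpow_mul (by positivity), ← hB',
        show (-(2 / 3) : ℝ) * (1 / 4) = -(1 / 6) by norm_num,
        show (-(199 / 200) : ℝ) * (1 / 4) = -(199 / 800) by norm_num]
      push_cast
      ring
    · have hQ := hC (n ^ 4) θ α r (by positivity) (by
        refine le_trans ?_ happ
        have h3 : ((n ^ 4 : ℕ) : ℝ) ≤ (n ^ 5 : ℕ) := by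
          exact_mod_cast Nat.pow_le_pow_right hn (by norm_num)
        gcongr) (hqP.trans (by
          rw [← pow_mul]
          calc n ^ 5 ≤ n ^ (4 * 2) := Nat.pow_le_pow_right hn (by norm_num)
            _ ≤ _ := by omega))
      have h1 : ‖cubeSum (n ^ 4) θ α‖ ^ 4
          ≤ 2 * C * (((n : ℝ) ^ 4) ^ 4 * (r.den : ℝ) ^ (-(39 / 50) : ℝ)) := by
        refine hQ.trans ?_
        rw [mul_comm 2 C, mul_assoc C 2]
        refine mul_le_mul_of_nonneg_left ?_ (by linarith)
        rw [two_mul]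
        refine add_le_add ?_ ?_
        · push_cast
          refine mul_le_mul_of_nonneg_left ?_ (by positivity)
          rw [← one_mul ((r.den : ℝ) ^ (-(39 / 50) : ℝ))]
          refine mul_le_mul ?_ ?_ (by positivity) zero_le_one
          · refine Real.rpow_le_one_of_one_le_of_nonpos ?_ (by norm_num)
            have : 0 ≤ ((n : ℝ) ^ 4) ^ 3 * |α - r| := by positivity
            linarith
          · exact Real.rpow_le_rpow_of_exponent_le hq1 (by norm_num)
        · calc (((n ^ 4 : ℕ) : ℝ)) ^ (151 / 50 : ℝ) = (n : ℝ) ^ (302 / 25 : ℝ) := by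
                push_cast
                rw [← Real.rpow_natCast, ← Real.rpow_mul hn0.le]
                norm_num
            _ ≤ (n : ℝ) ^ (16 - 39 / 10 : ℝ) :=
                Real.rpow_le_rpow_of_exponent_le hn1 (by norm_num)
            _ = ((n : ℝ) ^ 4) ^ 4 * ((n : ℝ) ^ 5) ^ (-(39 / 50) : ℝ) := by
                rw [← Real.rpow_natCast _ 5, ← Real.rpow_mul hn0.le, ← pow_mul, ← Real.rpow_natCast,
                  ← Real.rpow_add hn0]
                norm_num
            _ ≤ _ := by
                refine mul_le_mul_of_nonneg_left ?_ (by positivity)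
                exact Real.rpow_le_rpow_of_nonpos hq hqPR (by norm_num)
      have h2 := le_of_pow_four_le (by linarith) (by positivity) (by positivity) h1
      rw [← Real.rpow_mul hq.le] at h2
      refine h2.trans (le_of_eq ?_)
      norm_num

theorem card_le_of_injOn_differences (Z : Finset (ℤ × ℤ)) (n M R : ℕ) (hn : 0 < n)
    (hb : ∀ p ∈ Z, 0 ≤ p.2 ∧ p.2 < n * M)
    (hr : ∀ p ∈ Z, ∀ p' ∈ Z, |p.2 - p'.2| ≤ n → |p.1 - p'.1| ≤ R)
    (huniq : ∀ p ∈ Z, ∀ p' ∈ Z, p.2 = p'.2 → p = p')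
    (hdiff : ∀ p ∈ Z, ∀ p' ∈ Z, ∀ v : ℤ × ℤ, p + v ∈ Z → p' + v ∈ Z → v.2 ≠ 0 → p = p') :
    #Z ≤ M + (2 * R + 1) * (2 * n + 1) := by
  classical
  have hnZ : (0 : ℤ) < n := by exact_mod_cast hn
  have hex : ∀ j : ℤ, ∃ c : ℤ × ℤ, (∃ p ∈ Z, p.2 / n = j) → c ∈ Z ∧ c.2 / n = j := by
    intro j
    by_cases h : ∃ p ∈ Z, p.2 / n = j
    · obtain ⟨p, hp, hpj⟩ := h
      exact ⟨p, fun _ => ⟨hp, hpj⟩⟩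
    · exact ⟨0, fun h' => absurd h' h⟩
  choose c hc using hex
  have hc' : ∀ p ∈ Z, c (p.2 / n) ∈ Z ∧ (c (p.2 / n)).2 / n = p.2 / n :=
    fun p hp => hc _ ⟨p, hp, rfl⟩
  have hclose : ∀ p ∈ Z, |p.2 - (c (p.2 / n)).2| ≤ n := by
    intro p hp
    have h1 := (hc' p hp).2
    have h2 := Int.emod_add_mul_ediv p.2 n
    have h3 := Int.emod_add_mul_ediv (c (p.2 / n)).2 n
    rw [h1] at h3
    have h4 := Int.emod_nonneg p.2 hnZ.ne'
    have h5 := Int.emod_lt_of_pos p.2 hnZ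
    have h6 := Int.emod_nonneg (c (p.2 / n)).2 hnZ.ne'
    have h7 := Int.emod_lt_of_pos (c (p.2 / n)).2 hnZ
    rw [abs_le]
    constructor <;> linarith
  rw [← card_filter_add_card_filter_not (fun p : ℤ × ℤ => c (p.2 / n) = p)]
  refine add_le_add ?_ ?_
  · calc _ ≤ #(Ico (0 : ℤ) M) := by
          refine card_le_card_of_injOn (fun p => p.2 / n) (fun p hp => ?_) fun p hp p' hp' h => ?_
          · rw [mem_coe, mem_filter] at hp
            rw [mem_coe, mem_Ico]
            obtain ⟨h1, h2⟩ := hb p hp.1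
            refine ⟨Int.ediv_nonneg h1 hnZ.le, ?_⟩
            rw [Int.ediv_lt_iff_lt_mul hnZ]
            linarith
          · rw [mem_coe, mem_filter] at hp hp'
            have h' : p.2 / n = p'.2 / n := h
            rw [← hp.2, ← hp'.2, h']
      _ = M := by simp
  · calc _ ≤ #(Icc (-(R : ℤ)) R ×ˢ Icc (-(n : ℤ)) n) := by
          refine card_le_card_of_injOn (fun p => p - c (p.2 / n)) (fun p hp => ?_)
            fun p hp p' hp' h => ?_
          · rw [mem_coe, mem_filter] at hp
            rw [mem_coe, mem_product, mem_Icc, mem_Icc, ← abs_le, ← abs_le]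
            exact ⟨hr p hp.1 _ (hc' p hp.1).1 (hclose p hp.1), hclose p hp.1⟩
          · rw [mem_coe, mem_filter] at hp hp'
            have h' : p - c (p.2 / n) = p' - c (p'.2 / n) := h
            have h1 : c (p.2 / n) = c (p'.2 / n) := by
              refine hdiff _ (hc' p hp.1).1 _ (hc' p' hp'.1).1 (p - c (p.2 / n)) ?_ ?_ ?_
              · rw [add_sub_cancel]
                exact hp.1
              · rw [h', add_sub_cancel]
                exact hp'.1
              · intro h0
                have h0' : p.2 - (c (p.2 / n)).2 = 0 := h0
                exact hp.2 (huniq _ (hc' p hp.1).1 _ hp.1 (by linarith))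
            rw [h1] at h'
            exact sub_left_inj.mp h'
      _ = _ := by
          rw [card_product, Int.card_Icc, Int.card_Icc]
          congr 1 <;> omega

/-- Short chords between points near the hyperbola `X ^ 2 - ρ * Y ^ 2 = C` are space-like. -/
theorem mul_le_neg_form_of_near {ρ C ε P Q X Y r s : ℝ} (hρ : 1 ≤ ρ) (hε : ε ≤ 1)
    (hQ : 1 ≤ Q) (hC : 16 * Q ≤ C) (hX : 0 < X) (hX2 : X ≤ 2 * P) (hXr : 0 < X + r)
    (hXr2 : X + r ≤ 2 * P) (hY : 0 ≤ Y) (hY2 : Y ≤ 2 * Q) (hYs : 0 ≤ Y + s)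
    (hYs2 : Y + s ≤ 2 * Q) (hp : |X ^ 2 - ρ * Y ^ 2 - C| ≤ ε)
    (hp' : |(X + r) ^ 2 - ρ * (Y + s) ^ 2 - C| ≤ ε) (hs : 1 ≤ |s|) :
    ρ * C ≤ -(r ^ 2 - ρ * s ^ 2) * (16 * P ^ 2) := by
  have hε0 : 0 ≤ ε := (abs_nonneg _).trans hp
  rw [abs_le] at hp hp'
  set E : ℝ := ((X + r) ^ 2 - ρ * (Y + s) ^ 2 - (X ^ 2 - ρ * Y ^ 2)) / 2 with hE
  set A : ℝ := ((X + r) ^ 2 - ρ * (Y + s) ^ 2 + (X ^ 2 - ρ * Y ^ 2)) / 2 with hA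
  have hEa : |E| ≤ ε := by
    rw [abs_le]
    constructor <;> linarith
  have hAC : C - ε ≤ A := by linarith
  set m : ℝ := X + r / 2 with hm
  set y : ℝ := Y + s / 2 with hy
  have hy0 : 0 ≤ y := by linarith
  have hy2 : y ≤ 2 * Q := by linarith
  have key : (r ^ 2 - ρ * s ^ 2) * (m ^ 2 - ρ * s ^ 2 / 4)
      = E ^ 2 + 2 * E * ρ * s * y - ρ * s ^ 2 * A := by
    rw [hE, hA, hm, hy]
    ring
  have hm1 : 0 ≤ m ^ 2 - ρ * s ^ 2 / 4 := by
    have h1 : ρ * Y ^ 2 ≤ X ^ 2 := by linarith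
    have h2 : ρ * (Y + s) ^ 2 ≤ (X + r) ^ 2 := by linarith
    have h3 : ρ * (Y * (Y + s)) ≤ X * (X + r) := by
      refine abs_le_of_sq_le_sq' ?_ (by positivity) |>.2
      calc (ρ * (Y * (Y + s))) ^ 2 = (ρ * Y ^ 2) * (ρ * (Y + s) ^ 2) := by ring
        _ ≤ X ^ 2 * (X + r) ^ 2 := by gcongr
        _ = _ := by ring
    have h4 : m ^ 2 - ρ * s ^ 2 / 4 = (X ^ 2 + 2 * (X * (X + r)) + (X + r) ^ 2) / 4
        - (ρ * Y ^ 2 - 2 * (ρ * (Y * (Y + s))) + ρ * (Y + s) ^ 2) / 4 := by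
      rw [hm]
      ring
    have h5 : 0 ≤ ρ * (Y * (Y + s)) := by positivity
    rw [h4]
    linarith
  have hm2 : m ^ 2 - ρ * s ^ 2 / 4 ≤ 4 * P ^ 2 := by
    have h1 : m ≤ 2 * P := by linarith
    have h2 : 0 < m := by linarith
    have h3 : m ^ 2 ≤ (2 * P) ^ 2 := by gcongr
    have h4 : 0 ≤ ρ * s ^ 2 / 4 := by positivity
    linarith
  have hlow : ρ * C / 4 ≤ -(r ^ 2 - ρ * s ^ 2) * (m ^ 2 - ρ * s ^ 2 / 4) := by
    have h1 : -(r ^ 2 - ρ * s ^ 2) * (m ^ 2 - ρ * s ^ 2 / 4)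
        = ρ * s ^ 2 * A - 2 * E * ρ * s * y - E ^ 2 := by linarith
    rw [h1]
    have hE1 : E ^ 2 ≤ 1 := by
      rw [← sq_abs]
      exact pow_le_one₀ (abs_nonneg E) (hEa.trans hε)
    have h2 : 2 * E * ρ * s * y ≤ ρ * (|s| * (4 * Q)) := by
      have : E * s * y ≤ 1 * |s| * (2 * Q) := by
        calc E * s * y ≤ |E * s * y| := le_abs_self _
          _ = |E| * |s| * y := by rw [abs_mul, abs_mul, abs_of_nonneg hy0]
          _ ≤ 1 * |s| * (2 * Q) := by
            have := hEa.trans hε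
            gcongr
      have := mul_le_mul_of_nonneg_left this (zero_le_one.trans hρ)
      linarith
    have h3 : |s| ≤ s ^ 2 := by
      rw [← sq_abs]
      exact le_self_pow₀ hs two_ne_zero
    have h4 : |s| * (C - 1) ≤ s ^ 2 * A := by
      have : C - 1 ≤ A := by linarith
      have : 0 ≤ C - 1 := by linarith
      gcongr
    have h5 : C - 1 - 4 * Q ≤ |s| * (C - 1 - 4 * Q) :=
      le_mul_of_one_le_left (by linarith) hs
    have h6 : C / 4 + 1 ≤ s ^ 2 * A - |s| * (4 * Q) := by linarith
    have h7 : ρ * (C / 4 + 1) ≤ ρ * (s ^ 2 * A - |s| * (4 * Q)) :=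
      mul_le_mul_of_nonneg_left h6 (by linarith)
    linarith
  have hC0 : 0 < C := by linarith
  have hpos : 0 < -(r ^ 2 - ρ * s ^ 2) := by
    have : 0 < ρ * C / 4 := by positivity
    exact pos_of_mul_pos_left (this.trans_le hlow) hm1
  have := mul_le_mul_of_nonneg_left hm2 hpos.le
  linarith

/-- Near a hyperbola, a chord cannot be translated to a different chord. -/
theorem no_parallel_chords {ρ C ε P Q X Y X' Y' r s : ℝ} (hρ : 1 ≤ ρ) (hε : ε ≤ 1)
    (hQ : 1 ≤ Q) (hC : 16 * Q ≤ C) (hP : 0 < P) (hbig : 2 * ε * (16 * P ^ 2) < ρ * C)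
    (hX : 0 < X ∧ X ≤ 2 * P) (hXr : 0 < X + r ∧ X + r ≤ 2 * P)
    (hX' : 0 < X' ∧ X' ≤ 2 * P)
    (hY : 0 ≤ Y ∧ Y ≤ 2 * Q) (hYs : 0 ≤ Y + s ∧ Y + s ≤ 2 * Q)
    (hY' : 0 ≤ Y' ∧ Y' ≤ 2 * Q)
    (h1 : |X ^ 2 - ρ * Y ^ 2 - C| ≤ ε) (h2 : |(X + r) ^ 2 - ρ * (Y + s) ^ 2 - C| ≤ ε)
    (h3 : |X' ^ 2 - ρ * Y' ^ 2 - C| ≤ ε) (h4 : |(X' + r) ^ 2 - ρ * (Y' + s) ^ 2 - C| ≤ ε)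
    (hs : 1 ≤ |s|) : ¬ 1 ≤ |Y' - Y| := by
  intro hYY
  obtain ⟨a1, a2⟩ := hX
  obtain ⟨b1, b2⟩ := hXr
  obtain ⟨c1, c2⟩ := hX'
  obtain ⟨a1', a2'⟩ := hY
  obtain ⟨b1', b2'⟩ := hYs
  obtain ⟨c1', c2'⟩ := hY'
  have hv := mul_le_neg_form_of_near hρ hε hQ hC a1 a2 b1 b2 a1' a2' b1' b2' h1 h2 hs
  have hw := mul_le_neg_form_of_near (r := X' - X) (s := Y' - Y) hρ hε hQ hC a1 a2
    (by linarith) (by linarith) a1' a2' (by linarith) (by linarith) h1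
    (by rw [add_sub_cancel, add_sub_cancel]; exact h3) hYY
  set w1 := X' - X with hw1
  set w2 := Y' - Y with hw2
  have hB : |r * w1 - ρ * (s * w2)| ≤ 2 * ε := by
    rw [abs_le] at h1 h2 h3 h4 ⊢
    constructor <;> linarith
  have hgram : (r ^ 2 - ρ * s ^ 2) * (w1 ^ 2 - ρ * w2 ^ 2) ≤ (r * w1 - ρ * (s * w2)) ^ 2 := by
    have : (r * w1 - ρ * (s * w2)) ^ 2 - (r ^ 2 - ρ * s ^ 2) * (w1 ^ 2 - ρ * w2 ^ 2)
        = ρ * (r * w2 - s * w1) ^ 2 := by ring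
    have : 0 ≤ ρ * (r * w2 - s * w1) ^ 2 := by positivity
    linarith
  have hε0 : 0 ≤ ε := (abs_nonneg _).trans h1
  have hsq : (r * w1 - ρ * (s * w2)) ^ 2 ≤ (2 * ε) ^ 2 := by
    rw [← sq_abs]
    gcongr
  have hK : 0 < 16 * P ^ 2 := by positivity
  set K := 16 * P ^ 2
  have hρC : 0 < ρ * C := lt_of_le_of_lt (by positivity) hbig
  have h5 : (ρ * C) * (ρ * C)
      ≤ (-(r ^ 2 - ρ * s ^ 2) * K) * (-(w1 ^ 2 - ρ * w2 ^ 2) * K) :=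
    mul_le_mul hv hw hρC.le (hρC.le.trans hv)
  have h6 : (2 * ε * K) ^ 2 < (ρ * C) ^ 2 := by gcongr
  have h7 : (r ^ 2 - ρ * s ^ 2) * (w1 ^ 2 - ρ * w2 ^ 2) * K ^ 2 ≤ (2 * ε) ^ 2 * K ^ 2 := by
    gcongr
    linarith
  linarith

/-- Pairs `(a, b)` for which `(a + h, b)` and `(a, b + k)` give values of the sum of two shifted
cubes at distance less than `1`. -/
noncomputable def closePairs (n : ℕ) (θ φ : ℝ) (h k : ℕ) : Finset (ℕ × ℕ) :=
  {p ∈ range (n ^ 5) ×ˢ range (n ^ 4) | p.1 + h < n ^ 5 ∧ p.2 + k < n ^ 4 ∧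
    |(((p.1 + h : ℕ) : ℝ) + (n ^ 5 + θ)) ^ 3 + ((p.2 : ℝ) + (n ^ 4 + φ)) ^ 3
      - ((p.1 + (n ^ 5 + θ)) ^ 3 + (((p.2 + k : ℕ) : ℝ) + (n ^ 4 + φ)) ^ 3)| < 1}

theorem bounds_of_mem_closePairs {n : ℕ} {θ φ : ℝ} {h k : ℕ} (hθ0 : 0 ≤ θ) (hθ1 : θ ≤ 1)
    (hφ0 : 0 ≤ φ) (hφ1 : φ ≤ 1) {p : ℕ × ℕ} (hp : p ∈ closePairs n θ φ h k) :
    (n : ℝ) ^ 5 ≤ p.1 + h / 2 + (n ^ 5 + θ) ∧ p.1 + h / 2 + (n ^ 5 + θ) ≤ 2 * (n : ℝ) ^ 5 ∧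
    (n : ℝ) ^ 4 ≤ p.2 + k / 2 + (n ^ 4 + φ) ∧ p.2 + k / 2 + (n ^ 4 + φ) ≤ 2 * (n : ℝ) ^ 4 ∧
    (h : ℝ) ≤ n ^ 5 ∧ (k : ℝ) ≤ n ^ 4 ∧
    |h * (12 * (p.1 + h / 2 + (n ^ 5 + θ)) ^ 2 + h ^ 2)
      - k * (12 * (p.2 + k / 2 + (n ^ 4 + φ)) ^ 2 + (k : ℝ) ^ 2)| < 4 := by
  rw [closePairs, mem_filter] at hp
  obtain ⟨-, h1, h2, h3⟩ := hp
  have h1' : (p.1 : ℝ) + h + 1 ≤ n ^ 5 := by exact_mod_cast h1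
  have h2' : (p.2 : ℝ) + k + 1 ≤ n ^ 4 := by exact_mod_cast h2
  have ha : (0 : ℝ) ≤ p.1 := Nat.cast_nonneg _
  have hb : (0 : ℝ) ≤ p.2 := Nat.cast_nonneg _
  have hh : (0 : ℝ) ≤ h := Nat.cast_nonneg _
  have hk : (0 : ℝ) ≤ k := Nat.cast_nonneg _
  refine ⟨by linarith, by linarith, by linarith, by linarith, by linarith, by linarith, ?_⟩
  push_cast at h3
  rw [abs_lt] at h3 ⊢
  constructor <;> linarith

theorem difference_bounds {n : ℕ} {θ φ : ℝ} {h k : ℕ} (hn : 0 < n) (hh : 0 < h ∨ 0 < k)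
    (hθ0 : 0 ≤ θ) (hθ1 : θ ≤ 1) (hφ0 : 0 ≤ φ) (hφ1 : φ ≤ 1) {p : ℕ × ℕ}
    (hp : p ∈ closePairs n θ φ h k) :
    0 < h ∧ 0 < k ∧ h * n ^ 2 ≤ 5 * k ∧ k ≤ 5 * h * n ^ 2 := by
  obtain ⟨hX1, hX2, hY1, hY2, hhP, hkQ, hlt⟩ := bounds_of_mem_closePairs hθ0 hθ1 hφ0 hφ1 hp
  set X : ℝ := p.1 + h / 2 + (n ^ 5 + θ)
  set Y : ℝ := p.2 + k / 2 + (n ^ 4 + φ)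
  clear_value X Y
  have hn1 : (1 : ℝ) ≤ n := by exact_mod_cast hn
  have hn0 : (0 : ℝ) < n := by linarith
  have hh0 : (0 : ℝ) ≤ h := Nat.cast_nonneg _
  have hk0 : (0 : ℝ) ≤ k := Nat.cast_nonneg _
  have hX1' : ((n : ℝ) ^ 5) ^ 2 ≤ X ^ 2 := by gcongr
  have hY1' : ((n : ℝ) ^ 4) ^ 2 ≤ Y ^ 2 := by gcongr
  have hX2' : X ^ 2 ≤ (2 * (n : ℝ) ^ 5) ^ 2 := by
    have : 0 ≤ X := by linarith [pow_pos hn0 5]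
    gcongr
  have hY2' : Y ^ 2 ≤ (2 * (n : ℝ) ^ 4) ^ 2 := by
    have : 0 ≤ Y := by linarith [pow_pos hn0 4]
    gcongr
  have hh2 : (h : ℝ) ^ 2 ≤ ((n : ℝ) ^ 5) ^ 2 := by gcongr
  have hk2 : (k : ℝ) ^ 2 ≤ ((n : ℝ) ^ 4) ^ 2 := by gcongr
  have h10 : (1 : ℝ) ≤ (n : ℝ) ^ 8 := one_le_pow₀ hn1
  have e1 : ((n : ℝ) ^ 5) ^ 2 = n ^ 2 * n ^ 8 := by ring
  have e2 : ((n : ℝ) ^ 4) ^ 2 = n ^ 8 := by ring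
  have e3 : (2 * (n : ℝ) ^ 5) ^ 2 = 4 * (n ^ 2 * n ^ 8) := by ring
  have e4 : (2 * (n : ℝ) ^ 4) ^ 2 = 4 * n ^ 8 := by ring
  rw [e1] at hX1' hh2
  rw [e2] at hY1' hk2
  rw [e3] at hX2'
  rw [e4] at hY2'
  have l1 : h * (12 * (n ^ 2 * n ^ 8)) ≤ h * (12 * X ^ 2 + (h : ℝ) ^ 2) :=
    mul_le_mul_of_nonneg_left (by linarith [sq_nonneg (h : ℝ)]) hh0
  have l2 : k * (12 * n ^ 8) ≤ k * (12 * Y ^ 2 + (k : ℝ) ^ 2) :=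
    mul_le_mul_of_nonneg_left (by linarith [sq_nonneg (k : ℝ)]) hk0
  have u1 : h * (12 * X ^ 2 + (h : ℝ) ^ 2) ≤ h * (49 * (n ^ 2 * n ^ 8)) :=
    mul_le_mul_of_nonneg_left (by linarith) hh0
  have u2 : k * (12 * Y ^ 2 + (k : ℝ) ^ 2) ≤ k * (49 * n ^ 8) :=
    mul_le_mul_of_nonneg_left (by linarith) hk0
  rw [abs_lt] at hlt
  have hn2 : (1 : ℝ) ≤ (n : ℝ) ^ 2 := one_le_pow₀ hn1
  have hn28 : (1 : ℝ) ≤ (n : ℝ) ^ 2 * n ^ 8 := one_le_mul_of_one_le_of_one_le hn2 h10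
  have hh' : 0 < h := by
    rcases hh with hh | hh
    · exact hh
    · by_contra hneg
      have hz : h = 0 := by omega
      have hk1 : (1 : ℝ) ≤ k := by exact_mod_cast hh
      have : (1 : ℝ) ≤ k * n ^ 8 := one_le_mul_of_one_le_of_one_le hk1 h10
      have hz' : (h : ℝ) = 0 := by exact_mod_cast hz
      rw [hz', zero_mul] at u1
      rw [hz', zero_mul] at hlt
      linarith
  have hk' : 0 < k := by
    by_contra hneg
    have hz : k = 0 := by omega
    have hk1 : (1 : ℝ) ≤ h := by exact_mod_cast hh'
    have : (1 : ℝ) ≤ h * (n ^ 2 * n ^ 8) := one_le_mul_of_one_le_of_one_le hk1 hn28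
    have hz' : (k : ℝ) = 0 := by exact_mod_cast hz
    rw [hz', zero_mul] at hlt
    linarith
  have hh1 : (1 : ℝ) ≤ h := by exact_mod_cast hh'
  have hk1 : (1 : ℝ) ≤ k := by exact_mod_cast hk'
  refine ⟨hh', hk', ?_, ?_⟩
  · have : (h : ℝ) * n ^ 2 ≤ 5 * k := by
      have h8 : (0 : ℝ) < (n : ℝ) ^ 8 := by positivity
      refine le_of_mul_le_mul_right ?_ h8
      have : (1 : ℝ) ≤ k * n ^ 8 := one_le_mul_of_one_le_of_one_le hk1 h10
      linarith
    exact_mod_cast this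
  · have : (k : ℝ) ≤ 5 * h * n ^ 2 := by
      have h8 : (0 : ℝ) < (n : ℝ) ^ 8 := by positivity
      refine le_of_mul_le_mul_right ?_ h8
      have : (1 : ℝ) ≤ h * (n ^ 2 * n ^ 8) := one_le_mul_of_one_le_of_one_le hh1 hn28
      linarith
    exact_mod_cast this

theorem near_hyperbola_of_mem {n : ℕ} {θ φ : ℝ} {h k : ℕ} (hh : 0 < h)
    (hθ0 : 0 ≤ θ) (hθ1 : θ ≤ 1) (hφ0 : 0 ≤ φ) (hφ1 : φ ≤ 1) {p : ℕ × ℕ}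
    (hp : p ∈ closePairs n θ φ h k) :
    |((p.1 : ℝ) + h / 2 + (n ^ 5 + θ)) ^ 2 - k / h * ((p.2 : ℝ) + k / 2 + (n ^ 4 + φ)) ^ 2
      - ((k : ℝ) ^ 3 - (h : ℝ) ^ 3) / (12 * (h : ℝ))| ≤ 1 / (3 * (h : ℝ)) := by
  obtain ⟨-, -, -, -, -, -, hlt⟩ := bounds_of_mem_closePairs hθ0 hθ1 hφ0 hφ1 hp
  have hh0 : (0 : ℝ) < h := by exact_mod_cast hh
  set X : ℝ := p.1 + h / 2 + (n ^ 5 + θ)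
  set Y : ℝ := p.2 + k / 2 + (n ^ 4 + φ)
  have h1 : X ^ 2 - k / h * Y ^ 2 - ((k : ℝ) ^ 3 - (h : ℝ) ^ 3) / (12 * (h : ℝ))
      = (h * (12 * X ^ 2 + h ^ 2) - k * (12 * Y ^ 2 + (k : ℝ) ^ 2)) / (12 * h) := by
    field_simp
    ring
  have h2 : (0 : ℝ) < 12 * h := by positivity
  rw [h1, abs_div, abs_of_pos h2, div_le_div_iff₀ h2 (by positivity)]
  nlinarith

theorem abs_sub_mul_le_of_near {ρ C ε P Q X Y X' Y' : ℝ} (hρ : 0 ≤ ρ)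
    (hX : P ≤ X) (hX' : P ≤ X') (hP : 0 < P) (hY : 0 ≤ Y) (hY' : 0 ≤ Y') (hY2 : Y ≤ 2 * Q)
    (hY2' : Y' ≤ 2 * Q) (h1 : |X ^ 2 - ρ * Y ^ 2 - C| ≤ ε) (h2 : |X' ^ 2 - ρ * Y' ^ 2 - C| ≤ ε) :
    |X - X'| * (2 * P) ≤ ρ * |Y - Y'| * (4 * Q) + 2 * ε := by
  have h3 : |X - X'| * (X + X') = |X ^ 2 - X' ^ 2| := by
    rw [show X ^ 2 - X' ^ 2 = (X - X') * (X + X') by ring, abs_mul,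
      abs_of_pos (show 0 < X + X' by linarith)]
  have h4 : |Y - Y'| * (Y + Y') = |Y ^ 2 - Y' ^ 2| := by
    rw [show Y ^ 2 - Y' ^ 2 = (Y - Y') * (Y + Y') by ring, abs_mul,
      abs_of_nonneg (show 0 ≤ Y + Y' by linarith)]
  have h5 : |X ^ 2 - X' ^ 2| ≤ ρ * |Y ^ 2 - Y' ^ 2| + 2 * ε := by
    have h7 : ρ * |Y ^ 2 - Y' ^ 2| = |ρ * (Y ^ 2 - Y' ^ 2)| := by
      rw [abs_mul, abs_of_nonneg hρ]
    rw [h7]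
    have h6 : X ^ 2 - X' ^ 2 = ρ * (Y ^ 2 - Y' ^ 2) + ((X ^ 2 - ρ * Y ^ 2 - C)
        - (X' ^ 2 - ρ * Y' ^ 2 - C)) := by ring
    rw [h6]
    refine (abs_add_le _ _).trans ?_
    have := abs_sub (X ^ 2 - ρ * Y ^ 2 - C) (X' ^ 2 - ρ * Y' ^ 2 - C)
    linarith
  calc |X - X'| * (2 * P) ≤ |X - X'| * (X + X') := by
        gcongr
        linarith
    _ ≤ ρ * (|Y - Y'| * (Y + Y')) + 2 * ε := by rw [h3, h4]; exact h5
    _ ≤ ρ * (|Y - Y'| * (4 * Q)) + 2 * ε := by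
        gcongr
        linarith
    _ = _ := by ring

theorem eq_of_mem_closePairs {n : ℕ} {θ φ : ℝ} {h k : ℕ} (hn : 0 < n) (hh : 0 < h)
    (hθ0 : 0 ≤ θ) (hθ1 : θ ≤ 1) (hφ0 : 0 ≤ φ) (hφ1 : φ ≤ 1) {p p' : ℕ × ℕ}
    (hp : p ∈ closePairs n θ φ h k) (hp' : p' ∈ closePairs n θ φ h k) (hpp : p.2 = p'.2) :
    p = p' := by
  obtain ⟨a1, a2, a3, a4, -, -, -⟩ := bounds_of_mem_closePairs hθ0 hθ1 hφ0 hφ1 hp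
  obtain ⟨b1, b2, b3, b4, -, -, -⟩ := bounds_of_mem_closePairs hθ0 hθ1 hφ0 hφ1 hp'
  have hn1 : (1 : ℝ) ≤ n := by exact_mod_cast hn
  have hh1 : (1 : ℝ) ≤ h := by exact_mod_cast hh
  have hn5 : (1 : ℝ) ≤ (n : ℝ) ^ 5 := one_le_pow₀ hn1
  have hn4 : (1 : ℝ) ≤ (n : ℝ) ^ 4 := one_le_pow₀ hn1
  have key := abs_sub_mul_le_of_near (P := (n : ℝ) ^ 5) (Q := (n : ℝ) ^ 4)
    (by positivity) a1 b1 (by linarith) (by linarith) (by linarith) a4 b4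
    (near_hyperbola_of_mem hh hθ0 hθ1 hφ0 hφ1 hp) (near_hyperbola_of_mem hh hθ0 hθ1 hφ0 hφ1 hp')
  rw [hpp, sub_self, abs_zero, mul_zero, zero_mul, zero_add, add_sub_add_right_eq_sub,
    add_sub_add_right_eq_sub] at key
  have h1 : 1 / (3 * (h : ℝ)) ≤ 1 / 3 := by
    apply one_div_le_one_div_of_le <;> linarith
  have h2 : |(p.1 : ℝ) - p'.1| < 1 := by
    by_contra hc
    rw [not_lt] at hc
    nlinarith
  have h3 : |(p.1 : ℤ) - p'.1| < 1 := by exact_mod_cast h2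
  refine Prod.ext ?_ hpp
  have := Int.abs_lt_one_iff.mp h3
  omega

theorem card_closePairs_le {n : ℕ} {θ φ : ℝ} {h k : ℕ} (hn : 0 < n) (hh : 0 < h)
    (hθ0 : 0 ≤ θ) (hθ1 : θ ≤ 1) (hφ0 : 0 ≤ φ) (hφ1 : φ ≤ 1) :
    #(closePairs n θ φ h k) ≤ n ^ 4 := by
  calc _ ≤ #(range (n ^ 4)) := by
        refine card_le_card_of_injOn (fun p => p.2) (fun p hp => ?_) fun p hp p' hp' hpp =>
          eq_of_mem_closePairs hn hh hθ0 hθ1 hφ0 hφ1 hp hp' hpp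
        rw [mem_coe, closePairs, mem_filter, mem_product] at hp
        exact hp.1.2
    _ = _ := card_range _

theorem hyperbola_parameters {n h k : ℕ} (hn : 160000 ≤ n) (hh : n < h)
    (hhk' : (h : ℝ) * (n : ℝ) ^ 2 ≤ 5 * k) :
    16 * (n : ℝ) ^ 4 ≤ ((k : ℝ) ^ 3 - (h : ℝ) ^ 3) / (12 * (h : ℝ)) ∧
    2 * (1 / (3 * (h : ℝ))) * (16 * ((n : ℝ) ^ 5) ^ 2)
      < (k : ℝ) / h * (((k : ℝ) ^ 3 - (h : ℝ) ^ 3) / (12 * (h : ℝ))) := by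
  have hnR : (160000 : ℝ) ≤ n := by exact_mod_cast hn
  have hn0 : (0 : ℝ) < n := by linarith
  have hhR : (n : ℝ) < h := by exact_mod_cast hh
  have hh0R : (0 : ℝ) < h := by linarith
  set ρ : ℝ := (k : ℝ) / h with hρ
  set C : ℝ := ((k : ℝ) ^ 3 - (h : ℝ) ^ 3) / (12 * (h : ℝ)) with hC
  set ε : ℝ := 1 / (3 * (h : ℝ)) with hε
  have hn2 : (160000 : ℝ) * 160000 ≤ (n : ℝ) ^ 2 := by nlinarith
  have hρlow : (n : ℝ) ^ 2 / 5 ≤ ρ := by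
    rw [hρ, div_le_div_iff₀ (by norm_num) hh0R]
    linarith
  have hρ1 : 0 ≤ ρ := by positivity
  have hClow : (h : ℝ) ^ 2 * n ^ 6 / 3000 ≤ C := by
    have h1 : C = (h : ℝ) ^ 2 * (ρ ^ 3 - 1) / 12 := by
      rw [hC, hρ]
      field_simp
    have h2 : ((n : ℝ) ^ 2 / 5) ^ 3 ≤ ρ ^ 3 := by gcongr
    have h3 : ((n : ℝ) ^ 2 / 5) ^ 3 = (n : ℝ) ^ 6 / 125 := by ring
    have h4 : (250 : ℝ) ≤ (n : ℝ) ^ 6 := by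
      calc (250 : ℝ) ≤ (n : ℝ) ^ 1 := by linarith
        _ ≤ _ := by
          gcongr
          · linarith
          · norm_num
    rw [h1]
    have h5 : (n : ℝ) ^ 6 / 250 ≤ ρ ^ 3 - 1 := by linarith
    have h6 := mul_le_mul_of_nonneg_left h5 (sq_nonneg (h : ℝ))
    linarith
  have hC16 : 16 * (n : ℝ) ^ 4 ≤ C := by
    refine le_trans ?_ hClow
    have h1 : (n : ℝ) ^ 2 ≤ (h : ℝ) ^ 2 := by gcongr
    have h2 : (48000 : ℝ) ≤ (n : ℝ) ^ 2 * (n : ℝ) ^ 2 := by nlinarith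
    have h3 : (48000 : ℝ) ≤ (h : ℝ) ^ 2 * (n : ℝ) ^ 2 := by
      refine h2.trans ?_
      gcongr
    have h4 : (48000 : ℝ) * n ^ 4 ≤ h ^ 2 * n ^ 2 * n ^ 4 := by gcongr
    linarith
  have hbig : 2 * ε * (16 * ((n : ℝ) ^ 5) ^ 2) < ρ * C := by
    have h1 : (n : ℝ) ^ 2 / 5 * ((h : ℝ) ^ 2 * n ^ 6 / 3000) ≤ ρ * C :=
      mul_le_mul hρlow hClow (by positivity) (by linarith)
    refine lt_of_lt_of_le ?_ h1
    have h2 : 2 * ε * (16 * ((n : ℝ) ^ 5) ^ 2) = 32 * n ^ 10 / (3 * h) := by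
      rw [hε]
      field_simp
      ring
    rw [h2, div_lt_iff₀ (by positivity)]
    have h3 : (160000 : ℝ) * (n : ℝ) ^ 2 < (h : ℝ) ^ 3 := by
      calc (160000 : ℝ) * (n : ℝ) ^ 2 ≤ n * (n : ℝ) ^ 2 := by gcongr
        _ = (n : ℝ) ^ 3 := by ring
        _ < _ := by gcongr
    have h4 : (160000 : ℝ) * n ^ 2 * n ^ 8 < h ^ 3 * n ^ 8 := by gcongr
    nlinarith
  exact ⟨hC16, hbig⟩

theorem card_closePairs_le_of_lt {n : ℕ} {θ φ : ℝ} {h k : ℕ} (hn : 160000 ≤ n) (hh : n < h)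
    (hθ0 : 0 ≤ θ) (hθ1 : θ ≤ 1) (hφ0 : 0 ≤ φ) (hφ1 : φ ≤ 1) :
    #(closePairs n θ φ h k) ≤ 70 * n ^ 3 := by
  rcases (closePairs n θ φ h k).eq_empty_or_nonempty with hempty | ⟨p0, hp0⟩
  · rw [hempty]
    simp
  have hnpos : 0 < n := by omega
  have hh0 : 0 < h := by omega
  obtain ⟨-, hk0, hhk, hkh⟩ := difference_bounds hnpos (Or.inl hh0) hθ0 hθ1 hφ0 hφ1 hp0
  have hnR : (160000 : ℝ) ≤ n := by exact_mod_cast hn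
  have hn0 : (0 : ℝ) < n := by linarith
  have hhR : (n : ℝ) < h := by exact_mod_cast hh
  have hh0R : (0 : ℝ) < h := by linarith
  have hhk' : (h : ℝ) * (n : ℝ) ^ 2 ≤ 5 * k := by exact_mod_cast hhk
  have hkh' : (k : ℝ) ≤ 5 * h * (n : ℝ) ^ 2 := by exact_mod_cast hkh
  obtain ⟨hC16, hbig⟩ := hyperbola_parameters hn hh hhk'
  have hn2 : (160000 : ℝ) * 160000 ≤ (n : ℝ) ^ 2 := by nlinarith
  have hρlow : (n : ℝ) ^ 2 / 5 ≤ (k : ℝ) / h := by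
    rw [div_le_div_iff₀ (by norm_num) hh0R]
    linarith
  have hρhigh : (k : ℝ) / h ≤ 5 * (n : ℝ) ^ 2 := by
    rw [div_le_iff₀ hh0R]
    linarith
  have hρ1 : 1 ≤ (k : ℝ) / h := by linarith
  have hε1 : 1 / (3 * (h : ℝ)) ≤ 1 / 3 := by
    apply one_div_le_one_div_of_le <;> linarith
  have hnear := fun p (hp : p ∈ closePairs n θ φ h k) =>
    near_hyperbola_of_mem hh0 hθ0 hθ1 hφ0 hφ1 hp
  have hbd := fun p (hp : p ∈ closePairs n θ φ h k) =>
    bounds_of_mem_closePairs hθ0 hθ1 hφ0 hφ1 hp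
  have hn5 : (0 : ℝ) < (n : ℝ) ^ 5 := by positivity
  have hn4 : (1 : ℝ) ≤ (n : ℝ) ^ 4 := one_le_pow₀ (by linarith)
  set f : ℕ × ℕ → ℤ × ℤ := fun p => ((p.1 : ℤ), (p.2 : ℤ)) with hf
  have hfinj : Function.Injective f := by
    intro p p' hpp
    rw [hf, Prod.mk.injEq] at hpp
    exact Prod.ext (by exact_mod_cast hpp.1) (by exact_mod_cast hpp.2)
  rw [← card_image_of_injective _ hfinj]
  have hmain := card_le_of_injOn_differences ((closePairs n θ φ h k).image f) n (n ^ 3)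
    (10 * n ^ 2 + 1) hnpos ?_ ?_ ?_ ?_
  · refine hmain.trans ?_
    have h1 : 1 ≤ n := hnpos
    have h2 : n ^ 3 = n ^ 2 * n := by ring
    have h3 : 1 ≤ n ^ 2 := Nat.one_le_pow _ _ hnpos
    calc n ^ 3 + (2 * (10 * n ^ 2 + 1) + 1) * (2 * n + 1)
        ≤ n ^ 3 + (23 * n ^ 2) * (3 * n) := by gcongr <;> omega
      _ = 70 * n ^ 3 := by ring
  · rw [forall_mem_image]
    intro p hp
    rw [closePairs, mem_filter, mem_product, mem_range, mem_range] at hp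
    refine ⟨by simp [hf], ?_⟩
    have : p.2 < n * n ^ 3 := by
      rw [← pow_succ']
      exact hp.1.2
    simp only [hf]
    exact_mod_cast this
  · simp only [forall_mem_image]
    intro p hp p' hp' hpp
    obtain ⟨a1, a2, a3, a4, -, -, -⟩ := hbd p hp
    obtain ⟨b1, b2, b3, b4, -, -, -⟩ := hbd p' hp'
    have key := abs_sub_mul_le_of_near (by linarith) a1 b1 hn5 (by linarith) (by linarith) a4 b4
      (hnear p hp) (hnear p' hp')
    rw [add_sub_add_right_eq_sub, add_sub_add_right_eq_sub, add_sub_add_right_eq_sub,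
      add_sub_add_right_eq_sub] at key
    have h1 : |(p.2 : ℝ) - p'.2| ≤ n := by
      simp only [hf] at hpp
      exact_mod_cast hpp
    have h2 : |(p.1 : ℝ) - p'.1| ≤ 10 * (n : ℝ) ^ 2 + 1 := by
      have h3 : (k : ℝ) / h * |(p.2 : ℝ) - p'.2| * (4 * (n : ℝ) ^ 4)
          ≤ 5 * (n : ℝ) ^ 2 * n * (4 * (n : ℝ) ^ 4) := by gcongr
      have h4 : (1 : ℝ) ≤ (n : ℝ) ^ 5 := one_le_pow₀ (by linarith)
      refine le_of_mul_le_mul_right ?_ (show 0 < 2 * (n : ℝ) ^ 5 by positivity)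
      nlinarith
    simp only [hf]
    exact_mod_cast h2
  · simp only [forall_mem_image]
    intro p hp p' hp' hpp
    rw [eq_of_mem_closePairs hnpos hh0 hθ0 hθ1 hφ0 hφ1 hp hp' (by simpa [hf] using hpp)]
  · intro x hx y hy v hxv hyv hv
    rw [mem_image] at hx hy hxv hyv
    obtain ⟨p, hp, rfl⟩ := hx
    obtain ⟨p', hp', rfl⟩ := hy
    obtain ⟨u, hu, huv⟩ := hxv
    obtain ⟨u', hu', huv'⟩ := hyv
    by_contra hne
    have hb : p.2 ≠ p'.2 := fun h2 =>
      hne (by rw [eq_of_mem_closePairs hnpos hh0 hθ0 hθ1 hφ0 hφ1 hp hp' h2])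
    obtain ⟨a1, a2, a3, a4, -, -, -⟩ := hbd p hp
    obtain ⟨b1, b2, b3, b4, -, -, -⟩ := hbd p' hp'
    obtain ⟨c1, c2, c3, c4, -, -, -⟩ := hbd u hu
    obtain ⟨d1, d2, d3, d4, -, -, -⟩ := hbd u' hu'
    have e1 : (u.1 : ℝ) = p.1 + v.1 := by
      have := congrArg Prod.fst huv
      exact_mod_cast this
    have e2 : (u.2 : ℝ) = p.2 + v.2 := by
      have := congrArg Prod.snd huv
      exact_mod_cast this
    have e3 : (u'.1 : ℝ) = p'.1 + v.1 := by
      have := congrArg Prod.fst huv'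
      exact_mod_cast this
    have e4 : (u'.2 : ℝ) = p'.2 + v.2 := by
      have := congrArg Prod.snd huv'
      exact_mod_cast this
    have q1 : (u.1 : ℝ) + h / 2 + (n ^ 5 + θ) = p.1 + h / 2 + (n ^ 5 + θ) + v.1 := by
      rw [e1]; ring
    have q2 : (u.2 : ℝ) + k / 2 + (n ^ 4 + φ) = p.2 + k / 2 + (n ^ 4 + φ) + v.2 := by
      rw [e2]; ring
    have q3 : (u'.1 : ℝ) + h / 2 + (n ^ 5 + θ) = p'.1 + h / 2 + (n ^ 5 + θ) + v.1 := by
      rw [e3]; ring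
    have q4 : (u'.2 : ℝ) + k / 2 + (n ^ 4 + φ) = p'.2 + k / 2 + (n ^ 4 + φ) + v.2 := by
      rw [e4]; ring
    have nu := hnear u hu
    have nu' := hnear u' hu'
    rw [q1, q2] at nu
    rw [q3, q4] at nu'
    rw [q1] at c1 c2
    rw [q2] at c3 c4
    rw [q3] at d1 d2
    rw [q4] at d3 d4
    refine no_parallel_chords hρ1 (by linarith) hn4 hC16 hn5 hbig
      ⟨by linarith, a2⟩ ⟨by linarith, c2⟩ ⟨by linarith, b2⟩
      ⟨by linarith, a4⟩ ⟨by linarith, c4⟩ ⟨by linarith, b4⟩ (hnear p hp) nu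
      (hnear p' hp') nu' ?_ ?_
    · exact_mod_cast Int.one_le_abs hv
    · rw [add_sub_add_right_eq_sub, add_sub_add_right_eq_sub]
      have : (1 : ℤ) ≤ |(p'.2 : ℤ) - p.2| := Int.one_le_abs (by omega)
      exact_mod_cast this

/-- The value of a sum of two shifted cubes, with shifts of sizes `n ^ 5` and `n ^ 4`. -/
noncomputable def twoCubes (n : ℕ) (θ φ : ℝ) (p : ℕ × ℕ) : ℝ :=
  ((p.1 : ℝ) + (n ^ 5 + θ)) ^ 3 + ((p.2 : ℝ) + (n ^ 4 + φ)) ^ 3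

theorem add_one_le_cube_of_lt {a b : ℕ} {c : ℝ} (hc : 0 ≤ c) (hab : a < b) :
    ((a : ℝ) + c) ^ 3 + 1 ≤ ((b : ℝ) + c) ^ 3 := by
  have h1 : (a : ℝ) + 1 ≤ b := by exact_mod_cast hab
  have ha : (0 : ℝ) ≤ a := Nat.cast_nonneg _
  have h2 : ((a : ℝ) + c + 1) ^ 3 ≤ ((b : ℝ) + c) ^ 3 :=
    pow_le_pow_left₀ (by positivity) (by linarith) 3
  have h3 : 0 ≤ ((a : ℝ) + c) := by positivity
  have h4 : 0 ≤ ((a : ℝ) + c) ^ 2 := by positivity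
  linarith

theorem snd_le_of_twoCubes_close {n : ℕ} {θ φ : ℝ} (hθ0 : 0 ≤ θ) (hφ0 : 0 ≤ φ) {u v : ℕ × ℕ}
    (h : |twoCubes n θ φ u - twoCubes n θ φ v| < 1) (huv : v.1 ≤ u.1) : u.2 ≤ v.2 := by
  by_contra hc
  rw [not_le] at hc
  have h1 := add_one_le_cube_of_lt (c := (n : ℝ) ^ 4 + φ) (by positivity) hc
  have h2 : ((v.1 : ℝ) + (n ^ 5 + θ)) ^ 3 ≤ ((u.1 : ℝ) + (n ^ 5 + θ)) ^ 3 := by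
    gcongr
  rw [twoCubes, twoCubes, abs_lt] at h
  linarith

/-- Pairs of points of the box with close values of `twoCubes`, ordered by first coordinates. -/
noncomputable def orderedClose (n : ℕ) (θ φ : ℝ) : Finset ((ℕ × ℕ) × (ℕ × ℕ)) :=
  {w ∈ (range (n ^ 5) ×ˢ range (n ^ 4)) ×ˢ (range (n ^ 5) ×ˢ range (n ^ 4)) |
    |twoCubes n θ φ w.1 - twoCubes n θ φ w.2| < 1 ∧ w.2.1 < w.1.1}

theorem mem_closePairs_of_mem_orderedClose {n : ℕ} {θ φ : ℝ} (hθ0 : 0 ≤ θ) (hφ0 : 0 ≤ φ)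
    {w : (ℕ × ℕ) × (ℕ × ℕ)} (hw : w ∈ orderedClose n θ φ) :
    (w.2.1, w.1.2) ∈ closePairs n θ φ (w.1.1 - w.2.1) (w.2.2 - w.1.2) := by
  rw [orderedClose, mem_filter, mem_product, mem_product, mem_product, mem_range, mem_range,
    mem_range, mem_range] at hw
  obtain ⟨⟨⟨h1, h2⟩, h3, h4⟩, h5, h6⟩ := hw
  have h7 := snd_le_of_twoCubes_close hθ0 hφ0 h5 h6.le
  rw [closePairs, mem_filter, mem_product, mem_range, mem_range]
  dsimp only
  rw [Nat.add_sub_cancel' h6.le, Nat.add_sub_cancel' h7]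
  refine ⟨⟨h3, h2⟩, h1, h4, ?_⟩
  rw [twoCubes, twoCubes] at h5
  rw [abs_lt] at h5 ⊢
  constructor <;> linarith

theorem card_le_of_closePairs_le {n : ℕ} {θ φ : ℝ} (hθ0 : 0 ≤ θ) (hφ0 : 0 ≤ φ)
    (W : Finset ((ℕ × ℕ) × (ℕ × ℕ))) (hW : W ⊆ orderedClose n θ φ) (T : Finset (ℕ × ℕ)) (m : ℕ)
    (hT : ∀ w ∈ W, (w.1.1 - w.2.1, w.2.2 - w.1.2) ∈ T)
    (hm : ∀ t ∈ T, #(closePairs n θ φ t.1 t.2) ≤ m) : #W ≤ m * #T := by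
  classical
  refine card_le_mul_card_image_of_maps_to hT m fun t ht => (le_trans ?_ (hm t ht))
  refine card_le_card_of_injOn (fun w => (w.2.1, w.1.2)) (fun w hw => ?_) fun w hw w' hw' hww => ?_
  · rw [mem_coe, mem_filter] at hw
    rw [← hw.2]
    exact mem_closePairs_of_mem_orderedClose hθ0 hφ0 (hW hw.1)
  · rw [mem_coe, mem_filter] at hw hw'
    have h1 := hw.2.trans hw'.2.symm
    rw [Prod.mk.injEq] at h1 hww
    have hc := hW hw.1
    have hc' := hW hw'.1
    rw [orderedClose, mem_filter] at hc hc'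
    have h7 := snd_le_of_twoCubes_close hθ0 hφ0 hc.2.1 hc.2.2.le
    have h7' := snd_le_of_twoCubes_close hθ0 hφ0 hc'.2.1 hc'.2.2.le
    have h8 := hc.2.2
    have h8' := hc'.2.2
    refine Prod.ext (Prod.ext ?_ ?_) (Prod.ext ?_ ?_) <;> omega

theorem card_orderedClose_le {n : ℕ} {θ φ : ℝ} (hn : 160000 ≤ n)
    (hθ0 : 0 ≤ θ) (hθ1 : θ ≤ 1) (hφ0 : 0 ≤ φ) (hφ1 : φ ≤ 1) :
    #(orderedClose n θ φ) ≤ 355 * n ^ 9 := by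
  classical
  have hn0 : 0 < n := by omega
  have hdb : ∀ w ∈ orderedClose n θ φ, 0 < w.1.1 - w.2.1 ∧ 0 < w.2.2 - w.1.2 ∧
      (w.1.1 - w.2.1) * n ^ 2 ≤ 5 * (w.2.2 - w.1.2) ∧
      w.2.2 - w.1.2 ≤ 5 * (w.1.1 - w.2.1) * n ^ 2 ∧ w.2.2 - w.1.2 ≤ n ^ 4 := by
    intro w hw
    have h1 := mem_closePairs_of_mem_orderedClose hθ0 hφ0 hw
    rw [orderedClose, mem_filter, mem_product, mem_product, mem_product, mem_range, mem_range,
      mem_range, mem_range] at hw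
    obtain ⟨a, b, c, d⟩ := difference_bounds hn0 (Or.inl (Nat.sub_pos_of_lt hw.2.2))
      hθ0 hθ1 hφ0 hφ1 h1
    exact ⟨a, b, c, d, by omega⟩
  rw [← card_filter_add_card_filter_not (fun w => w.1.1 - w.2.1 ≤ n)]
  have hsmall := card_le_of_closePairs_le hθ0 hφ0
    {w ∈ orderedClose n θ φ | w.1.1 - w.2.1 ≤ n} (filter_subset _ _)
    (Icc 1 n ×ˢ Icc 1 (5 * n ^ 3)) (n ^ 4) (fun w hw => by
      rw [mem_filter] at hw
      obtain ⟨a, b, c, d, e⟩ := hdb w hw.1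
      rw [mem_product, mem_Icc, mem_Icc]
      refine ⟨⟨a, hw.2⟩, b, d.trans ?_⟩
      calc 5 * (w.1.1 - w.2.1) * n ^ 2 ≤ 5 * n * n ^ 2 := by
            gcongr
            exact hw.2
        _ = 5 * n ^ 3 := by ring) (fun t ht => by
      rw [mem_product, mem_Icc] at ht
      exact card_closePairs_le hn0 ht.1.1 hθ0 hθ1 hφ0 hφ1)
  have hlarge := card_le_of_closePairs_le hθ0 hφ0
    {w ∈ orderedClose n θ φ | ¬ w.1.1 - w.2.1 ≤ n} (filter_subset _ _)
    (Icc (n + 1) (5 * n ^ 2) ×ˢ Icc 1 (n ^ 4)) (70 * n ^ 3) (fun w hw => by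
      rw [mem_filter, not_le] at hw
      obtain ⟨a, b, c, d, e⟩ := hdb w hw.1
      rw [mem_product, mem_Icc, mem_Icc]
      refine ⟨⟨hw.2, ?_⟩, b, e⟩
      have h2 : 0 < n ^ 2 := by positivity
      refine Nat.le_of_mul_le_mul_right (c.trans ?_) h2
      calc 5 * (w.2.2 - w.1.2) ≤ 5 * n ^ 4 := by gcongr
        _ = 5 * n ^ 2 * n ^ 2 := by ring) (fun t ht => by
      rw [mem_product, mem_Icc] at ht
      exact card_closePairs_le_of_lt hn ht.1.1 hθ0 hθ1 hφ0 hφ1)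
  rw [card_product, Nat.card_Icc, Nat.card_Icc] at hsmall hlarge
  calc _ ≤ _ := add_le_add hsmall hlarge
    _ ≤ n ^ 4 * (n * (5 * n ^ 3)) + 70 * n ^ 3 * ((5 * n ^ 2) * n ^ 4) := by
      gcongr <;> omega
    _ = 5 * (n ^ 8 * 1) + 350 * n ^ 9 := by ring
    _ ≤ 5 * (n ^ 8 * n) + 350 * n ^ 9 := by gcongr; omega
    _ = _ := by ring

theorem card_twoCubes_close_le {n : ℕ} {θ φ : ℝ} (hn : 160000 ≤ n)
    (hθ0 : 0 ≤ θ) (hθ1 : θ ≤ 1) (hφ0 : 0 ≤ φ) (hφ1 : φ ≤ 1) :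
    #{w ∈ (range (n ^ 5) ×ˢ range (n ^ 4)) ×ˢ (range (n ^ 5) ×ˢ range (n ^ 4)) |
      |twoCubes n θ φ w.1 - twoCubes n θ φ w.2| < 1} ≤ 711 * n ^ 9 := by
  classical
  calc _ ≤ #((range (n ^ 5) ×ˢ range (n ^ 4)).image (fun u => (u, u)) ∪ (orderedClose n θ φ
        ∪ (orderedClose n θ φ).image Prod.swap)) := by
        refine card_le_card fun w hw => ?_
        rw [mem_filter, mem_product] at hw
        obtain ⟨⟨h1, h2⟩, h3⟩ := hw
        rw [mem_union, mem_union, mem_image, mem_image]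
        rcases lt_trichotomy w.1.1 w.2.1 with h | h | h
        · refine Or.inr (Or.inr ⟨w.swap, ?_, w.swap_swap⟩)
          rw [orderedClose, mem_filter, mem_product]
          rw [abs_sub_comm] at h3
          exact ⟨⟨h2, h1⟩, h3, h⟩
        · left
          have h4 := snd_le_of_twoCubes_close hθ0 hφ0 h3 h.ge
          rw [abs_sub_comm] at h3
          have h5 := snd_le_of_twoCubes_close hθ0 hφ0 h3 h.le
          exact ⟨w.1, h1, Prod.ext rfl (Prod.ext h (le_antisymm h4 h5))⟩
        · right
          left
          rw [orderedClose, mem_filter, mem_product]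
          exact ⟨⟨h1, h2⟩, h3, h⟩
    _ ≤ n ^ 9 + (355 * n ^ 9 + 355 * n ^ 9) := by
      have h := card_orderedClose_le hn hθ0 hθ1 hφ0 hφ1
      refine (card_union_le _ _).trans (add_le_add ?_ ((card_union_le _ _).trans
        (add_le_add h (card_image_le.trans h))))
      refine card_image_le.trans (le_of_eq ?_)
      rw [card_product, card_range, card_range]
      ring
    _ = _ := by ring

theorem intervalIntegral_comp_abs {f : ℝ → ℝ} (hf : Continuous f) {A : ℝ} (hA : 0 ≤ A) :
    ∫ x in (-A)..A, f |x| = 2 * ∫ x in (0 : ℝ)..A, f x := by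
  have hc : Continuous fun x : ℝ => f |x| := hf.comp continuous_abs
  have h1 : ∫ x in (0 : ℝ)..A, f |x| = ∫ x in (0 : ℝ)..A, f x := by
    refine intervalIntegral.integral_congr fun x hx => ?_
    rw [Set.uIcc_of_le hA] at hx
    rw [abs_of_nonneg hx.1]
  have h2 : ∫ x in (-A)..0, f |x| = ∫ x in (0 : ℝ)..A, f |x| := by
    have := intervalIntegral.integral_comp_neg (a := 0) (b := A) (fun x => f |x|)
    simp only [abs_neg, neg_zero] at this
    exact this.symm
  rw [← intervalIntegral.integral_add_adjacent_intervals (b := 0) (hc.intervalIntegrable _ _)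
    (hc.intervalIntegrable _ _), h2, h1]
  ring

theorem integral_truncated {b A : ℝ} (hb : 0 ≤ b) (hbA : b ≤ A) (p : ℕ) (hp : p ≠ 0) (ω : ℝ) :
    ∫ α in (-A)..A, (max (b - |α|) 0) ^ p * Real.cos (ω * α)
      = 2 * ∫ α in (0 : ℝ)..b, (b - α) ^ p * Real.cos (ω * α) := by
  have hc : Continuous fun α : ℝ => (max (b - α) 0) ^ p * Real.cos (ω * α) := by fun_prop
  have h1 : ∀ α : ℝ, (max (b - |α|) 0) ^ p * Real.cos (ω * α)
      = (fun α : ℝ => (max (b - α) 0) ^ p * Real.cos (ω * α)) |α| := by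
    intro α
    dsimp only
    rcases abs_choice α with h | h <;> rw [h]
    rw [mul_neg, Real.cos_neg]
  simp_rw [h1]
  rw [intervalIntegral_comp_abs hc (hb.trans hbA)]
  congr 1
  rw [← intervalIntegral.integral_add_adjacent_intervals (b := b) (hc.intervalIntegrable _ _)
    (hc.intervalIntegrable _ _)]
  have h2 : ∫ α in b..A, (max (b - α) 0) ^ p * Real.cos (ω * α) = ∫ α in b..A, (0 : ℝ) := by
    refine intervalIntegral.integral_congr fun x hx => ?_
    rw [Set.uIcc_of_le hbA] at hx
    rw [max_eq_right (by linarith [hx.1]), zero_pow hp, zero_mul]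
  rw [h2, intervalIntegral.integral_zero, add_zero]
  refine intervalIntegral.integral_congr fun x hx => ?_
  rw [Set.uIcc_of_le hb] at hx
  rw [max_eq_left (by linarith [hx.2])]

theorem integral_tri_cos {b A ω : ℝ} (hb : 0 ≤ b) (hbA : b ≤ A) (hω : ω ≠ 0) :
    ∫ α in (-A)..A, max (b - |α|) 0 * Real.cos (ω * α) = 2 * (1 - Real.cos (ω * b)) / ω ^ 2 := by
  have h := integral_truncated hb hbA 1 one_ne_zero ω
  simp only [pow_one] at h
  rw [h, intervalIntegral.integral_eq_sub_of_hasDerivAt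
    (f := fun α => (b - α) * (Real.sin (ω * α) / ω) - Real.cos (ω * α) / ω ^ 2)]
  · simp only [sub_self, mul_zero, Real.cos_zero, Real.sin_zero]
    ring
  · intro α _
    have h1 : HasDerivAt (fun α : ℝ => ω * α) ω α := by
      simpa using (hasDerivAt_id α).const_mul ω
    have h2 : HasDerivAt (fun α : ℝ => b - α) (-1) α := by
      simpa using (hasDerivAt_id α).const_sub b
    refine ((h2.mul (h1.sin.div_const ω)).sub (h1.cos.div_const (ω ^ 2))).congr_deriv ?_
    field_simp
    ring
  · exact Continuous.intervalIntegrable (by fun_prop) _ _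

theorem integral_tri {b A : ℝ} (hb : 0 ≤ b) (hbA : b ≤ A) :
    ∫ α in (-A)..A, max (b - |α|) 0 = b ^ 2 := by
  have h := integral_truncated hb hbA 1 one_ne_zero 0
  simp only [pow_one, zero_mul, Real.cos_zero, mul_one] at h
  rw [h, intervalIntegral.integral_eq_sub_of_hasDerivAt (f := fun α => b * α - α ^ 2 / 2)]
  · ring
  · intro α _
    refine (((hasDerivAt_id α).const_mul b).sub
      ((hasDerivAt_pow 2 α).div_const 2)).congr_deriv ?_
    simp
  · exact Continuous.intervalIntegrable (by fun_prop) _ _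

theorem integral_tri_sq_cos {b A ω : ℝ} (hb : 0 ≤ b) (hbA : b ≤ A) (hω : ω ≠ 0) :
    ∫ α in (-A)..A, (max (b - |α|) 0) ^ 2 * Real.cos (ω * α)
      = 4 * b / ω ^ 2 - 4 * Real.sin (ω * b) / ω ^ 3 := by
  rw [integral_truncated hb hbA 2 two_ne_zero ω, intervalIntegral.integral_eq_sub_of_hasDerivAt
    (f := fun α => (b - α) ^ 2 * (Real.sin (ω * α) / ω) - 2 * (b - α) * (Real.cos (ω * α) / ω ^ 2)
      - 2 * (Real.sin (ω * α) / ω ^ 3))]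
  · simp only [sub_self, mul_zero, Real.cos_zero, Real.sin_zero]
    ring
  · intro α _
    have h1 : HasDerivAt (fun α : ℝ => ω * α) ω α := by
      simpa using (hasDerivAt_id α).const_mul ω
    have h2 : HasDerivAt (fun α : ℝ => b - α) (-1) α := by
      simpa using (hasDerivAt_id α).const_sub b
    refine ((((h2.pow 2).mul (h1.sin.div_const ω)).sub ((h2.const_mul 2).mul
      (h1.cos.div_const (ω ^ 2)))).sub ((h1.sin.div_const (ω ^ 3)).const_mul 2)).congr_deriv ?_
    simp only [Pi.pow_apply]
    field_simp
    push_cast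
    ring
  · exact Continuous.intervalIntegrable (by fun_prop) _ _

theorem integral_tri_cos_le {b A : ℝ} (hb : 0 ≤ b) (hbA : b ≤ A) (ω : ℝ) :
    (∫ α in (-A)..A, max (b - |α|) 0 * Real.cos (ω * α)) * (1 + ω ^ 2) ≤ b ^ 2 + 4 := by
  rcases eq_or_ne ω 0 with rfl | hω
  · simp only [zero_mul, Real.cos_zero, mul_one, integral_tri hb hbA]
    linarith
  · rw [integral_tri_cos hb hbA hω]
    have h0 : 0 < ω ^ 2 := by positivity
    have h1 := Real.one_sub_sq_div_two_le_cos (x := ω * b)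
    have h2 := Real.neg_one_le_cos (ω * b)
    have h3 : 2 * (1 - Real.cos (ω * b)) / ω ^ 2 ≤ b ^ 2 := by
      rw [div_le_iff₀ h0]
      linarith
    have h4 : 2 * (1 - Real.cos (ω * b)) / ω ^ 2 * ω ^ 2 ≤ 4 := by
      rw [div_mul_cancel₀ _ h0.ne']
      linarith
    linarith

/-- A kernel whose cosine transform is nonpositive away from the origin. -/
noncomputable def detector (b α : ℝ) : ℝ :=
  max (3 * b - |α|) 0 - 2 / b * max (b - |α|) 0 ^ 2

theorem continuous_detector (b : ℝ) : Continuous (detector b) := by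
  unfold detector
  fun_prop

theorem integral_detector_cos_nonpos {b A ω : ℝ} (hb : 0 < b) (hbA : 3 * b ≤ A)
    (hω : 2 ≤ b * |ω|) : ∫ α in (-A)..A, detector b α * Real.cos (ω * α) ≤ 0 := by
  have hω0 : ω ≠ 0 := by
    rintro rfl
    simp at hω
    linarith
  have h1 : ∫ α in (-A)..A, detector b α * Real.cos (ω * α)
      = 2 * (1 - Real.cos (ω * (3 * b))) / ω ^ 2
        - 2 / b * (4 * b / ω ^ 2 - 4 * Real.sin (ω * b) / ω ^ 3) := by
    rw [← integral_tri_cos (by positivity) hbA hω0,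
      ← integral_tri_sq_cos hb.le (by linarith : b ≤ A) hω0,
      ← intervalIntegral.integral_const_mul, ← intervalIntegral.integral_sub
      (Continuous.intervalIntegrable (by fun_prop) _ _)
      (Continuous.intervalIntegrable (by fun_prop) _ _)]
    refine intervalIntegral.integral_congr fun α _ => ?_
    simp only [detector]
    ring
  have h2 : 2 * (1 - Real.cos (ω * (3 * b))) / ω ^ 2
        - 2 / b * (4 * b / ω ^ 2 - 4 * Real.sin (ω * b) / ω ^ 3)
      = (2 * (1 - Real.cos (ω * (3 * b))) - 8 + 8 * (Real.sin (ω * b) / (b * ω))) / ω ^ 2 := by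
    field_simp
    ring
  have h3 : Real.sin (ω * b) / (b * ω) ≤ 1 / 2 := by
    refine (le_abs_self _).trans ?_
    rw [abs_div, abs_mul, abs_of_pos hb, div_le_div_iff₀ (by linarith) two_pos]
    linarith [Real.abs_sin_le_one (ω * b)]
  rw [h1, h2]
  refine div_nonpos_of_nonpos_of_nonneg ?_ (sq_nonneg _)
  linarith [Real.neg_one_le_cos (ω * (3 * b))]

theorem abs_detector_sub_le {b : ℝ} (hb : 0 < b) (α : ℝ) : |detector b α - b| ≤ 6 * |α| := by
  have ha := abs_nonneg α
  have h1 : |max (3 * b - |α|) 0 - 3 * b| ≤ |α| := by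
    rw [abs_le]
    rcases max_cases (3 * b - |α|) 0 with ⟨h, h'⟩ | ⟨h, h'⟩ <;> rw [h] <;>
      constructor <;> linarith
  have h2 : |max (b - |α|) 0 ^ 2 - b ^ 2| ≤ |α| * (2 * b) := by
    rcases max_cases (b - |α|) 0 with ⟨h, h'⟩ | ⟨h, h'⟩ <;> rw [h]
    · have : (b - |α|) ^ 2 - b ^ 2 = -(|α| * (2 * b - |α|)) := by ring
      rw [this, abs_neg, abs_of_nonneg (mul_nonneg ha (by linarith))]
      gcongr
      linarith
    · have : (0 : ℝ) ^ 2 - b ^ 2 = -(b * b) := by ring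
      rw [this, abs_neg, abs_of_nonneg (by positivity)]
      nlinarith
  have h3 : detector b α - b = (max (3 * b - |α|) 0 - 3 * b)
      - 2 / b * (max (b - |α|) 0 ^ 2 - b ^ 2) := by
    rw [detector]
    field_simp
    ring
  rw [h3]
  have h4 : |2 / b * (max (b - |α|) 0 ^ 2 - b ^ 2)| ≤ 2 / b * (|α| * (2 * b)) := by
    rw [abs_mul, abs_of_pos (by positivity : 0 < 2 / b)]
    gcongr
  have h5 : 2 / b * (|α| * (2 * b)) = 4 * |α| := by
    field_simp
    ring
  have := abs_sub (max (3 * b - |α|) 0 - 3 * b) (2 / b * (max (b - |α|) 0 ^ 2 - b ^ 2))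
  linarith

theorem abs_detector_le {b : ℝ} (hb : 0 < b) (α : ℝ) : |detector b α| ≤ 5 * b := by
  have h0 := abs_nonneg α
  have h1 : max (3 * b - |α|) 0 ≤ 3 * b := max_le (by linarith) (by positivity)
  have h1' : 0 ≤ max (3 * b - |α|) 0 := le_max_right _ _
  have h2 : max (b - |α|) 0 ≤ b := max_le (by linarith) hb.le
  have h2' : 0 ≤ max (b - |α|) 0 := le_max_right _ _
  have h3 : 2 / b * max (b - |α|) 0 ^ 2 ≤ 2 / b * b ^ 2 := by gcongr
  have h3' : 0 ≤ 2 / b * max (b - |α|) 0 ^ 2 := by positivity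
  have h4 : 2 / b * b ^ 2 = 2 * b := by field_simp
  rw [detector, abs_le]
  constructor <;> linarith

theorem integral_tri_cos_nonneg {b A : ℝ} (hb : 0 ≤ b) (hbA : b ≤ A) (ω : ℝ) :
    0 ≤ ∫ α in (-A)..A, max (b - |α|) 0 * Real.cos (ω * α) := by
  rcases eq_or_ne ω 0 with rfl | hω
  · simp only [zero_mul, Real.cos_zero, mul_one, integral_tri hb hbA]
    positivity
  · rw [integral_tri_cos hb hbA hω]
    have := Real.cos_le_one (ω * b)
    exact div_nonneg (by linarith) (sq_nonneg _)

theorem le_integral_tri_cos {b A ω : ℝ} (hb : 0 ≤ b) (hbA : b ≤ A) (hω : |ω * b| ≤ Real.pi) :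
    b ^ 2 / 4 ≤ ∫ α in (-A)..A, max (b - |α|) 0 * Real.cos (ω * α) := by
  rcases eq_or_ne ω 0 with rfl | hω0
  · simp only [zero_mul, Real.cos_zero, mul_one, integral_tri hb hbA]
    linarith [sq_nonneg b]
  · rw [integral_tri_cos hb hbA hω0]
    have h1 := Real.cos_le_one_sub_mul_cos_sq hω
    have h2 : (1 : ℝ) / 8 ≤ 2 / Real.pi ^ 2 := by
      rw [div_le_div_iff₀ (by norm_num) (by positivity)]
      have := pow_le_pow_left₀ Real.pi_pos.le Real.pi_le_four 2
      linarith
    have h3 := mul_le_mul_of_nonneg_right h2 (sq_nonneg (ω * b))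
    rw [le_div_iff₀ (by positivity)]
    linarith

theorem norm_sq_sum_addChar {ι : Type*} (I : Finset ι) (f : ι → ℝ) (α : ℝ) :
    ‖∑ x ∈ I, addChar (α * f x)‖ ^ 2
      = ∑ x ∈ I, ∑ y ∈ I, Real.cos (2 * Real.pi * (f x - f y) * α) := by
  have h : ((‖∑ x ∈ I, addChar (α * f x)‖ ^ 2 : ℝ) : ℂ)
      = ∑ x ∈ I, ∑ y ∈ I, addChar (α * f x - α * f y) := by
    push_cast
    rw [← Complex.mul_conj', map_sum, sum_mul_sum]
    simp_rw [addChar_mul_conj]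
  have h2 := congrArg Complex.re h
  rw [Complex.ofReal_re] at h2
  rw [h2, Complex.re_sum]
  refine sum_congr rfl fun x _ => ?_
  rw [Complex.re_sum]
  refine sum_congr rfl fun y _ => ?_
  rw [addChar_re]
  congr 1
  ring

theorem sum_sum_weight_le {ι : Type*} (I : Finset ι) (g : ι → ℤ) {w : ℤ → ℝ}
    (hw0 : ∀ k, 0 ≤ w k) (heven : ∀ k, w (-k) = w k) (hw : Summable w) :
    ∑ x ∈ I, ∑ y ∈ I, w (g x - g y) ≤ (∑' k, w k) * #{p ∈ I ×ˢ I | g p.1 = g p.2} := by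
  classical
  set N : ℤ → ℝ := fun l => #{x ∈ I | g x = l} with hN
  set L := I.image g with hL
  have hNsum : ∀ F : ℤ → ℝ, ∑ x ∈ I, F (g x) = ∑ l ∈ L, N l * F l := by
    intro F
    rw [sum_comp F g]
    simp [hN, hL]
  have hrow : ∀ l, ∑ m ∈ L, w (l - m) ≤ ∑' k, w k := by
    intro l
    rw [← sum_image (f := w) (g := fun m => l - m) (fun a _ b _ h => sub_right_injective h)]
    exact hw.sum_le_tsum _ fun k _ => hw0 k
  have hcount : (#{p ∈ I ×ˢ I | g p.1 = g p.2} : ℝ) = ∑ l ∈ L, N l ^ 2 := by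
    have h1 : #{p ∈ I ×ˢ I | g p.1 = g p.2} = ∑ y ∈ I, #{x ∈ I | g x = g y} := by
      rw [card_filter, sum_product_right]
      refine sum_congr rfl fun y _ => ?_
      rw [card_filter]
    rw [h1]
    push_cast
    rw [hNsum N]
    refine sum_congr rfl fun l _ => ?_
    ring
  rw [hcount, hNsum fun l => ∑ y ∈ I, w (l - g y)]
  calc ∑ l ∈ L, N l * ∑ y ∈ I, w (l - g y)
      = ∑ l ∈ L, ∑ m ∈ L, N l * (N m * w (l - m)) := by
        refine sum_congr rfl fun l _ => ?_
        rw [hNsum fun m => w (l - m), mul_sum]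
    _ ≤ ∑ l ∈ L, ∑ m ∈ L, (N l ^ 2 * w (l - m) / 2 + N m ^ 2 * w (l - m) / 2) := by
        refine sum_le_sum fun l _ => sum_le_sum fun m _ => ?_
        have := mul_nonneg (sq_nonneg (N l - N m)) (hw0 (l - m))
        linarith
    _ = ∑ l ∈ L, N l ^ 2 * ∑ m ∈ L, w (l - m) := by
        simp_rw [sum_add_distrib]
        rw [sum_comm (f := fun l m => N m ^ 2 * w (l - m) / 2), ← sum_add_distrib]
        refine sum_congr rfl fun l _ => ?_
        rw [mul_sum, ← sum_add_distrib]
        refine sum_congr rfl fun m _ => ?_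
        rw [← heven (m - l), neg_sub]
        ring
    _ ≤ ∑ l ∈ L, N l ^ 2 * ∑' k, w k := by
        refine sum_le_sum fun l _ => ?_
        exact mul_le_mul_of_nonneg_left (hrow l) (sq_nonneg _)
    _ = _ := by rw [← sum_mul, mul_comm]

theorem summable_one_div_one_add_sq : Summable fun k : ℤ => 1 / (1 + (k : ℝ) ^ 2) := by
  have h : Summable fun k : ℤ => 1 / (k : ℝ) ^ 2 := Real.summable_one_div_int_pow.mpr one_lt_two
  rw [← (Set.finite_singleton (0 : ℤ)).summable_compl_iff] at h ⊢
  refine Summable.of_nonneg_of_le (fun k => by dsimp; positivity) (fun k => ?_) h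
  have h0 : ((k : ℤ) : ℝ) ≠ 0 := by exact_mod_cast k.2
  apply one_div_le_one_div_of_le
  · positivity
  · linarith

/-- A mean square of an exponential sum is controlled by the number of close pairs of
frequencies. -/
theorem exists_integral_norm_sq_le (A : ℝ) (hA : 0 < A) : ∃ C, 0 < C ∧
    ∀ {ι : Type*} (I : Finset ι) (f : ι → ℝ),
      ∫ α in (-A)..A, ‖∑ x ∈ I, addChar (α * f x)‖ ^ 2
        ≤ C * #{p ∈ I ×ˢ I | |f p.1 - f p.2| < 1} := by
  classical
  set K : ℝ := ∑' k : ℤ, 1 / (1 + (k : ℝ) ^ 2) with hK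
  have hK0 : 0 ≤ K := tsum_nonneg fun k => by positivity
  set D : ℝ := 3 * ((2 * A) ^ 2 + 4) with hD
  have hD0 : 0 < D := by positivity
  refine ⟨1 / A * (D * K) + 1, by positivity, fun {ι} I f => ?_⟩
  have hcont : Continuous fun α : ℝ => ‖∑ x ∈ I, addChar (α * f x)‖ ^ 2 := by
    have := continuous_addChar
    fun_prop
  have hT : ∀ x y, ∫ α in (-(2 * A))..(2 * A),
      max (2 * A - |α|) 0 * Real.cos (2 * Real.pi * (f x - f y) * α)
        ≤ D * (1 / (1 + ((⌊f x⌋ - ⌊f y⌋ : ℤ) : ℝ) ^ 2)) := by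
    intro x y
    set ω := 2 * Real.pi * (f x - f y) with hω
    have h1 := integral_tri_cos_le (b := 2 * A) (A := 2 * A) (by positivity) le_rfl ω
    have h2 := integral_tri_cos_nonneg (b := 2 * A) (A := 2 * A) (by positivity) le_rfl ω
    set T := ∫ α in (-(2 * A))..(2 * A), max (2 * A - |α|) 0 * Real.cos (ω * α)
    set t := f x - f y with ht
    set k : ℝ := ((⌊f x⌋ - ⌊f y⌋ : ℤ) : ℝ) with hk
    have hkt : |k - t| ≤ 1 := by
      rw [hk, ht, abs_le]
      push_cast
      have a1 := Int.floor_le (f x)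
      have a2 := Int.lt_floor_add_one (f x)
      have a3 := Int.floor_le (f y)
      have a4 := Int.lt_floor_add_one (f y)
      constructor <;> linarith
    have hkt2 : (k - t) ^ 2 ≤ 1 := by
      rw [← sq_abs]
      exact pow_le_one₀ (abs_nonneg _) hkt
    have hωt : t ^ 2 ≤ ω ^ 2 := by
      rw [hω, mul_pow]
      refine le_mul_of_one_le_left (sq_nonneg t) (one_le_pow₀ ?_)
      linarith [Real.pi_gt_three]
    have hk2 : 1 + k ^ 2 ≤ 3 * (1 + ω ^ 2) := by
      have : k ^ 2 ≤ 2 * t ^ 2 + 2 * (k - t) ^ 2 := by linarith [sq_nonneg (k - 2 * t)]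
      linarith [sq_nonneg t]
    rw [mul_one_div, le_div_iff₀ (by positivity)]
    calc T * (1 + k ^ 2) ≤ T * (3 * (1 + ω ^ 2)) := by gcongr
      _ = 3 * (T * (1 + ω ^ 2)) := by ring
      _ ≤ D := by
        rw [hD]
        gcongr
  have hcount : (#{p ∈ I ×ˢ I | ⌊f p.1⌋ = ⌊f p.2⌋} : ℝ) ≤ #{p ∈ I ×ˢ I | |f p.1 - f p.2| < 1} := by
    norm_cast
    refine card_le_card fun p hp => ?_
    rw [mem_filter] at hp ⊢
    exact ⟨hp.1, Int.abs_sub_lt_one_of_floor_eq_floor hp.2⟩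
  have hmain : ∫ α in (-(2 * A))..(2 * A), max (2 * A - |α|) 0 * ‖∑ x ∈ I, addChar (α * f x)‖ ^ 2
      ≤ D * K * #{p ∈ I ×ˢ I | |f p.1 - f p.2| < 1} := by
    simp_rw [norm_sq_sum_addChar, mul_sum]
    rw [intervalIntegral.integral_finsetSum
      fun x _ => Continuous.intervalIntegrable (by fun_prop) _ _]
    calc _ ≤ ∑ x ∈ I, ∑ y ∈ I, D * (1 / (1 + ((⌊f x⌋ - ⌊f y⌋ : ℤ) : ℝ) ^ 2)) := by
          refine sum_le_sum fun x _ => ?_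
          rw [intervalIntegral.integral_finsetSum
            fun y _ => Continuous.intervalIntegrable (by fun_prop) _ _]
          exact sum_le_sum fun y _ => hT x y
      _ = D * ∑ x ∈ I, ∑ y ∈ I, (1 / (1 + ((⌊f x⌋ - ⌊f y⌋ : ℤ) : ℝ) ^ 2)) := by
          simp_rw [mul_sum]
      _ ≤ D * (K * #{p ∈ I ×ˢ I | ⌊f p.1⌋ = ⌊f p.2⌋}) := by
          gcongr
          exact sum_sum_weight_le I (fun x => ⌊f x⌋) (w := fun k => 1 / (1 + (k : ℝ) ^ 2))
            (fun k => by positivity) (fun k => by simp) summable_one_div_one_add_sq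
      _ ≤ D * (K * #{p ∈ I ×ˢ I | |f p.1 - f p.2| < 1}) := by gcongr
      _ = _ := by ring
  have hstep : A * ∫ α in (-A)..A, ‖∑ x ∈ I, addChar (α * f x)‖ ^ 2
      ≤ D * K * #{p ∈ I ×ˢ I | |f p.1 - f p.2| < 1} := by
    refine le_trans ?_ hmain
    rw [← intervalIntegral.integral_const_mul]
    have hcont2 : Continuous fun α : ℝ =>
        max (2 * A - |α|) 0 * ‖∑ x ∈ I, addChar (α * f x)‖ ^ 2 := by fun_prop
    calc _ ≤ ∫ α in (-A)..A, max (2 * A - |α|) 0 * ‖∑ x ∈ I, addChar (α * f x)‖ ^ 2 := by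
          refine intervalIntegral.integral_mono_on (by linarith)
            ((hcont.const_smul A).intervalIntegrable _ _)
            (hcont2.intervalIntegrable _ _) fun α hα => ?_
          have : |α| ≤ A := abs_le.mpr hα
          gcongr
          exact le_max_of_le_left (by linarith)
      _ ≤ _ := by
          refine intervalIntegral.integral_mono_interval (by linarith) (by linarith) (by linarith)
            (Filter.Eventually.of_forall fun α => ?_) (hcont2.intervalIntegrable _ _)
          positivity
  have hn : (0 : ℝ) ≤ #{p ∈ I ×ˢ I | |f p.1 - f p.2| < 1} := Nat.cast_nonneg _
  calc _ = 1 / A * (A * ∫ α in (-A)..A, ‖∑ x ∈ I, addChar (α * f x)‖ ^ 2) := by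
        field_simp
    _ ≤ 1 / A * (D * K * #{p ∈ I ×ˢ I | |f p.1 - f p.2| < 1}) := by gcongr
    _ ≤ _ := by linarith

theorem exists_mean_value_le (A : ℝ) (hA : 0 < A) : ∃ C, 0 < C ∧ ∀ (n : ℕ) (θ φ : ℝ),
    160000 ≤ n → 0 ≤ θ → θ ≤ 1 → 0 ≤ φ → φ ≤ 1 →
      ∫ α in (-A)..A, (‖cubeSum (n ^ 5) (n ^ 5 + θ) α‖ * ‖cubeSum (n ^ 4) (n ^ 4 + φ) α‖) ^ 2
        ≤ C * (n : ℝ) ^ 9 := by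
  obtain ⟨C, hC, h⟩ := exists_integral_norm_sq_le A hA
  refine ⟨C * 711, by positivity, fun n θ φ hn hθ0 hθ1 hφ0 hφ1 => ?_⟩
  have h1 : ∀ α, cubeSum (n ^ 5) (n ^ 5 + θ) α * cubeSum (n ^ 4) (n ^ 4 + φ) α
      = ∑ p ∈ range (n ^ 5) ×ˢ range (n ^ 4), addChar (α * twoCubes n θ φ p) := by
    intro α
    rw [cubeSum, cubeSum, sum_mul_sum, sum_product]
    refine sum_congr rfl fun x _ => sum_congr rfl fun y _ => ?_
    rw [← addChar_add, twoCubes, mul_add]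
  simp_rw [← norm_mul, h1]
  refine (h _ _).trans ?_
  rw [mul_assoc]
  gcongr
  exact_mod_cast card_twoCubes_close_le hn hθ0 hθ1 hφ0 hφ1

theorem nearestDist_pos_of_irrational {x : ℝ} (hx : Irrational x) : 0 < nearestDist x := by
  rw [nearestDist, abs_pos, sub_ne_zero]
  exact hx.ne_int _

theorem norm_sum_shift_sub_le (u : ℕ → ℂ) (hu : ∀ y, ‖u y‖ ≤ 1) (N k : ℕ) :
    ‖∑ y ∈ range N, u (y + k) - ∑ y ∈ range N, u y‖ ≤ 2 * k := by
  have h1 : ∑ y ∈ range N, u (y + k) - ∑ y ∈ range N, u y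
      = ∑ y ∈ range k, u (y + N) - ∑ y ∈ range k, u y := by
    have a := sum_range_add u N k
    have b := sum_range_add u k N
    rw [add_comm k N, a] at b
    simp_rw [add_comm k, add_comm N] at b
    linear_combination b.symm
  rw [h1]
  refine (norm_sub_le _ _).trans ?_
  have h2 : ∀ v : ℕ → ℂ, (∀ y, ‖v y‖ ≤ 1) → ‖∑ y ∈ range k, v y‖ ≤ k := by
    intro v hv
    refine (norm_sum_le _ _).trans ((sum_le_sum fun y _ => hv y).trans ?_)
    simp
  have a := h2 u hu
  have b := h2 (fun y => u (y + N)) fun y => hu _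
  linarith

/-- The van der Corput inequality with step `q`, assuming a uniform bound on the correlations. -/
theorem norm_sum_le_of_correlations (u : ℕ → ℂ) (hu : ∀ y, ‖u y‖ ≤ 1) (N q H : ℕ) {D : ℝ}
    (hD0 : 0 ≤ D) (hD : ∀ j ∈ range H, ∀ j' ∈ range H, j ≠ j' →
      ‖∑ y ∈ range N, u (y + q * j) * (starRingEnd ℂ) (u (y + q * j'))‖ ≤ D) :
    H * ‖∑ y ∈ range N, u y‖ ≤ Real.sqrt (N * (H * N + H ^ 2 * D)) + 2 * q * H ^ 2 := by
  have h0 : ∀ j j', ‖∑ y ∈ range N, u (y + q * j) * (starRingEnd ℂ) (u (y + q * j'))‖ ≤ N := by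
    intro j j'
    refine (norm_sum_le _ _).trans ((sum_le_sum fun y _ => ?_).trans
      (by simp : ∑ y ∈ range N, (1 : ℝ) ≤ N))
    rw [norm_mul, RCLike.norm_conj]
    exact mul_le_one₀ (hu _) (norm_nonneg _) (hu _)
  set V : ℕ → ℂ := fun y => ∑ j ∈ range H, u (y + q * j) with hV
  have hVsq : ∑ y ∈ range N, ‖V y‖ ^ 2 ≤ H * N + H ^ 2 * D := by
    have h1 : ((∑ y ∈ range N, ‖V y‖ ^ 2 : ℝ) : ℂ) = ∑ j ∈ range H, ∑ j' ∈ range H,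
        ∑ y ∈ range N, u (y + q * j) * (starRingEnd ℂ) (u (y + q * j')) := by
      push_cast
      have : ∀ y, ((‖V y‖ : ℂ)) ^ 2 = ∑ j ∈ range H, ∑ j' ∈ range H,
          u (y + q * j) * (starRingEnd ℂ) (u (y + q * j')) := by
        intro y
        rw [← Complex.mul_conj', hV, map_sum, sum_mul_sum]
      simp_rw [this]
      rw [sum_comm]
      refine sum_congr rfl fun j _ => ?_
      rw [sum_comm]
    have hpos : 0 ≤ ∑ y ∈ range N, ‖V y‖ ^ 2 := sum_nonneg fun y _ => sq_nonneg _
    calc ∑ y ∈ range N, ‖V y‖ ^ 2 = ‖((∑ y ∈ range N, ‖V y‖ ^ 2 : ℝ) : ℂ)‖ := by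
          rw [Complex.norm_real, Real.norm_eq_abs, abs_of_nonneg hpos]
      _ ≤ ∑ j ∈ range H, ∑ j' ∈ range H, ((if j = j' then (N : ℝ) else 0) + D) := by
          rw [h1]
          refine (norm_sum_le _ _).trans (sum_le_sum fun j hj => (norm_sum_le _ _).trans
            (sum_le_sum fun j' hj' => ?_))
          split_ifs with h
          · exact (h0 j j').trans (by linarith)
          · rw [zero_add]
            exact hD j hj j' hj' h
      _ = ∑ j ∈ range H, (N + H * D) := by
          refine sum_congr rfl fun j hj => ?_
          rw [sum_add_distrib, sum_ite_eq, if_pos hj]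
          simp
      _ = _ := by
          rw [sum_const, card_range, nsmul_eq_mul]
          ring
  have hVsum : ‖∑ y ∈ range N, V y‖ ≤ Real.sqrt (N * (H * N + H ^ 2 * D)) := by
    refine (norm_sum_le _ _).trans (Real.le_sqrt_of_sq_le ?_)
    refine sq_sum_le_card_mul_sum_sq.trans ?_
    rw [card_range]
    gcongr
  have hdiff : ‖∑ y ∈ range N, V y - H * ∑ y ∈ range N, u y‖ ≤ 2 * q * H ^ 2 := by
    have h1 : ∑ y ∈ range N, V y - H * ∑ y ∈ range N, u y
        = ∑ j ∈ range H, (∑ y ∈ range N, u (y + q * j) - ∑ y ∈ range N, u y) := by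
      rw [sum_sub_distrib, sum_const, card_range, nsmul_eq_mul, hV, sum_comm]
    rw [h1]
    calc _ ≤ ∑ j ∈ range H, (2 * q * H : ℝ) := by
          refine (norm_sum_le _ _).trans (sum_le_sum fun j hj => ?_)
          refine (norm_sum_shift_sub_le u hu N (q * j)).trans ?_
          have : (j : ℝ) ≤ H := by exact_mod_cast (mem_range.mp hj).le
          push_cast
          rw [← mul_assoc]
          gcongr
      _ = _ := by
          rw [sum_const, card_range, nsmul_eq_mul]
          ring
  calc H * ‖∑ y ∈ range N, u y‖ = ‖(H : ℂ) * ∑ y ∈ range N, u y‖ := by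
        rw [norm_mul, Complex.norm_natCast]
    _ = ‖∑ y ∈ range N, V y - (∑ y ∈ range N, V y - H * ∑ y ∈ range N, u y)‖ := by
        rw [sub_sub_cancel]
    _ ≤ _ := (norm_sub_le _ _).trans (add_le_add hVsum hdiff)

theorem norm_correlation_le {θ α B : ℝ} (h0 : 0 ≤ θ) (h1 : θ ≤ 1) {q : ℕ}
    (hq : 0 < q) (a : ℤ) {N H j j' : ℕ} (hj : j < H) (hj' : j' < H) (hN : q * H + 1 ≤ N)
    (hα : |α - a / q| * (N : ℝ) ^ 3 ≤ B)
    (hnd : 0 < nearestDist (6 * a * ((j : ℤ) - (j' : ℤ) : ℤ) * θ)) :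
    ‖∑ y ∈ range N, addChar (α * (((y + q * j : ℕ) : ℝ) + θ) ^ 3)
        * (starRingEnd ℂ) (addChar (α * (((y + q * j' : ℕ) : ℝ) + θ) ^ 3))‖
      ≤ 1 / (2 * nearestDist (6 * a * ((j : ℤ) - (j' : ℤ) : ℤ) * θ))
        + 24 * Real.pi * B * q * H := by
  set b : ℝ := 6 * a * ((j : ℤ) - (j' : ℤ) : ℤ) * θ with hb
  set c : ℝ := 3 * a * ((j : ℤ) - (j' : ℤ) : ℤ) * θ ^ 2
    + 3 * a * q * ((j : ℤ) - (j' : ℤ) : ℤ) * (j + j') * θ with hc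
  set β : ℝ := α - a / q with hβ
  have hq0 : (0 : ℝ) < q := by exact_mod_cast hq
  have hNpos : (0 : ℝ) < N := by
    have : 0 < N := by omega
    exact_mod_cast this
  have hNq : (q : ℝ) * H + 1 ≤ N := by exact_mod_cast hN
  have hαβ : α = a / q + β := by rw [hβ]; ring
  set E : ℕ → ℝ := fun y => β * ((((y + q * j : ℕ) : ℝ) + θ) ^ 3 - (((y + q * j' : ℕ) : ℝ) + θ) ^ 3)
    with hE
  have hterm : ∀ y : ℕ, addChar (α * (((y + q * j : ℕ) : ℝ) + θ) ^ 3)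
        * (starRingEnd ℂ) (addChar (α * (((y + q * j' : ℕ) : ℝ) + θ) ^ 3))
      = addChar (b * y + c + E y) := by
    intro y
    rw [addChar_mul_conj]
    set m : ℤ := a * (3 * ((j : ℤ) - j') * y ^ 2 + 3 * q * ((j : ℤ) - j') * (j + j') * y
      + q ^ 2 * ((j : ℤ) ^ 3 - (j' : ℤ) ^ 3)) with hm
    have : α * (((y + q * j : ℕ) : ℝ) + θ) ^ 3 - α * (((y + q * j' : ℕ) : ℝ) + θ) ^ 3
        = m + (b * y + c + E y) := by
      simp only [hE]
      rw [hm, hb, hc, hαβ]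
      push_cast
      field_simp
      ring
    rw [this, addChar_add, addChar_intCast, one_mul]
  simp_rw [hterm]
  have hEle : ∀ y ∈ range N, |E y| ≤ 12 * B * q * H / N := by
    intro y hy
    have hyN : (y : ℝ) + 1 ≤ N := by exact_mod_cast mem_range.mp hy
    have hjH : (j : ℝ) ≤ H := by exact_mod_cast hj.le
    have hjH' : (j' : ℝ) ≤ H := by exact_mod_cast hj'.le
    have hjj : |(j : ℝ) - j'| ≤ H := by
      have := Nat.cast_nonneg (α := ℝ) j
      have := Nat.cast_nonneg (α := ℝ) j'
      rw [abs_le]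
      constructor <;> linarith
    set x1 : ℝ := ((y + q * j : ℕ) : ℝ) + θ with hx1
    set x2 : ℝ := ((y + q * j' : ℕ) : ℝ) + θ with hx2
    have hx10 : 0 ≤ x1 := by positivity
    have hx20 : 0 ≤ x2 := by positivity
    have hx1N : x1 ≤ 2 * N := by
      have : (q : ℝ) * j ≤ q * H := by gcongr
      rw [hx1]
      push_cast
      linarith
    have hx2N : x2 ≤ 2 * N := by
      have : (q : ℝ) * j' ≤ q * H := by gcongr
      rw [hx2]
      push_cast
      linarith
    have hdiff : |x1 - x2| ≤ q * H := by
      have : x1 - x2 = q * ((j : ℝ) - j') := by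
        rw [hx1, hx2]
        push_cast
        ring
      rw [this, abs_mul, abs_of_pos hq0]
      gcongr
    have hE1 : E y = β * ((x1 - x2) * (x1 ^ 2 + x1 * x2 + x2 ^ 2)) := by
      simp only [hE]
      ring
    rw [hE1, abs_mul, abs_mul, abs_of_nonneg (by positivity : 0 ≤ x1 ^ 2 + x1 * x2 + x2 ^ 2),
      le_div_iff₀ hNpos]
    calc |β| * (|x1 - x2| * (x1 ^ 2 + x1 * x2 + x2 ^ 2)) * N
        ≤ |β| * ((q * H) * ((2 * N) ^ 2 + (2 * N) * (2 * N) + (2 * N) ^ 2)) * N := by gcongr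
      _ = 12 * (|β| * (N : ℝ) ^ 3) * q * H := by ring
      _ ≤ _ := by gcongr
  have hlin : ‖∑ y ∈ range N, addChar (b * y + c)‖ ≤ 1 / (2 * nearestDist b) := by
    rw [le_div_iff₀ (by positivity), mul_comm]
    exact nearestDist_mul_norm_sum_le N b c
  have herr : ‖∑ y ∈ range N, addChar (b * y + c + E y) - ∑ y ∈ range N, addChar (b * y + c)‖
      ≤ 24 * Real.pi * B * q * H := by
    rw [← sum_sub_distrib]
    calc _ ≤ ∑ y ∈ range N, 2 * Real.pi * (12 * B * q * H / N) := by
          refine (norm_sum_le _ _).trans (sum_le_sum fun y hy => ?_)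
          refine (norm_addChar_sub_le _ _).trans ?_
          rw [add_sub_cancel_left]
          have := hEle y hy
          have := Real.pi_pos
          gcongr
      _ = _ := by
          rw [sum_const, card_range, nsmul_eq_mul]
          field_simp
          ring
  calc _ = ‖∑ y ∈ range N, addChar (b * y + c) + (∑ y ∈ range N, addChar (b * y + c + E y)
        - ∑ y ∈ range N, addChar (b * y + c))‖ := by rw [add_sub_cancel]
    _ ≤ _ := (norm_add_le _ _).trans (add_le_add hlin herr)

/-- Near a rational number with nonzero numerator, a cubic Weyl sum with an irrational shift is
`o(N)`. -/
theorem exists_norm_cubeSum_le_of_irrational {θ : ℝ} (hθ : Irrational θ) (h0 : 0 ≤ θ) (h1 : θ ≤ 1)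
    {q : ℕ} (hq : 0 < q) {a : ℤ} (ha : a ≠ 0) {B ε : ℝ} (hB : 0 ≤ B) (hε : 0 < ε) :
    ∃ N0 : ℕ, ∀ N ≥ N0, ∀ α : ℝ, |α - a / q| * (N : ℝ) ^ 3 ≤ B →
      ‖cubeSum N θ α‖ ≤ ε * N := by
  obtain ⟨H, hH⟩ := exists_nat_gt (8 / ε ^ 2)
  have hHpos : (0 : ℝ) < H := lt_of_le_of_lt (by positivity) hH
  set nd : ℕ → ℕ → ℝ := fun j j' => nearestDist (6 * a * ((j : ℤ) - (j' : ℤ) : ℤ) * θ) with hnd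
  set D : ℝ := ∑ j ∈ range H, ∑ j' ∈ range H, 1 / (2 * nd j j') + 24 * Real.pi * B * q * H with hD
  have hnd0 : ∀ j j', 0 ≤ 1 / (2 * nd j j') := fun j j' =>
    one_div_nonneg.mpr (mul_nonneg zero_le_two (nearestDist_nonneg _))
  have hD0 : 0 ≤ D := by
    have := sum_nonneg fun j (_ : j ∈ range H) => sum_nonneg fun j' (_ : j' ∈ range H) => hnd0 j j'
    have := Real.pi_pos
    positivity
  obtain ⟨N1, hN1⟩ := exists_nat_ge (H * D + 4 * q * H / ε)
  refine ⟨max N1 (q * H + 1), fun N hN α hα => ?_⟩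
  have hNN1 : (N1 : ℝ) ≤ N := by exact_mod_cast (le_max_left _ _).trans hN
  have hNqH : q * H + 1 ≤ N := (le_max_right _ _).trans hN
  have hNε : 4 * q * H / ε ≤ N := by linarith [mul_nonneg hHpos.le hD0]
  have hND : H * D ≤ N := by
    have : 0 ≤ 4 * q * H / ε := by positivity
    linarith
  have hcorr := norm_sum_le_of_correlations (fun y => addChar (α * ((y : ℝ) + θ) ^ 3))
    (fun y => (norm_addChar _).le) N q H hD0 fun j hj j' hj' hjj => by
      have hirr : Irrational (6 * a * ((j : ℤ) - (j' : ℤ) : ℤ) * θ) := by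
        have hz : (6 * a * ((j : ℤ) - (j' : ℤ)) : ℤ) ≠ 0 := by
          refine mul_ne_zero (mul_ne_zero (by norm_num) ha) (sub_ne_zero.mpr ?_)
          exact_mod_cast hjj
        have := hθ.intCast_mul hz
        push_cast at this ⊢
        exact this
      refine (norm_correlation_le h0 h1 hq a (mem_range.mp hj) (mem_range.mp hj') hNqH hα
        (nearestDist_pos_of_irrational hirr)).trans ?_
      rw [hD]
      gcongr
      exact (single_le_sum (f := fun j' => 1 / (2 * nd j j')) (fun j' _ => hnd0 j j') hj').trans
        (single_le_sum (f := fun j => ∑ j' ∈ range H, 1 / (2 * nd j j'))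
          (fun j _ => sum_nonneg fun j' _ => hnd0 j j') hj)
  rw [← cubeSum] at hcorr
  have hsqrt : Real.sqrt (N * (H * N + H ^ 2 * D)) ≤ ε * N * H / 2 := by
    refine Real.sqrt_le_iff.mpr ⟨by positivity, ?_⟩
    have e1 : (H : ℝ) ^ 2 * D ≤ H * N := by
      calc (H : ℝ) ^ 2 * D = H * (H * D) := by ring
        _ ≤ _ := by gcongr
    have e2 : 8 ≤ ε ^ 2 * H := by
      rw [div_lt_iff₀ (by positivity)] at hH
      linarith
    calc (N : ℝ) * (H * N + H ^ 2 * D) ≤ N * (H * N + H * N) := by gcongr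
      _ = 8 * (H * N ^ 2 / 4) := by ring
      _ ≤ ε ^ 2 * H * (H * N ^ 2 / 4) := by gcongr
      _ = _ := by ring
  have hlast : 2 * q * (H : ℝ) ^ 2 ≤ ε * N * H / 2 := by
    rw [div_le_iff₀ hε] at hNε
    have := mul_le_mul_of_nonneg_left hNε hHpos.le
    linarith
  refine le_of_mul_le_mul_left ?_ hHpos
  linarith

/-- The lengths of the nine blocks of variables. -/
def blockLen (n : ℕ) : Fin 9 → ℕ :=
  ![n ^ 5, n ^ 5, n ^ 5, n ^ 5, n ^ 5, n ^ 5, n ^ 5, n ^ 4, n ^ 4]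

/-- The shifts of the nine blocks of variables; the last four blocks are dyadic. -/
noncomputable def blockShift (n : ℕ) (θ : Fin 9 → ℝ) : Fin 9 → ℝ :=
  ![θ 0, θ 1, θ 2, θ 3, θ 4, n ^ 5 + θ 5, n ^ 5 + θ 6, n ^ 4 + θ 7, n ^ 4 + θ 8]

/-- The generating function counting representations by nine shifted cubes. -/
noncomputable def genFun (n : ℕ) (θ : Fin 9 → ℝ) (α : ℝ) : ℂ :=
  ∏ i, cubeSum (blockLen n i) (blockShift n θ i) α

theorem genFun_eq (n : ℕ) (θ : Fin 9 → ℝ) (α : ℝ) :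
    genFun n θ α = cubeSum (n ^ 5) (θ 0) α * cubeSum (n ^ 5) (θ 1) α * cubeSum (n ^ 5) (θ 2) α
      * cubeSum (n ^ 5) (θ 3) α * cubeSum (n ^ 5) (θ 4) α * cubeSum (n ^ 5) (n ^ 5 + θ 5) α
      * cubeSum (n ^ 5) (n ^ 5 + θ 6) α * cubeSum (n ^ 4) (n ^ 4 + θ 7) α
      * cubeSum (n ^ 4) (n ^ 4 + θ 8) α := by
  simp only [genFun, Fin.prod_univ_castSucc, Fin.prod_univ_zero, one_mul]
  rfl

theorem continuous_genFun (n : ℕ) (θ : Fin 9 → ℝ) : Continuous (genFun n θ) :=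
  continuous_finsetProd _ fun _ _ => continuous_cubeSum _ _

theorem norm_genFun_le_of_bounds {n : ℕ} {θ : Fin 9 → ℝ} {α T U V : ℝ}
    (hT : ‖cubeSum (n ^ 5) (θ 0) α‖ ≤ T) (hU : ∀ t, ‖cubeSum (n ^ 5) t α‖ ≤ U)
    (hV : ∀ t, ‖cubeSum (n ^ 4) t α‖ ≤ V) : ‖genFun n θ α‖ ≤ T * U ^ 6 * V ^ 2 := by
  have hT0 : 0 ≤ T := (norm_nonneg _).trans hT
  have hU0 : 0 ≤ U := (norm_nonneg _).trans (hU 0)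
  have hV0 : 0 ≤ V := (norm_nonneg _).trans (hV 0)
  rw [genFun_eq]
  simp only [norm_mul]
  calc _ ≤ T * U * U * U * U * U * U * V * V := by
        gcongr <;> first | exact hU _ | exact hV _
    _ = _ := by ring

theorem exists_mul_rpow_neg_le {C c ε : ℝ} (hc : 0 < c) (hε : 0 < ε) :
    ∃ X : ℝ, 1 ≤ X ∧ ∀ x ≥ X, C * x ^ (-c) ≤ ε := by
  have h := (tendsto_rpow_neg_atTop hc).const_mul C
  rw [mul_zero] at h
  obtain ⟨X, hX⟩ := Filter.eventually_atTop.mp (h.eventually (gt_mem_nhds hε))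
  exact ⟨max X 1, le_max_right _ _, fun x hx => (hX x ((le_max_left _ _).trans hx)).le⟩

theorem major_bound_eq {C P Q q b : ℝ} (hq : 1 ≤ q) (hb : 1 ≤ b) :
    C * P * (q ^ (-(199 / 800) : ℝ) * b ^ (-(1 / 6) : ℝ))
        * (C * P * (q ^ (-(199 / 800) : ℝ) * b ^ (-(1 / 6) : ℝ))) ^ 6
        * (C * Q * q ^ (-(39 / 200) : ℝ)) ^ 2
      = C ^ 9 * (q ^ (-(13 / 160) : ℝ) * b ^ (-(1 / 12) : ℝ))
        * (P ^ 7 * Q ^ 2 * (q ^ (-(41 / 20) : ℝ) * b ^ (-(13 / 12) : ℝ))) := by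
  have hq0 : 0 < q := by linarith
  have hb0 : 0 < b := by linarith
  have e1 : (q ^ (-(199 / 800) : ℝ)) ^ 7 * (q ^ (-(39 / 200) : ℝ)) ^ 2
      = q ^ (-(13 / 160) : ℝ) * q ^ (-(41 / 20) : ℝ) := by
    rw [← Real.rpow_mul_natCast hq0.le, ← Real.rpow_mul_natCast hq0.le, ← Real.rpow_add hq0,
      ← Real.rpow_add hq0]
    norm_num
  have e2 : (b ^ (-(1 / 6) : ℝ)) ^ 7 = b ^ (-(1 / 12) : ℝ) * b ^ (-(13 / 12) : ℝ) := by
    rw [← Real.rpow_mul_natCast hb0.le, ← Real.rpow_add hb0]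
    norm_num
  calc _ = C ^ 9 * P ^ 7 * Q ^ 2 * ((q ^ (-(199 / 800) : ℝ)) ^ 7 * (q ^ (-(39 / 200) : ℝ)) ^ 2)
        * (b ^ (-(1 / 6) : ℝ)) ^ 7 := by ring
    _ = _ := by
      rw [e1, e2]
      ring

theorem exists_norm_genFun_le {θ₀ : ℝ} (hθ : Irrational θ₀) (h0 : 0 ≤ θ₀) (h1 : θ₀ ≤ 1) (A : ℝ)
    {ε : ℝ} (hε : 0 < ε) : ∃ R : ℝ, 0 < R ∧ ∃ C : ℝ, 0 < C ∧ ∃ n₀ : ℕ, 0 < n₀ ∧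
      ∀ n ≥ n₀, ∀ θ : Fin 9 → ℝ, θ 0 = θ₀ → ∀ α : ℝ, |α| ≤ A →
      ‖genFun n θ α‖ ≤ C * (n : ℝ) ^ (151 / 8 : ℝ) *
        ((‖cubeSum (n ^ 5) (n ^ 5 + θ 5) α‖ * ‖cubeSum (n ^ 4) (n ^ 4 + θ 7) α‖) ^ 2
        + (‖cubeSum (n ^ 5) (n ^ 5 + θ 6) α‖ * ‖cubeSum (n ^ 4) (n ^ 4 + θ 8) α‖) ^ 2) ∨
      ∃ r : ℚ, r.den ≤ n ^ 5 ∧ |(r.num : ℝ)| ≤ (A + 1) * r.den ∧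
        min 1 (|α| * (n : ℝ) ^ 15 / R) * ‖genFun n θ α‖ ≤ ε * ((n : ℝ) ^ 43 *
          ((r.den : ℝ) ^ (-(41 / 20) : ℝ) * (1 + (n : ℝ) ^ 15 * |α - r|) ^ (-(13 / 12) : ℝ))) := by
  obtain ⟨C, hC1, hdich⟩ := exists_weyl_dichotomy
  have hC0 : 0 < C := by linarith
  obtain ⟨X, hX1, hX⟩ := exists_mul_rpow_neg_le (C := C ^ 9) (c := 13 / 160) (by norm_num) hε
  obtain ⟨Y, hY1, hY⟩ := exists_mul_rpow_neg_le (C := C ^ 9) (c := 1 / 12) (by norm_num) hε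
  have hX0 : 0 < X := by linarith
  have hY0 : 0 < Y := by linarith
  set δ : ℝ := ε * (X ^ (-(41 / 20) : ℝ) * Y ^ (-(13 / 12) : ℝ)) with hδ
  have hδ0 : 0 < δ := by positivity
  -- finitely many rationals need the irrationality of the shift
  have hfin : ∃ N0 : ℕ, ∀ q : ℕ, 0 < q → (q : ℝ) ≤ X → ∀ a : ℤ, a ≠ 0 →
      |(a : ℝ)| ≤ (A + 1) * X → ∀ N ≥ N0, ∀ α : ℝ, |α - a / q| * (N : ℝ) ^ 3 ≤ Y →
      ‖cubeSum N θ₀ α‖ ≤ δ * N := by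
    have hex : ∀ p : ℕ × ℤ, ∃ N0 : ℕ, 0 < p.1 → p.2 ≠ 0 → ∀ N ≥ N0, ∀ α : ℝ,
        |α - p.2 / p.1| * (N : ℝ) ^ 3 ≤ Y → ‖cubeSum N θ₀ α‖ ≤ δ * N := by
      intro p
      by_cases hp : 0 < p.1 ∧ p.2 ≠ 0
      · obtain ⟨N0, hN0⟩ := exists_norm_cubeSum_le_of_irrational hθ h0 h1 hp.1 hp.2 hY0.le hδ0
        exact ⟨N0, fun _ _ => hN0⟩
      · exact ⟨0, fun h h' => absurd ⟨h, h'⟩ hp⟩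
    choose f hf using hex
    set I : Finset (ℕ × ℤ) := range (⌊X⌋₊ + 1) ×ˢ Icc (-⌊(A + 1) * X⌋) ⌊(A + 1) * X⌋ with hI
    refine ⟨I.sup f, fun q hq hqX a ha haX N hN α hα => ?_⟩
    refine hf (q, a) hq ha N (le_trans ?_ hN) α hα
    refine le_sup (f := f) ?_
    rw [hI, mem_product, mem_range, mem_Icc, ← abs_le]
    refine ⟨Nat.lt_succ_of_le (Nat.le_floor hqX), Int.le_floor.mpr ?_⟩
    push_cast
    exact haX
  obtain ⟨N0, hN0⟩ := hfin
  refine ⟨Y / δ, by positivity, C ^ 5, by positivity, N0 + 1, by omega,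
    fun n hn θ hθ0 α hα => ?_⟩
  have hn0 : 0 < n := by omega
  have hnR : (1 : ℝ) ≤ n := by exact_mod_cast hn0
  rcases hdich n α hn0 with hminor | ⟨r, hr1, hr2, hr3, hr4⟩
  · left
    rw [genFun_eq]
    simp only [norm_mul]
    set s5 := ‖cubeSum (n ^ 5) (n ^ 5 + θ 5) α‖
    set s6 := ‖cubeSum (n ^ 5) (n ^ 5 + θ 6) α‖
    set s7 := ‖cubeSum (n ^ 4) (n ^ 4 + θ 7) α‖
    set s8 := ‖cubeSum (n ^ 4) (n ^ 4 + θ 8) α‖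
    have e1 : (C * (n : ℝ) ^ (151 / 40 : ℝ)) ^ 5 = C ^ 5 * (n : ℝ) ^ (151 / 8 : ℝ) := by
      rw [mul_pow, ← Real.rpow_mul_natCast (by positivity)]
      norm_num
    have hs5 : 0 ≤ s5 := norm_nonneg _
    have hs6 : 0 ≤ s6 := norm_nonneg _
    have hs7 : 0 ≤ s7 := norm_nonneg _
    have hs8 : 0 ≤ s8 := norm_nonneg _
    set W := C * (n : ℝ) ^ (151 / 40 : ℝ)
    have hW : 0 ≤ W := (norm_nonneg _).trans (hminor 0)
    calc _ ≤ W * W * W * W * W * s5 * s6 * s7 * s8 := by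
          gcongr <;> exact hminor _
      _ = W ^ 5 * ((s5 * s7) * (s6 * s8)) := by ring
      _ ≤ W ^ 5 * ((s5 * s7) ^ 2 + (s6 * s8) ^ 2) := by
          gcongr
          linarith [sq_nonneg (s5 * s7 - s6 * s8), sq_nonneg (s5 * s7), sq_nonneg (s6 * s8)]
      _ = _ := by rw [e1]
  · right
    have hq0 : 0 < r.den := r.den_pos
    have hq1 : (1 : ℝ) ≤ r.den := by exact_mod_cast hq0
    have hqpos : (0 : ℝ) < r.den := by linarith
    have hrcast : (r : ℝ) = r.num / r.den := Rat.cast_def r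
    have hnum : |(r.num : ℝ)| ≤ (A + 1) * r.den := by
      have h2 : |α - r| ≤ 1 := by
        have h3 : (1 : ℝ) ≤ 12 * (n : ℝ) ^ 10 * r.den := by
          have := one_le_mul_of_one_le_of_one_le (one_le_pow₀ hnR (n := 10)) hq1
          linarith
        exact (le_mul_of_one_le_right (abs_nonneg _) h3).trans hr2
      have h4 : |(r : ℝ)| ≤ A + 1 := by
        have := abs_sub_abs_le_abs_sub (r : ℝ) α
        rw [abs_sub_comm] at this
        linarith
      rw [hrcast, abs_div, abs_of_pos hqpos, div_le_iff₀ hqpos] at h4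
      exact h4
    refine ⟨r, hr1, hnum, ?_⟩
    set b : ℝ := 1 + (n : ℝ) ^ 15 * |α - r| with hb
    have hb1 : 1 ≤ b := by
      have : 0 ≤ (n : ℝ) ^ 15 * |α - r| := by positivity
      linarith
    have hb0 : 0 < b := by linarith
    have hω0 : 0 ≤ min 1 (|α| * (n : ℝ) ^ 15 / (Y / δ)) := le_min zero_le_one (by positivity)
    have hω1 : min 1 (|α| * (n : ℝ) ^ 15 / (Y / δ)) ≤ 1 := min_le_left _ _
    have hG0 := norm_nonneg (genFun n θ α)
    by_cases hbig : X ≤ r.den ∨ Y ≤ b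
    · have hmaj := norm_genFun_le_of_bounds (θ := θ) (hr3 (θ 0)) hr3 hr4
      rw [major_bound_eq hq1 hb1] at hmaj
      have hfac : C ^ 9 * ((r.den : ℝ) ^ (-(13 / 160) : ℝ) * b ^ (-(1 / 12) : ℝ)) ≤ ε := by
        have u1 : (r.den : ℝ) ^ (-(13 / 160) : ℝ) ≤ 1 :=
          Real.rpow_le_one_of_one_le_of_nonpos hq1 (by norm_num)
        have u2 : b ^ (-(1 / 12) : ℝ) ≤ 1 :=
          Real.rpow_le_one_of_one_le_of_nonpos hb1 (by norm_num)
        rcases hbig with h | h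
        · refine le_trans ?_ (hX _ h)
          gcongr
          exact mul_le_of_le_one_right (by positivity) u2
        · refine le_trans ?_ (hY _ h)
          gcongr
          exact mul_le_of_le_one_left (by positivity) u1
      calc _ ≤ ‖genFun n θ α‖ := mul_le_of_le_one_left hG0 hω1
        _ ≤ _ := hmaj
        _ ≤ ε * (((n : ℝ) ^ 5) ^ 7 * ((n : ℝ) ^ 4) ^ 2
            * ((r.den : ℝ) ^ (-(41 / 20) : ℝ) * b ^ (-(13 / 12) : ℝ))) := by
          gcongr
        _ = _ := by ring
    · push Not at hbig
      obtain ⟨hqX, hbY⟩ := hbig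
      have hδle : δ ≤ ε * ((r.den : ℝ) ^ (-(41 / 20) : ℝ) * b ^ (-(13 / 12) : ℝ)) := by
        rw [hδ]
        have u1 := Real.rpow_le_rpow_of_nonpos hqpos hqX.le (by norm_num : (-(41 / 20) : ℝ) ≤ 0)
        have u2 := Real.rpow_le_rpow_of_nonpos hb0 hbY.le (by norm_num : (-(13 / 12) : ℝ) ≤ 0)
        gcongr
      have htriv5 : ∀ t, ‖cubeSum (n ^ 5) t α‖ ≤ (n : ℝ) ^ 5 := fun t => by
        exact_mod_cast norm_cubeSum_le (n ^ 5) t α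
      have htriv4 : ∀ t, ‖cubeSum (n ^ 4) t α‖ ≤ (n : ℝ) ^ 4 := fun t => by
        exact_mod_cast norm_cubeSum_le (n ^ 4) t α
      have key : min 1 (|α| * (n : ℝ) ^ 15 / (Y / δ)) * ‖genFun n θ α‖ ≤ δ * (n : ℝ) ^ 43 := by
        by_cases hnum0 : r.num = 0
        · have hr0 : (r : ℝ) = 0 := by rw [hrcast, hnum0, Int.cast_zero, zero_div]
          have h2 : min 1 (|α| * (n : ℝ) ^ 15 / (Y / δ)) ≤ δ := by
            refine (min_le_right _ _).trans ?_
            rw [div_le_iff₀ (by positivity), mul_div_cancel₀ _ hδ0.ne']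
            rw [hb, hr0, sub_zero] at hbY
            linarith
          have h3 := norm_genFun_le_of_bounds (θ := θ) (htriv5 (θ 0)) htriv5 htriv4
          have h4 : (n : ℝ) ^ 5 * ((n : ℝ) ^ 5) ^ 6 * ((n : ℝ) ^ 4) ^ 2 = (n : ℝ) ^ 43 := by ring
          rw [h4] at h3
          gcongr
        · have hnN : N0 ≤ n ^ 5 := by
            have : n ≤ n ^ 5 := Nat.le_self_pow (by norm_num) n
            omega
          have hAX : |(r.num : ℝ)| ≤ (A + 1) * X := by
            refine hnum.trans ?_
            have : 0 ≤ A := (abs_nonneg _).trans hα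
            gcongr
          have hS := hN0 r.den hq0 hqX.le r.num hnum0 hAX (n ^ 5) hnN α (by
            rw [← hrcast]
            push_cast
            calc |α - r| * ((n : ℝ) ^ 5) ^ 3 = (n : ℝ) ^ 15 * |α - r| := by ring
              _ ≤ Y := by linarith)
          rw [← hθ0] at hS
          push_cast at hS
          have h3 := norm_genFun_le_of_bounds (θ := θ) hS htriv5 htriv4
          calc _ ≤ ‖genFun n θ α‖ := mul_le_of_le_one_left hG0 hω1
            _ ≤ _ := h3
            _ = _ := by ring
      calc _ ≤ δ * (n : ℝ) ^ 43 := key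
        _ ≤ ε * ((r.den : ℝ) ^ (-(41 / 20) : ℝ) * b ^ (-(13 / 12) : ℝ)) * (n : ℝ) ^ 43 := by gcongr
        _ = _ := by ring

theorem integral_one_add_abs_le {X A : ℝ} (hX : 0 < X) (hA : 0 ≤ A) (t : ℝ) :
    ∫ α in (-A)..A, (1 + X * |α - t|) ^ (-(13 / 12) : ℝ)
      ≤ (∫ x : ℝ, (1 + |x|) ^ (-(13 / 12) : ℝ)) / X := by
  set g : ℝ → ℝ := fun x => (1 + |x|) ^ (-(13 / 12) : ℝ) with hg
  have hgi : MeasureTheory.Integrable g :=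
    integrable_one_add_norm (E := ℝ) (μ := MeasureTheory.volume) (r := 13 / 12)
      (by rw [Module.finrank_self]; norm_num)
  have hg0 : ∀ x, 0 ≤ g x := fun x => by positivity
  have h1 : ∀ α, (1 + X * |α - t|) ^ (-(13 / 12) : ℝ) = (fun y => g (X * y)) (α - t) := by
    intro α
    simp only [hg, abs_mul, abs_of_pos hX]
  simp_rw [h1]
  rw [intervalIntegral.integral_of_le (by linarith)]
  refine (MeasureTheory.setIntegral_le_integral ((hgi.comp_mul_left' hX.ne').comp_sub_right t)
    (Filter.Eventually.of_forall fun α => hg0 _)).trans ?_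
  rw [MeasureTheory.integral_sub_right_eq_self (fun y => g (X * y)),
    MeasureTheory.Measure.integral_comp_mul_left, abs_of_pos (by positivity), smul_eq_mul,
    div_eq_inv_mul]

theorem exists_sum_farey_le (M : ℕ) : ∃ B : ℝ, 0 < B ∧ ∀ N : ℕ,
    ∑ q ∈ Icc 1 N, ∑ _a ∈ Icc (-((M * q : ℕ) : ℤ)) ((M * q : ℕ) : ℤ), (q : ℝ) ^ (-(41 / 20) : ℝ)
      ≤ B := by
  have hs : Summable fun q : ℕ => (q : ℝ) ^ (-(21 / 20) : ℝ) :=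
    Real.summable_nat_rpow.mpr (by norm_num)
  have hS0 : 0 ≤ ∑' q : ℕ, (q : ℝ) ^ (-(21 / 20) : ℝ) := tsum_nonneg fun q => by positivity
  refine ⟨(2 * M + 1) * ∑' q : ℕ, (q : ℝ) ^ (-(21 / 20) : ℝ) + 1, by positivity, fun N => ?_⟩
  calc _ ≤ ∑ q ∈ Icc 1 N, (2 * M + 1) * (q : ℝ) ^ (-(21 / 20) : ℝ) := by
        refine sum_le_sum fun q hq => ?_
        have hq1 : (1 : ℝ) ≤ q := by exact_mod_cast (mem_Icc.mp hq).1
        have e : (q : ℝ) ^ (-(21 / 20) : ℝ) = q * (q : ℝ) ^ (-(41 / 20) : ℝ) := by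
          rw [← Real.rpow_one_add' (by linarith) (by norm_num)]
          norm_num
        have hc : ((Icc (-((M * q : ℕ) : ℤ)) ((M * q : ℕ) : ℤ)).card : ℝ) = 2 * (M * q) + 1 := by
          rw [Int.card_Icc]
          have : (((M * q : ℕ) : ℤ) + 1 - -((M * q : ℕ) : ℤ)).toNat = 2 * (M * q) + 1 := by omega
          rw [this]
          push_cast
          ring
        have h : (2 * (M * q) + 1 : ℝ) ≤ (2 * M + 1) * q := by linarith
        rw [sum_const, nsmul_eq_mul, hc, e]
        calc _ ≤ (2 * M + 1) * (q : ℝ) * (q : ℝ) ^ (-(41 / 20) : ℝ) := by gcongr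
          _ = _ := by ring
    _ ≤ _ := by
        rw [← mul_sum]
        have := hs.sum_le_tsum (Icc 1 N) fun q _ => by positivity
        nlinarith [mul_le_mul_of_nonneg_left this (show (0 : ℝ) ≤ 2 * M + 1 by positivity)]

theorem exists_integral_norm_genFun_le {θ₀ : ℝ} (hθ : Irrational θ₀) (h0 : 0 ≤ θ₀) (h1 : θ₀ ≤ 1)
    {A : ℝ} (hA : 0 < A) {ε : ℝ} (hε : 0 < ε) : ∃ R : ℝ, 0 < R ∧ ∃ n₀ : ℕ, 0 < n₀ ∧
      ∀ n ≥ n₀, ∀ θ : Fin 9 → ℝ, θ 0 = θ₀ → (∀ i, 0 ≤ θ i) → (∀ i, θ i ≤ 1) →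
        ∫ α in (-A)..A, min 1 (|α| * (n : ℝ) ^ 15 / R) * ‖genFun n θ α‖ ≤ ε * (n : ℝ) ^ 28 := by
  obtain ⟨M, hM⟩ := exists_nat_ge (A + 1)
  obtain ⟨B, hB, hsum⟩ := exists_sum_farey_le M
  obtain ⟨D, hD, hmean⟩ := exists_mean_value_le A hA
  set K := ∫ x : ℝ, (1 + |x|) ^ (-(13 / 12) : ℝ) with hK
  have hK0 : 0 ≤ K := MeasureTheory.integral_nonneg fun x => by positivity
  obtain ⟨R, hR, C, hC, n₁, hn₁, hpt⟩ := exists_norm_genFun_le hθ h0 h1 A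
    (ε := ε / (2 * (B * (K + 1)))) (by positivity)
  obtain ⟨X, hX1, hX⟩ := exists_mul_rpow_neg_le (C := C * (2 * D)) (c := 1 / 8) (ε := ε / 2)
    (by norm_num) (by positivity)
  obtain ⟨n₂, hn₂⟩ := exists_nat_ge X
  refine ⟨R, hR, max n₁ (max n₂ 160000), by simp, fun n hn θ hθ0 hθn hθ1 => ?_⟩
  have hnn₁ : n₁ ≤ n := le_trans (by simp) hn
  have hnn₂ : n₂ ≤ n := le_trans (by simp) hn
  have hn3 : 160000 ≤ n := le_trans (by simp) hn
  have hn0 : (0 : ℝ) < n := by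
    have : 0 < n := by omega
    exact_mod_cast this
  set δ := ε / (2 * (B * (K + 1))) with hδ
  have hδ0 : 0 < δ := by positivity
  set m₁ : ℝ → ℝ := fun α =>
    (‖cubeSum (n ^ 5) (n ^ 5 + θ 5) α‖ * ‖cubeSum (n ^ 4) (n ^ 4 + θ 7) α‖) ^ 2 with hm₁
  set m₂ : ℝ → ℝ := fun α =>
    (‖cubeSum (n ^ 5) (n ^ 5 + θ 6) α‖ * ‖cubeSum (n ^ 4) (n ^ 4 + θ 8) α‖) ^ 2 with hm₂
  have hcm₁ : Continuous m₁ :=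
    (((continuous_cubeSum _ _).norm).mul ((continuous_cubeSum _ _).norm)).pow 2
  have hcm₂ : Continuous m₂ :=
    (((continuous_cubeSum _ _).norm).mul ((continuous_cubeSum _ _).norm)).pow 2
  set J : ℕ → ℤ → ℝ → ℝ := fun q a α => (q : ℝ) ^ (-(41 / 20) : ℝ) *
    (1 + (n : ℝ) ^ 15 * |α - (a : ℝ) / q|) ^ (-(13 / 12) : ℝ) with hJ
  have hJ0 : ∀ q a α, 0 ≤ J q a α := fun q a α => by positivity
  have hJc : ∀ q a, Continuous (J q a) := by
    intro q a
    refine continuous_const.mul (Continuous.rpow_const (by fun_prop) fun α => Or.inl ?_)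
    positivity
  set F : ℕ → Finset ℤ := fun q => Icc (-((M * q : ℕ) : ℤ)) ((M * q : ℕ) : ℤ) with hF
  set T : ℝ → ℝ := fun α => ∑ q ∈ Icc 1 (n ^ 5), ∑ a ∈ F q, J q a α with hT
  have hTc : Continuous T :=
    continuous_finsetSum _ fun q _ => continuous_finsetSum _ fun a _ => hJc q a
  have hT0 : ∀ α, 0 ≤ T α := fun α => sum_nonneg fun q _ => sum_nonneg fun a _ => hJ0 q a α
  have hm0 : ∀ α, 0 ≤ m₁ α + m₂ α := fun α => by positivity
  have hpoint : ∀ α ∈ Set.Icc (-A) A, min 1 (|α| * (n : ℝ) ^ 15 / R) * ‖genFun n θ α‖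
      ≤ C * (n : ℝ) ^ (151 / 8 : ℝ) * (m₁ α + m₂ α) + δ * (n : ℝ) ^ 43 * T α := by
    intro α hα
    rcases hpt n hnn₁ θ hθ0 α (abs_le.mpr hα) with h | ⟨r, hr1, hr2, h⟩
    · have h2 : min 1 (|α| * (n : ℝ) ^ 15 / R) * ‖genFun n θ α‖ ≤ 1 * ‖genFun n θ α‖ :=
        mul_le_mul_of_nonneg_right (min_le_left _ _) (norm_nonneg _)
      have h3 : 0 ≤ δ * (n : ℝ) ^ 43 * T α := mul_nonneg (by positivity) (hT0 α)
      linarith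
    · have h3 : 0 ≤ C * (n : ℝ) ^ (151 / 8 : ℝ) * (m₁ α + m₂ α) :=
        mul_nonneg (by positivity) (hm0 α)
      have hmem : r.num ∈ F r.den := by
        have h5 : |(r.num : ℝ)| ≤ ((M * r.den : ℕ) : ℝ) := by
          push_cast
          exact hr2.trans (by gcongr)
        rw [abs_le] at h5
        rw [hF, mem_Icc]
        constructor <;> [have := h5.1; have := h5.2] <;> exact_mod_cast this
      have h4 : J r.den r.num α ≤ T α :=
        (single_le_sum (f := fun a => J r.den a α) (fun a _ => hJ0 _ _ _) hmem).trans
          (single_le_sum (f := fun q => ∑ a ∈ F q, J q a α)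
            (fun q _ => sum_nonneg fun a _ => hJ0 _ _ _) (mem_Icc.mpr ⟨r.pos, hr1⟩))
      rw [Rat.cast_def r] at h
      have h6 : δ * (n : ℝ) ^ 43 * J r.den r.num α ≤ δ * (n : ℝ) ^ 43 * T α := by gcongr
      rw [mul_assoc δ] at h6
      linarith
  have hTint : ∫ α in (-A)..A, T α ≤ B * (K / (n : ℝ) ^ 15) := by
    rw [hT, intervalIntegral.integral_finsetSum fun q _ =>
      (continuous_finsetSum _ fun a _ => hJc q a).intervalIntegrable _ _]
    calc _ ≤ ∑ q ∈ Icc 1 (n ^ 5), ∑ _a ∈ F q,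
            (q : ℝ) ^ (-(41 / 20) : ℝ) * (K / (n : ℝ) ^ 15) := by
          refine sum_le_sum fun q _ => ?_
          rw [intervalIntegral.integral_finsetSum fun a _ => (hJc q a).intervalIntegrable _ _]
          refine sum_le_sum fun a _ => ?_
          rw [hJ, intervalIntegral.integral_const_mul]
          gcongr
          exact integral_one_add_abs_le (by positivity) hA.le _
      _ ≤ _ := by
          simp_rw [← sum_mul]
          gcongr
          exact hsum _
  have hm1 := hmean n (θ 5) (θ 7) hn3 (hθn _) (hθ1 _) (hθn _) (hθ1 _)
  have hm2 := hmean n (θ 6) (θ 8) hn3 (hθn _) (hθ1 _) (hθn _) (hθ1 _)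
  have hXn := hX n (hn₂.trans (by exact_mod_cast hnn₂))
  calc _ ≤ ∫ α in (-A)..A, (C * (n : ℝ) ^ (151 / 8 : ℝ) * (m₁ α + m₂ α)
        + δ * (n : ℝ) ^ 43 * T α) := by
        refine intervalIntegral.integral_mono_on (by linarith) ?_ ?_ hpoint
        · refine Continuous.intervalIntegrable ?_ _ _
          have := (continuous_genFun n θ).norm
          fun_prop
        · refine Continuous.intervalIntegrable ?_ _ _
          fun_prop
    _ = C * (n : ℝ) ^ (151 / 8 : ℝ) * ((∫ α in (-A)..A, m₁ α) + ∫ α in (-A)..A, m₂ α)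
        + δ * (n : ℝ) ^ 43 * ∫ α in (-A)..A, T α := by
        rw [intervalIntegral.integral_add, intervalIntegral.integral_const_mul,
          intervalIntegral.integral_const_mul, intervalIntegral.integral_add]
        · exact hcm₁.intervalIntegrable _ _
        · exact hcm₂.intervalIntegrable _ _
        · exact Continuous.intervalIntegrable (by fun_prop) _ _
        · exact Continuous.intervalIntegrable (by fun_prop) _ _
    _ ≤ C * (n : ℝ) ^ (151 / 8 : ℝ) * (D * (n : ℝ) ^ 9 + D * (n : ℝ) ^ 9)
        + δ * (n : ℝ) ^ 43 * (B * (K / (n : ℝ) ^ 15)) := by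
        gcongr
    _ = C * (2 * D) * (n : ℝ) ^ (-(1 / 8) : ℝ) * (n : ℝ) ^ 28 + δ * (B * K) * (n : ℝ) ^ 28 := by
        have e : (n : ℝ) ^ (151 / 8 : ℝ) * (n : ℝ) ^ 9
            = (n : ℝ) ^ (-(1 / 8) : ℝ) * (n : ℝ) ^ 28 := by
          rw [← Real.rpow_natCast, ← Real.rpow_natCast, ← Real.rpow_add hn0, ← Real.rpow_add hn0]
          norm_num
        have e2 : (n : ℝ) ^ 43 * (1 / (n : ℝ) ^ 15) = (n : ℝ) ^ 28 := by
          field_simp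
        linear_combination C * (2 * D) * e + δ * (B * K) * e2
    _ ≤ ε / 2 * (n : ℝ) ^ 28 + ε / 2 * (n : ℝ) ^ 28 := by
        gcongr
        rw [hδ, div_mul_eq_mul_div, div_le_iff₀ (by positivity)]
        nlinarith [mul_pos hε hB]
    _ = _ := by ring

/-- The tuples of natural numbers counted by `genFun`. -/
def blockBox (n : ℕ) : Finset (Fin 9 → ℕ) :=
  Fintype.piFinset fun i => range (blockLen n i)

/-- The sum of nine shifted cubes whose values are counted by `genFun`. -/
noncomputable def blockForm (n : ℕ) (θ : Fin 9 → ℝ) (x : Fin 9 → ℕ) : ℝ :=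
  ∑ i, ((x i : ℝ) + blockShift n θ i) ^ 3

theorem addChar_sum {ι : Type*} (s : Finset ι) (f : ι → ℝ) :
    addChar (∑ i ∈ s, f i) = ∏ i ∈ s, addChar (f i) := by
  classical
  induction s using Finset.induction_on with
  | empty => simp [addChar_zero]
  | insert a s ha ih => rw [sum_insert ha, prod_insert ha, addChar_add, ih]

theorem genFun_eq_sum (n : ℕ) (θ : Fin 9 → ℝ) (α : ℝ) :
    genFun n θ α = ∑ x ∈ blockBox n, addChar (α * blockForm n θ x) := by
  unfold genFun cubeSum blockBox blockForm
  rw [prod_univ_sum]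
  refine sum_congr rfl fun x _ => ?_
  rw [mul_sum, addChar_sum]

theorem integral_mul_genFun_re (n : ℕ) (θ : Fin 9 → ℝ) (τ A : ℝ) {w : ℝ → ℝ} (hw : Continuous w) :
    ∫ α in (-A)..A, w α * (genFun n θ α * addChar (-(α * τ))).re
      = ∑ x ∈ blockBox n, ∫ α in (-A)..A,
          w α * Real.cos (2 * Real.pi * (blockForm n θ x - τ) * α) := by
  rw [← intervalIntegral.integral_finsetSum fun x _ =>
    Continuous.intervalIntegrable (by fun_prop) _ _]
  refine intervalIntegral.integral_congr fun α _ => ?_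
  rw [genFun_eq_sum, sum_mul, Complex.re_sum, mul_sum]
  refine sum_congr rfl fun x _ => ?_
  rw [← addChar_add, addChar_re]
  ring_nf

theorem abs_cube_sub_cube_le {P u z : ℝ} (hu0 : 0 ≤ u) (hu : u ≤ P) (hz0 : 0 ≤ z) (hz : z ≤ P) :
    |u ^ 3 - z ^ 3| ≤ 3 * P ^ 2 * |u - z| := by
  have e : u ^ 3 - z ^ 3 = (u ^ 2 + u * z + z ^ 2) * (u - z) := by ring
  rw [e, abs_mul, abs_of_nonneg (by positivity)]
  gcongr
  nlinarith [mul_le_mul hu hz hz0 (hu0.trans hu), pow_le_pow_left₀ hu0 hu 2,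
    pow_le_pow_left₀ hz0 hz 2]

/-- A subbox of the last eight blocks leaving room for the first variable. -/
def tailLen (n : ℕ) : Fin 8 → ℕ :=
  ![n ^ 5 / 16, n ^ 5 / 16, n ^ 5 / 16, n ^ 5 / 16, n ^ 5 / 16, n ^ 5 / 16, n ^ 4, n ^ 4]

theorem tailLen_le (n : ℕ) (i : Fin 8) : tailLen n i ≤ blockLen n i.succ := by
  have h := Nat.div_le_self (n ^ 5) 16
  fin_cases i <;> first | exact h | exact le_rfl

theorem tail_sum_bounds {P Q : ℝ} (hQP : Q * 20 ≤ P) {u : Fin 8 → ℝ} (hu0 : ∀ i, 0 ≤ u i)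
    (hu : ∀ i, i < 6 → u i ≤ P / 16) (h6 : u 6 ≤ Q) (h7 : u 7 ≤ Q) :
    2 * P ^ 3 ≤ u 0 ^ 3 + u 1 ^ 3 + u 2 ^ 3 + u 3 ^ 3 + (P + u 4) ^ 3 + (P + u 5) ^ 3
        + (Q + u 6) ^ 3 + (Q + u 7) ^ 3 ∧
      u 0 ^ 3 + u 1 ^ 3 + u 2 ^ 3 + u 3 ^ 3 + (P + u 4) ^ 3 + (P + u 5) ^ 3
        + (Q + u 6) ^ 3 + (Q + u 7) ^ 3 ≤ 241 / 100 * P ^ 3 := by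
  have hQ0 : 0 ≤ Q := (hu0 6).trans h6
  have hP0 : 0 ≤ P := by linarith
  have hP3 : 0 ≤ P ^ 3 := by positivity
  have small : ∀ i, i < 6 → 0 ≤ u i ^ 3 ∧ u i ^ 3 ≤ P ^ 3 / 4096 := fun i hi =>
    ⟨pow_nonneg (hu0 i) 3, (pow_le_pow_left₀ (hu0 i) (hu i hi) 3).trans_eq (by ring)⟩
  have mid : ∀ i, i < 6 → P ^ 3 ≤ (P + u i) ^ 3 ∧ (P + u i) ^ 3 ≤ 4913 / 4096 * P ^ 3 := by
    intro i hi
    have h0 := hu0 i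
    have h1 := hu i hi
    exact ⟨pow_le_pow_left₀ hP0 (by linarith) 3, (pow_le_pow_left₀ (by positivity)
      (by linarith : P + u i ≤ 17 / 16 * P) 3).trans_eq (by ring)⟩
  have tiny : ∀ i, u i ≤ Q → 0 ≤ (Q + u i) ^ 3 ∧ (Q + u i) ^ 3 ≤ P ^ 3 / 1000 := by
    intro i h1
    have h0 := hu0 i
    exact ⟨by positivity, (pow_le_pow_left₀ (by positivity)
      (by linarith : Q + u i ≤ P / 10) 3).trans_eq (by ring)⟩
  have c0 := small 0 (by decide)
  have c1 := small 1 (by decide)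
  have c2 := small 2 (by decide)
  have c3 := small 3 (by decide)
  have c4 := mid 4 (by decide)
  have c5 := mid 5 (by decide)
  have c6 := tiny 6 h6
  have c7 := tiny 7 h7
  constructor <;> linarith [c0.1, c0.2, c1.1, c1.2, c2.1, c2.2, c3.1, c3.2, c4.1, c4.2, c5.1,
    c5.2, c6.1, c6.2, c7.1, c7.2]

theorem tail_form_bounds {n : ℕ} (hn : 20 ≤ n) {θ : Fin 9 → ℝ} (h0 : ∀ i, 0 ≤ θ i)
    (h1 : ∀ i, θ i ≤ 1) {y : Fin 8 → ℕ} (hy : ∀ i, y i < tailLen n i) :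
    2 * (n : ℝ) ^ 15 ≤ ∑ i, ((y i : ℝ) + blockShift n θ i.succ) ^ 3 ∧
      ∑ i, ((y i : ℝ) + blockShift n θ i.succ) ^ 3 ≤ 241 / 100 * (n : ℝ) ^ 15 := by
  have hn' : (20 : ℝ) ≤ n := by exact_mod_cast hn
  have hQP : (n : ℝ) ^ 4 * 20 ≤ (n : ℝ) ^ 5 := by
    rw [pow_succ _ 4]
    gcongr
  have hlt : ∀ i, (y i : ℝ) + θ i.succ ≤ tailLen n i := by
    intro i
    have h2 : (y i + 1 : ℝ) ≤ tailLen n i := by exact_mod_cast hy i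
    linarith [h1 i.succ]
  have hdiv : ((n ^ 5 / 16 : ℕ) : ℝ) ≤ (n : ℝ) ^ 5 / 16 := by
    have := Nat.cast_div_le (α := ℝ) (m := n ^ 5) (n := 16)
    exact_mod_cast this
  have hu : ∀ i : Fin 8, i < 6 → (y i : ℝ) + θ i.succ ≤ (n : ℝ) ^ 5 / 16 := by
    intro i hi
    have e : tailLen n i = n ^ 5 / 16 := by
      fin_cases i <;> first | rfl | exact absurd hi (by decide)
    have := hlt i
    rw [e] at this
    exact this.trans hdiv
  have h6 : (y 6 : ℝ) + θ (Fin.succ 6) ≤ (n : ℝ) ^ 4 :=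
    (hlt 6).trans_eq (Nat.cast_pow n 4)
  have h7 : (y 7 : ℝ) + θ (Fin.succ 7) ≤ (n : ℝ) ^ 4 :=
    (hlt 7).trans_eq (Nat.cast_pow n 4)
  have hs : ∑ i, ((y i : ℝ) + blockShift n θ i.succ) ^ 3
      = (y 0 + θ (Fin.succ 0)) ^ 3 + (y 1 + θ (Fin.succ 1)) ^ 3 + (y 2 + θ (Fin.succ 2)) ^ 3
        + (y 3 + θ (Fin.succ 3)) ^ 3 + ((n : ℝ) ^ 5 + (y 4 + θ (Fin.succ 4))) ^ 3
        + ((n : ℝ) ^ 5 + (y 5 + θ (Fin.succ 5))) ^ 3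
        + ((n : ℝ) ^ 4 + (y 6 + θ (Fin.succ 6))) ^ 3
        + ((n : ℝ) ^ 4 + (y 7 + θ (Fin.succ 7))) ^ 3 := by
    rw [Fin.sum_univ_eight, add_left_comm ((n : ℝ) ^ 5), add_left_comm ((n : ℝ) ^ 5),
      add_left_comm ((n : ℝ) ^ 4), add_left_comm ((n : ℝ) ^ 4)]
    rfl
  rw [hs, show (n : ℝ) ^ 15 = ((n : ℝ) ^ 5) ^ 3 by ring]
  exact tail_sum_bounds hQP (u := fun i => (y i : ℝ) + θ i.succ)
    (fun i => add_nonneg (Nat.cast_nonneg _) (h0 _)) hu h6 h7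

theorem prod_tailLen (n : ℕ) : ∏ i, tailLen n i = (n ^ 5 / 16) ^ 6 * (n ^ 4) ^ 2 := by
  rw [Fin.prod_univ_eight]
  change n ^ 5 / 16 * (n ^ 5 / 16) * (n ^ 5 / 16) * (n ^ 5 / 16) * (n ^ 5 / 16) * (n ^ 5 / 16)
    * n ^ 4 * n ^ 4 = _
  ring

theorem le_card_blockForm_close {R : ℝ} (hR : 1 ≤ R) {n : ℕ} (hn : 20 ≤ n) (hnR : 200 * R ≤ n)
    {θ : Fin 9 → ℝ} (h0 : ∀ i, 0 ≤ θ i) (h1 : ∀ i, θ i ≤ 1) {τ : ℝ}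
    (hτ1 : 5 / 2 * (n : ℝ) ^ 15 ≤ τ) (hτ2 : τ ≤ 11 / 4 * (n : ℝ) ^ 15) :
    (n : ℝ) ^ 43 / (32 ^ 6 * 200 * R)
      ≤ (#{x ∈ blockBox n | |blockForm n θ x - τ| ≤ (n : ℝ) ^ 15 / (2 * R)} : ℝ) := by
  have hn' : (20 : ℝ) ≤ n := by exact_mod_cast hn
  have hn1 : (1 : ℝ) ≤ n := by linarith
  have hnP : (n : ℝ) ≤ (n : ℝ) ^ 5 := le_self_pow₀ hn1 (by norm_num)
  have e15 : (n : ℝ) ^ 15 = ((n : ℝ) ^ 5) ^ 3 := by ring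
  set P : ℝ := (n : ℝ) ^ 5 with hP
  have hP0 : 0 < P := by positivity
  set L := ⌊P / (100 * R)⌋₊ with hL
  have hL1 : (L : ℝ) ≤ P / (100 * R) := Nat.floor_le (by positivity)
  have hL2 : P / (200 * R) ≤ (L : ℝ) := by
    have h2 := Nat.lt_floor_add_one (P / (100 * R))
    have h3 : 1 ≤ P / (200 * R) := by rw [le_div_iff₀ (by positivity)]; linarith
    have h4 : P / (100 * R) = 2 * (P / (200 * R)) := by field_simp; norm_num
    rw [← hL] at h2
    linarith
  set rest : (Fin 8 → ℕ) → ℝ := fun y => ∑ i, ((y i : ℝ) + blockShift n θ i.succ) ^ 3 with hrest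
  set z : (Fin 8 → ℕ) → ℝ := fun y => (τ - rest y) ^ ((3 : ℕ) : ℝ)⁻¹ with hz
  set box : Finset (Fin 8 → ℕ) := Fintype.piFinset fun i => range (tailLen n i) with hbox
  have hcard : #(box ×ˢ range L)
      ≤ #{x ∈ blockBox n | |blockForm n θ x - τ| ≤ (n : ℝ) ^ 15 / (2 * R)} := by
    refine card_le_card_of_injOn (fun p => Fin.cons (⌊z p.1⌋₊ + p.2) p.1) ?_ ?_
    · rintro ⟨y, k⟩ hp
      rw [mem_coe, mem_product, hbox, Fintype.mem_piFinset] at hp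
      have hy : ∀ i, y i < tailLen n i := fun i => mem_range.mp (hp.1 i)
      have hk : (k : ℝ) + 1 ≤ L := by exact_mod_cast mem_range.mp hp.2
      obtain ⟨r1, r2⟩ := tail_form_bounds hn h0 h1 hy
      change 2 * (n : ℝ) ^ 15 ≤ rest y at r1
      change rest y ≤ _ at r2
      have hP3 : 0 < P ^ 3 := by positivity
      rw [e15] at r1 r2 hτ1 hτ2
      have ht0 : 0 ≤ τ - rest y := by linarith
      have hz0 : 0 ≤ z y := Real.rpow_nonneg ht0 _
      have hz3 : z y ^ 3 = τ - rest y := Real.rpow_inv_natCast_pow ht0 (by norm_num)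
      have hzP : z y ≤ 91 / 100 * P := by
        refine le_of_pow_le_pow_left₀ (n := 3) (by norm_num) (by positivity) ?_
        rw [hz3]
        nlinarith
      have hf1 := Nat.floor_le hz0
      have hf2 := Nat.lt_floor_add_one (z y)
      have hL3 : P / (100 * R) ≤ P / 100 := by gcongr; linarith
      have hk0 : (0 : ℝ) ≤ k := Nat.cast_nonneg k
      set u : ℝ := ((⌊z y⌋₊ + k : ℕ) : ℝ) + θ 0 with hu
      have hu' : u = ⌊z y⌋₊ + k + θ 0 := by rw [hu]; push_cast; ring
      have hθ0 := h0 0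
      have hθ1 := h1 0
      have hub : |u - z y| ≤ L := by
        rw [abs_le]
        constructor <;> linarith
      have hclose := abs_cube_sub_cube_le (P := P) (u := u) (z := z y) (by positivity)
        (by linarith) hz0 (by linarith)
      have hform : blockForm n θ (Fin.cons (⌊z y⌋₊ + k) y) = u ^ 3 + rest y := by
        rw [blockForm, Fin.sum_univ_succ]
        rfl
      rw [mem_coe, mem_filter]
      refine ⟨?_, ?_⟩
      · rw [blockBox, Fintype.mem_piFinset]
        intro i
        refine Fin.cases ?_ (fun j => ?_) i
        · simp only [Fin.cons_zero, mem_range]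
          change _ < n ^ 5
          have : ((⌊z y⌋₊ + k : ℕ) : ℝ) < ((n ^ 5 : ℕ) : ℝ) := by
            push_cast
            linarith
          exact_mod_cast this
        · simp only [Fin.cons_succ, mem_range]
          exact (hy j).trans_le (tailLen_le n j)
      · rw [hform, show u ^ 3 + rest y - τ = u ^ 3 - z y ^ 3 by rw [hz3]; ring, e15]
        refine hclose.trans ?_
        calc 3 * P ^ 2 * |u - z y| ≤ 3 * P ^ 2 * (P / (100 * R)) := by
              gcongr
              linarith
          _ = 3 / 50 * (P ^ 3 / (2 * R)) := by field_simp; ring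
          _ ≤ _ := by
              have : 0 ≤ P ^ 3 / (2 * R) := by positivity
              linarith
    · rintro ⟨y, k⟩ _ ⟨y', k'⟩ _ h
      obtain ⟨ha, hb⟩ := Fin.cons_inj.mp h
      simp only at ha hb
      subst hb
      simpa using ha
  have hH : P / 32 ≤ ((n ^ 5 / 16 : ℕ) : ℝ) := by
    have h2 : n ^ 5 < (n ^ 5 / 16 + 1) * 16 := by omega
    have h3 : P < (((n ^ 5 / 16 : ℕ) : ℝ) + 1) * 16 := by
      rw [hP]
      exact_mod_cast h2
    linarith
  have hc : ((#(box ×ˢ range L) : ℕ) : ℝ)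
      = ((n ^ 5 / 16 : ℕ) : ℝ) ^ 6 * ((n : ℝ) ^ 4) ^ 2 * L := by
    rw [card_product, hbox, Fintype.card_piFinset, card_range]
    simp only [card_range, prod_tailLen]
    push_cast
    ring
  calc _ = (P / 32) ^ 6 * ((n : ℝ) ^ 4) ^ 2 * (P / (200 * R)) := by
        rw [hP]
        field_simp
    _ ≤ ((n ^ 5 / 16 : ℕ) : ℝ) ^ 6 * ((n : ℝ) ^ 4) ^ 2 * L := by gcongr
    _ ≤ _ := by
        rw [← hc]
        exact_mod_cast hcard

theorem continuous_addChar_neg_mul (τ : ℝ) : Continuous fun α : ℝ => addChar (-(α * τ)) :=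
  continuous_addChar.comp (by fun_prop)

theorem abs_detector_sub_tri_le {b β : ℝ} (hb : 0 < b) (hβ : 0 < β) (hβ1 : β ≤ 1) (α : ℝ) :
    |detector b α - b / β * max (β - |α|) 0| ≤ (6 * b + 6) * min 1 (|α| / β) := by
  have ha := abs_nonneg α
  rcases le_total β |α| with h | h
  · rw [max_eq_right (by linarith), mul_zero, sub_zero,
      min_eq_left ((one_le_div hβ).mpr h), mul_one]
    linarith [abs_detector_le hb α]
  · rw [max_eq_left (by linarith), min_eq_right ((div_le_one hβ).mpr h)]
    have e : detector b α - b / β * (β - |α|) = (detector b α - b) + b * (|α| / β) := by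
      field_simp
      ring
    have h1 : |α| ≤ |α| / β := le_div_self ha hβ hβ1
    have h2 : 0 ≤ b * (|α| / β) := by positivity
    rw [e]
    calc _ ≤ |detector b α - b| + |b * (|α| / β)| := abs_add_le _ _
      _ ≤ 6 * |α| + b * (|α| / β) := by
          rw [abs_of_nonneg h2]
          gcongr
          exact abs_detector_sub_le hb α
      _ ≤ _ := by nlinarith

theorem exists_blockForm_close {θ₀ : ℝ} (hθ : Irrational θ₀) (h0 : 0 ≤ θ₀) (h1 : θ₀ ≤ 1)
    {η : ℝ} (hη : 0 < η) : ∃ n₀ : ℕ, ∀ n ≥ n₀, ∀ θ : Fin 9 → ℝ, θ 0 = θ₀ → (∀ i, 0 ≤ θ i) →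
      (∀ i, θ i ≤ 1) → ∀ τ : ℝ, 5 / 2 * (n : ℝ) ^ 15 ≤ τ → τ ≤ 11 / 4 * (n : ℝ) ^ 15 →
        ∃ x : Fin 9 → ℕ, |blockForm n θ x - τ| < η := by
  have hπ := Real.pi_pos
  set b : ℝ := 1 / (Real.pi * η) with hb
  have hb0 : 0 < b := by positivity
  set c : ℝ := 1 / (32 ^ 6 * 200) with hc
  have hc0 : 0 < c := by positivity
  obtain ⟨R', hR'0, n₁, hn₁, herr⟩ := exists_integral_norm_genFun_le hθ h0 h1
    (A := 3 * b + 1) (by positivity) (ε := b * c / (8 * (6 * b + 6))) (by positivity)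
  set R := max R' 1 with hR
  have hR1 : 1 ≤ R := le_max_right _ _
  obtain ⟨n₂, hn₂⟩ := exists_nat_ge (200 * R)
  refine ⟨max n₁ (max n₂ 20), fun n hn θ hθ0 hθn hθ1 τ hτ1 hτ2 => ?_⟩
  have hnn₁ : n₁ ≤ n := le_trans (by simp) hn
  have hnn₂ : n₂ ≤ n := le_trans (by simp) hn
  have hn20 : 20 ≤ n := le_trans (by simp) hn
  have hn' : (20 : ℝ) ≤ n := by exact_mod_cast hn20
  have hn0 : (0 : ℝ) < n := by linarith
  have hnR : 200 * R ≤ n := hn₂.trans (by exact_mod_cast hnn₂)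
  set A : ℝ := 3 * b + 1 with hA
  have hA0 : 0 < A := by positivity
  set β : ℝ := R / (n : ℝ) ^ 15 with hβ
  have hβ0 : 0 < β := by positivity
  have hβ1 : β ≤ 1 := by
    rw [hβ, div_le_one (by positivity)]
    have := le_self_pow₀ (by linarith : (1 : ℝ) ≤ n) (show 15 ≠ 0 by norm_num)
    linarith
  have hcard := le_card_blockForm_close hR1 hn20 hnR hθn hθ1 hτ1 hτ2
  set h : ℝ → ℝ := fun α => (genFun n θ α * addChar (-(α * τ))).re with hh
  have hhc : Continuous h :=
    Complex.continuous_re.comp ((continuous_genFun n θ).mul (continuous_addChar_neg_mul τ))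
  have hhle : ∀ α, |h α| ≤ ‖genFun n θ α‖ := by
    intro α
    refine (Complex.abs_re_le_norm _).trans ?_
    rw [norm_mul, norm_addChar, mul_one]
  have hGc : Continuous fun α => ‖genFun n θ α‖ := (continuous_genFun n θ).norm
  have hdc := continuous_detector b
  by_contra! hcon
  have hS : ∫ α in (-A)..A, detector b α * h α ≤ 0 := by
    rw [hh, integral_mul_genFun_re n θ τ A hdc]
    refine sum_nonpos fun x _ => integral_detector_cos_nonpos hb0 (by linarith) ?_
    rw [abs_mul, abs_of_pos (by positivity : 0 < 2 * Real.pi)]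
    calc (2 : ℝ) = b * (2 * Real.pi * η) := by rw [hb]; field_simp
      _ ≤ _ := by
          gcongr
          exact hcon x
  have hW : β ^ 2 / 4 * ((n : ℝ) ^ 43 / (32 ^ 6 * 200 * R))
      ≤ ∫ α in (-A)..A, max (β - |α|) 0 * h α := by
    rw [hh, integral_mul_genFun_re n θ τ A (by fun_prop)]
    calc _ ≤ β ^ 2 / 4 *
            (#{x ∈ blockBox n | |blockForm n θ x - τ| ≤ (n : ℝ) ^ 15 / (2 * R)} : ℝ) := by gcongr
      _ = ∑ x ∈ blockBox n with |blockForm n θ x - τ| ≤ (n : ℝ) ^ 15 / (2 * R), β ^ 2 / 4 := by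
          rw [sum_const, nsmul_eq_mul, mul_comm]
      _ ≤ ∑ x ∈ blockBox n with |blockForm n θ x - τ| ≤ (n : ℝ) ^ 15 / (2 * R),
            ∫ α in (-A)..A, max (β - |α|) 0
              * Real.cos (2 * Real.pi * (blockForm n θ x - τ) * α) := by
          refine sum_le_sum fun x hx => le_integral_tri_cos hβ0.le (by linarith) ?_
          have hx' := (mem_filter.mp hx).2
          rw [abs_mul, abs_mul, abs_of_pos hβ0, abs_of_pos (by positivity : 0 < 2 * Real.pi)]
          calc _ ≤ 2 * Real.pi * ((n : ℝ) ^ 15 / (2 * R)) * β := by gcongr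
            _ = _ := by
                rw [hβ]
                field_simp
      _ ≤ _ := sum_le_sum_of_subset_of_nonneg (filter_subset _ _) fun x _ _ =>
          integral_tri_cos_nonneg hβ0.le (by linarith) _
  have hdiff : (b / β * ∫ α in (-A)..A, max (β - |α|) 0 * h α)
      - (6 * b + 6) * ∫ α in (-A)..A, min 1 (|α| * (n : ℝ) ^ 15 / R') * ‖genFun n θ α‖
      ≤ ∫ α in (-A)..A, detector b α * h α := by
    rw [← intervalIntegral.integral_const_mul, ← intervalIntegral.integral_const_mul,
      ← intervalIntegral.integral_sub (Continuous.intervalIntegrable (by fun_prop) _ _)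
        (Continuous.intervalIntegrable (by fun_prop) _ _)]
    refine intervalIntegral.integral_mono_on (by linarith)
      (Continuous.intervalIntegrable (by fun_prop) _ _)
      (Continuous.intervalIntegrable (by fun_prop) _ _) fun α _ => ?_
    have e1 := abs_detector_sub_tri_le hb0 hβ0 hβ1 α
    have e2 : |α| / β ≤ |α| * (n : ℝ) ^ 15 / R' := by
      rw [hβ, div_div_eq_mul_div]
      gcongr
      exact le_max_left _ _
    have e3 : |(detector b α - b / β * max (β - |α|) 0) * h α|
        ≤ (6 * b + 6) * min 1 (|α| * (n : ℝ) ^ 15 / R') * ‖genFun n θ α‖ := by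
      rw [abs_mul]
      refine mul_le_mul (e1.trans ?_) (hhle α) (abs_nonneg _) (by positivity)
      gcongr
    have e4 := (abs_le.mp e3).1
    linarith
  have hfin := herr n hnn₁ θ hθ0 hθn hθ1
  have e1 : b / β * (β ^ 2 / 4 * ((n : ℝ) ^ 43 / (32 ^ 6 * 200 * R)))
      = b * c / 4 * (n : ℝ) ^ 28 := by
    rw [hβ, hc]
    field_simp
  have e2 : b / β * (β ^ 2 / 4 * ((n : ℝ) ^ 43 / (32 ^ 6 * 200 * R)))
      ≤ b / β * ∫ α in (-A)..A, max (β - |α|) 0 * h α :=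
    mul_le_mul_of_nonneg_left hW (by positivity)
  have e3 : (6 * b + 6) * ∫ α in (-A)..A, min 1 (|α| * (n : ℝ) ^ 15 / R') * ‖genFun n θ α‖
      ≤ (6 * b + 6) * (b * c / (8 * (6 * b + 6)) * (n : ℝ) ^ 28) :=
    mul_le_mul_of_nonneg_left hfin (by positivity)
  have e4 : (6 * b + 6) * (b * c / (8 * (6 * b + 6)) * (n : ℝ) ^ 28)
      = b * c / 8 * (n : ℝ) ^ 28 := by
    field_simp
  have e5 : 0 < b * c / 8 * (n : ℝ) ^ 28 := by positivity
  linarith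

theorem exists_pow_scale (n₀ : ℕ) : ∃ T : ℝ, ∀ τ ≥ T, ∃ n ≥ n₀,
    5 / 2 * (n : ℝ) ^ 15 ≤ τ ∧ τ ≤ 11 / 4 * (n : ℝ) ^ 15 := by
  refine ⟨5 / 2 * ((n₀ : ℝ) + 200) ^ 15, fun τ hτ => ?_⟩
  have hex : ∃ m : ℕ, τ < 5 / 2 * ((m : ℝ) + 1) ^ 15 := by
    obtain ⟨m, hm⟩ := exists_nat_ge τ
    refine ⟨m, ?_⟩
    have := le_self_pow₀ (by linarith [Nat.cast_nonneg (α := ℝ) m] : (1 : ℝ) ≤ (m : ℝ) + 1)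
      (show 15 ≠ 0 by norm_num)
    linarith
  classical
  have hspec := Nat.find_spec hex
  set m := Nat.find hex with hm
  have hbig : n₀ + 200 ≤ m := by
    by_contra! hlt
    have h1 : (m : ℝ) + 1 ≤ (n₀ : ℝ) + 200 := by exact_mod_cast hlt
    have h2 := pow_le_pow_left₀ (by positivity) h1 15
    linarith
  have hle : 5 / 2 * (m : ℝ) ^ 15 ≤ τ := by
    have h1 := Nat.find_min hex (m := m - 1) (by omega)
    rw [not_lt] at h1
    have h2 : ((m - 1 : ℕ) : ℝ) + 1 = m := by
      have : m - 1 + 1 = m := by omega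
      exact_mod_cast this
    rwa [h2] at h1
  refine ⟨m, by omega, hle, hspec.le.trans ?_⟩
  have hm200 : (200 : ℝ) ≤ m := by
    have : 200 ≤ m := by omega
    exact_mod_cast this
  have h3 : ((m : ℝ) + 1) ^ 15 ≤ (201 / 200 * m) ^ 15 :=
    pow_le_pow_left₀ (by positivity) (by linarith) 15
  rw [mul_pow] at h3
  have h4 : (201 / 200 : ℝ) ^ 15 ≤ 11 / 10 := by norm_num
  have h5 : (0 : ℝ) ≤ (m : ℝ) ^ 15 := by positivity
  nlinarith [mul_le_mul_of_nonneg_right h4 h5]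

/-- The integer translates by which the last four blocks are shifted. -/
def blockOffset (n : ℕ) : Fin 9 → ℕ :=
  ![0, 0, 0, 0, 0, n ^ 5, n ^ 5, n ^ 4, n ^ 4]

theorem blockShift_eq (n : ℕ) (θ : Fin 9 → ℝ) (i : Fin 9) :
    blockShift n θ i = blockOffset n i + θ i := by
  fin_cases i <;> simp [blockShift, blockOffset]

theorem sums_of_nine_shifted_cubes (μ : Fin 9 → ℝ) (hμ : Irrational (μ 0)) {η : ℝ} (hη : 0 < η) :
    ∃ T : ℝ, ∀ τ ≥ T, ∃ x : Fin 9 → ℤ, (∀ i, μ i < (x i : ℝ)) ∧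
      |(∑ i, ((x i : ℝ) - μ i) ^ 3) - τ| < η := by
  set θ : Fin 9 → ℝ := fun i => ((⌊μ i⌋ + 1 : ℤ) : ℝ) - μ i with hθ
  have hpos : ∀ i, 0 < θ i := by
    intro i
    have := Int.lt_floor_add_one (μ i)
    simp only [hθ]
    push_cast
    linarith
  have hle : ∀ i, θ i ≤ 1 := by
    intro i
    have := Int.floor_le (μ i)
    simp only [hθ]
    push_cast
    linarith
  obtain ⟨n₀, h⟩ := exists_blockForm_close (hμ.intCast_sub (⌊μ 0⌋ + 1)) (hpos 0).le (hle 0) hη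
  obtain ⟨T, hT⟩ := exists_pow_scale n₀
  refine ⟨T, fun τ hτ => ?_⟩
  obtain ⟨n, hn, hn1, hn2⟩ := hT τ hτ
  obtain ⟨y, hy⟩ := h n hn θ rfl (fun i => (hpos i).le) hle τ hn1 hn2
  have e : ∀ i, (((y i : ℤ) + (blockOffset n i : ℤ) + (⌊μ i⌋ + 1) : ℤ) : ℝ) - μ i
      = y i + blockShift n θ i := by
    intro i
    rw [blockShift_eq]
    simp only [hθ]
    push_cast
    ring
  refine ⟨fun i => (y i : ℤ) + (blockOffset n i : ℤ) + (⌊μ i⌋ + 1), fun i => ?_, ?_⟩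
  · rw [← sub_pos, e, blockShift_eq]
    have := hpos i
    positivity
  · simp_rw [e]
    exact hy

/-- **Sums of cubes with shifts, Waring-type result.**
If `s ≥ 9`, `μ₁` is irrational and `η > 0`, then for all sufficiently large
positive `τ` there are integers `xᵢ > μᵢ` with `|F(x) - τ| < η`, where
`F(x) = ∑ᵢ (xᵢ - μᵢ)³`. -/
theorem sums_of_shifted_cubes_waring
    (s : ℕ) (hs : 9 ≤ s) (μ : Fin s → ℝ)
    (hμ : Irrational (μ ⟨0, by omega⟩))
    (η : ℝ) (hη : 0 < η) :
    ∃ τ₀ : ℝ, 0 < τ₀ ∧ ∀ τ : ℝ, τ₀ ≤ τ →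
      ∃ x : Fin s → ℤ, (∀ i, μ i < (x i : ℝ)) ∧
        |(∑ i, ((x i : ℝ) - μ i) ^ 3) - τ| < η := by
  obtain ⟨k, rfl⟩ := Nat.exists_eq_add_of_le hs
  obtain ⟨T, hT⟩ := sums_of_nine_shifted_cubes (fun i => μ (Fin.castAdd k i)) hμ hη
  set d : ℝ := ∑ j : Fin k, (((⌊μ (Fin.natAdd 9 j)⌋ + 1 : ℤ) : ℝ) - μ (Fin.natAdd 9 j)) ^ 3 with hd
  refine ⟨max (T + d) 1, by positivity, fun τ hτ => ?_⟩
  obtain ⟨x, hx1, hx2⟩ := hT (τ - d) (by linarith [(le_max_left (T + d) 1).trans hτ])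
  refine ⟨Fin.append x fun j => ⌊μ (Fin.natAdd 9 j)⌋ + 1, fun i => ?_, ?_⟩
  · refine Fin.addCases (fun i => ?_) (fun j => ?_) i
    · rw [Fin.append_left]
      exact hx1 i
    · rw [Fin.append_right]
      push_cast
      exact Int.lt_floor_add_one _
  · rw [Fin.sum_univ_add]
    simp only [Fin.append_left, Fin.append_right]
    rw [← hd]
    convert hx2 using 2
    ring
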